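/- Given n ≥ 1 and s > 0, there exist constants k♯ and C♯ depending only on n, s such that for every finite set E ⊆ ℝⁿ and every function f : E → [0,∞), one has max_{S⊆E, #S≤k♯} ‖f‖_{F^s(S)} ≤ ‖f‖_{F^s(E)} ≤ C♯ · max_{S⊆E, #S≤k♯} ‖f‖_{F^s(S)}. -/

import Mathlib

open Set ENNReal
open scoped NNReal

noncomputable section

/-- The largest integer strictly less than `s` (for `s > 0`). -/
def lowFloor (s : ℝ) : ℕ := ⌈s⌉₊ - 1

variable {E : Type*} [NormedAddCommGroup E] [NormedSpace ℝ E]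

/-- `max_{0 ≤ m < s} sup_{x ∈ Ω} |∇^m F(x)|`, valued in `ℝ≥0∞`. -/
def derivSup (s : ℝ) (Ω : Set E) (F : E → ℝ) : ℝ≥0∞ :=
  ⨆ (m : ℕ) (_ : m ≤ lowFloor s) (x : E) (_ : x ∈ Ω),
    (‖iteratedFDerivWithin ℝ m F Ω x‖₊ : ℝ≥0∞)

/-- The homogeneous Hölder seminorm `‖F‖_{Ċ^s(Ω)}`, valued in `ℝ≥0∞`. -/
def holderSemi (s : ℝ) (Ω : Set E) (F : E → ℝ) : ℝ≥0∞ :=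
  ⨆ (x : E) (_ : x ∈ Ω) (y : E) (_ : y ∈ Ω) (_ : x ≠ y),
    (‖iteratedFDerivWithin ℝ (lowFloor s) F Ω x
        - iteratedFDerivWithin ℝ (lowFloor s) F Ω y‖₊ : ℝ≥0∞)
      / ENNReal.ofReal (‖x - y‖ ^ (s - (lowFloor s : ℝ)))

/-- The Hölder norm `‖F‖_{C^s(Ω)}`, valued in `ℝ≥0∞`. -/
def csNorm (s : ℝ) (Ω : Set E) (F : E → ℝ) : ℝ≥0∞ :=
  derivSup s Ω F + holderSemi s Ω F

/-- Membership in `C^s(Ω)`. -/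
def MemCs (s : ℝ) (Ω : Set E) (F : E → ℝ) : Prop :=
  ContDiffOn ℝ (lowFloor s : ℕ∞) F Ω ∧ csNorm s Ω F ≠ ∞

/-- The flat seminorm `‖F‖_{Ḟ^s(Ω)}`, valued in `ℝ≥0∞`.  (In `ℝ≥0∞` one has
`0/0 = 0` and `a/0 = ∞` for `a ≠ 0`, matching the paper's conventions; for
`0 < s < 1` the supremum is empty, hence `0`.) -/
def flatSemi (s : ℝ) (Ω : Set E) (F : E → ℝ) : ℝ≥0∞ :=
  ⨆ (m : ℕ) (_ : 1 ≤ m) (_ : m ≤ lowFloor s) (x : E) (_ : x ∈ Ω),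
    ((‖iteratedFDerivWithin ℝ m F Ω x‖₊ : ℝ≥0∞) ^ s
      / ENNReal.ofReal (F x) ^ (s - (m : ℝ))) ^ (1 / (m : ℝ))

/-- Membership in the cone `F^s(Ω)`. -/
def MemFs (s : ℝ) (Ω : Set E) (F : E → ℝ) : Prop :=
  MemCs s Ω F ∧ (∀ x ∈ Ω, 0 ≤ F x) ∧ flatSemi s Ω F ≠ ∞

/-- The norm `‖F‖_{F^s(Ω)} = ‖F‖_{C^s(Ω)} + ‖F‖_{Ḟ^s(Ω)}`. -/
def fsNorm (s : ℝ) (Ω : Set E) (F : E → ℝ) : ℝ≥0∞ :=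
  csNorm s Ω F + flatSemi s Ω F

/-- `sup_{x ∈ Ω} |F(x)|`, valued in `ℝ≥0∞`. -/
def supNormSet (Ω : Set E) (F : E → ℝ) : ℝ≥0∞ :=
  ⨆ (x : E) (_ : x ∈ Ω), (‖F x‖₊ : ℝ≥0∞)

/-- `P` is (the function given by) a polynomial of degree at most `D`. -/
def IsPolyDeg (D : ℕ) (P : E → ℝ) : Prop :=
  ContDiff ℝ (⊤ : ℕ∞) P ∧ ∀ x, iteratedFDeriv ℝ (D + 1) P x = 0

/-- The degree-`D` Taylor polynomial (jet) of `F` at `x`, as a function. -/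
def jetAt (D : ℕ) (F : E → ℝ) (x : E) : E → ℝ :=
  fun y => ∑ m ∈ Finset.range (D + 1),
    (iteratedFDeriv ℝ m F x fun _ => y - x) / m.factorial

/-- The degree-`D` Taylor polynomial of `F` at `x` using derivatives within `Ω`. -/
def jetWithinAt (D : ℕ) (F : E → ℝ) (Ω : Set E) (x : E) : E → ℝ :=
  fun y => ∑ m ∈ Finset.range (D + 1),
    (iteratedFDerivWithin ℝ m F Ω x fun _ => y - x) / m.factorial

/-- The pointwise flatness quantity `max_{1≤m<s} (|∇^m P(x)|^s / P(x)^{s-m})^{1/m}`. -/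
def jetFlatAt (s : ℝ) (P : E → ℝ) (x : E) : ℝ≥0∞ :=
  ⨆ (m : ℕ) (_ : 1 ≤ m) (_ : m ≤ lowFloor s),
    ((‖iteratedFDeriv ℝ m P x‖₊ : ℝ≥0∞) ^ s
      / ENNReal.ofReal (P x) ^ (s - (m : ℝ))) ^ (1 / (m : ℝ))

/-- The set `Γ(x₀, M)` of flat nonnegative jets. -/
def Gamma (s : ℝ) (x₀ : E) (M : ℝ) : Set (E → ℝ) :=
  {P | IsPolyDeg (lowFloor s) P ∧ 0 ≤ P x₀ ∧
    (∀ m ≤ lowFloor s, ‖iteratedFDeriv ℝ m P x₀‖ ≤ M) ∧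
    jetFlatAt s P x₀ ≤ ENNReal.ofReal M}

/-- `‖P⃗‖_{J C^s(E)}` for a family of jets `P : E → (E → ℝ)`. -/
def jetCNorm (s : ℝ) (Eset : Set E) (P : E → E → ℝ) : ℝ≥0∞ :=
  (⨆ (x : E) (_ : x ∈ Eset) (m : ℕ) (_ : m ≤ lowFloor s),
      (‖iteratedFDeriv ℝ m (P x) x‖₊ : ℝ≥0∞))
  + ⨆ (x : E) (_ : x ∈ Eset) (y : E) (_ : y ∈ Eset) (_ : x ≠ y)
      (m : ℕ) (_ : m ≤ lowFloor s),
      (‖iteratedFDeriv ℝ m (P x - P y) y‖₊ : ℝ≥0∞)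
        / ENNReal.ofReal (‖x - y‖ ^ (s - (m : ℝ)))

/-- `‖P⃗‖_{J Ḟ^s(E)}` for a family of jets. -/
def jetFlatNorm (s : ℝ) (Eset : Set E) (P : E → E → ℝ) : ℝ≥0∞ :=
  ⨆ (x : E) (_ : x ∈ Eset) (m : ℕ) (_ : 1 ≤ m) (_ : m ≤ lowFloor s),
    ((‖iteratedFDeriv ℝ m (P x) x‖₊ : ℝ≥0∞) ^ s
      / ENNReal.ofReal |P x x| ^ (s - (m : ℝ))) ^ (1 / (m : ℝ))

/-- `‖P⃗‖_{J F^s(E)}`. -/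
def jetFsNorm (s : ℝ) (Eset : Set E) (P : E → E → ℝ) : ℝ≥0∞ :=
  jetCNorm s Eset P + jetFlatNorm s Eset P

/-- The trace norm `‖f‖_{F^s(S)}` (with `inf ∅ = ∞`). -/
def traceNorm (s : ℝ) (S : Set E) (f : E → ℝ) : ℝ≥0∞ :=
  ⨅ (F : E → ℝ) (_ : MemFs s (univ : Set E) F ∧ ∀ x ∈ S, F x = f x),
    fsNorm s (univ : Set E) F

namespace FlatFP

section

/-- Euclidean `n`-space. -/
abbrev Sp (n : ℕ) := EuclideanSpace ℝ (Fin n)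

/-- Real polynomials in `n` variables; they serve as (untruncated) jets. -/
abbrev Poly (n : ℕ) := MvPolynomial (Fin n) ℝ

/-- The multi-indices of order at most `m`. -/
def idx (n m : ℕ) : Finset (Fin n →₀ ℕ) :=
  (Finset.range (m + 1)).biUnion fun j => (Finset.univ : Finset (Fin n)).finsuppAntidiag j

variable {n m : ℕ}

theorem mem_idx {α : Fin n →₀ ℕ} : α ∈ idx n m ↔ α.degree ≤ m := by
  simp only [idx, Finset.mem_biUnion, Finset.mem_range, Finset.mem_finsuppAntidiag,
    Finset.subset_univ, and_true, Finsupp.degree_eq_sum]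
  change (∃ a < m + 1, ∑ i, α i = a) ↔ _
  constructor
  · rintro ⟨a, ha, h⟩; omega
  · intro h; exact ⟨_, by omega, rfl⟩

theorem zero_mem_idx : (0 : Fin n →₀ ℕ) ∈ idx n m := mem_idx.2 (by simp)

theorem degree_add_single (α : Fin n →₀ ℕ) (i : Fin n) :
    (α + Finsupp.single i 1).degree = α.degree + 1 := by
  simp [map_add, Finsupp.degree_single]

theorem apply_le_degree (α : Fin n →₀ ℕ) (i : Fin n) : α i ≤ α.degree := by
  rw [Finsupp.degree_eq_sum]
  exact Finset.single_le_sum (f := fun i => α i) (fun _ _ => Nat.zero_le _) (Finset.mem_univ i)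

/-- The jet norm at scale `δ`. -/
def wn (m : ℕ) (δ : ℝ) (p : Poly n) : ℝ :=
  ∑ α ∈ idx n m, |p.coeff α| * δ ^ α.degree

section wn
variable {δ : ℝ} {p q : Poly n}

theorem wn_nonneg (hδ : 0 ≤ δ) (p : Poly n) : 0 ≤ wn m δ p :=
  Finset.sum_nonneg fun _ _ => by positivity

theorem wn_add_le (hδ : 0 ≤ δ) (p q : Poly n) : wn m δ (p + q) ≤ wn m δ p + wn m δ q := by
  rw [wn, wn, wn, ← Finset.sum_add_distrib]
  refine Finset.sum_le_sum fun α _ => ?_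
  rw [MvPolynomial.coeff_add, ← add_mul]
  gcongr
  exact abs_add_le _ _

theorem wn_neg (p : Poly n) : wn m δ (-p) = wn m δ p := by simp [wn]

theorem wn_sub_comm (p q : Poly n) : wn m δ (p - q) = wn m δ (q - p) := by
  rw [← wn_neg, neg_sub]

theorem wn_sub_le (hδ : 0 ≤ δ) (p q : Poly n) : wn m δ (p - q) ≤ wn m δ p + wn m δ q := by
  rw [sub_eq_add_neg]
  exact (wn_add_le hδ _ _).trans (by rw [wn_neg])

theorem wn_le_add_sub (hδ : 0 ≤ δ) (p q : Poly n) :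
    wn m δ p ≤ wn m δ q + wn m δ (p - q) := by
  have := wn_add_le (m := m) hδ q (p - q)
  rwa [add_sub_cancel] at this

theorem wn_smul (c : ℝ) (p : Poly n) : wn m δ (c • p) = |c| * wn m δ p := by
  simp [wn, Finset.mul_sum, abs_mul, mul_assoc]

@[simp] theorem wn_zero : wn m δ (0 : Poly n) = 0 := by simp [wn]

theorem wn_sum_le (hδ : 0 ≤ δ) {ι : Type*} (t : Finset ι) (f : ι → Poly n) :
    wn m δ (∑ i ∈ t, f i) ≤ ∑ i ∈ t, wn m δ (f i) := by
  classical
  induction t using Finset.induction_on with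
  | empty => simp
  | insert a t ha ih =>
    rw [Finset.sum_insert ha, Finset.sum_insert ha]
    exact (wn_add_le hδ _ _).trans (by gcongr)

theorem wn_C (c : ℝ) : wn m δ (MvPolynomial.C c : Poly n) = |c| := by
  classical
  rw [wn, Finset.sum_eq_single 0]
  · simp
  · intro b _ hb
    rw [MvPolynomial.coeff_C, if_neg (Ne.symm hb)]; simp
  · intro h; exact absurd zero_mem_idx h

theorem wn_one : wn m δ (1 : Poly n) = 1 := by
  have := wn_C (n := n) (m := m) (δ := δ) 1
  simpa using this

theorem abs_coeff_le_wn (hδ : 0 ≤ δ) {α : Fin n →₀ ℕ} (hα : α.degree ≤ m) (p : Poly n) :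
    |p.coeff α| * δ ^ α.degree ≤ wn m δ p :=
  Finset.single_le_sum (f := fun α : Fin n →₀ ℕ => |p.coeff α| * δ ^ α.degree)
    (fun _ _ => by positivity) (mem_idx.2 hα)

theorem abs_coeff_zero_le_wn (hδ : 0 ≤ δ) (p : Poly n) : |p.coeff 0| ≤ wn m δ p := by
  simpa using abs_coeff_le_wn (m := m) hδ (α := 0) (by simp) p

theorem wn_eq_zero_iff (hδ : 0 < δ) :
    wn m δ p = 0 ↔ ∀ α : Fin n →₀ ℕ, α.degree ≤ m → p.coeff α = 0 := by
  rw [wn, Finset.sum_eq_zero_iff_of_nonneg (fun _ _ => by positivity)]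
  simp only [mem_idx]
  refine forall₂_congr fun α _ => ?_
  simp [hδ.ne']

theorem wn_mul_le (hδ : 0 ≤ δ) (p q : Poly n) : wn m δ (p * q) ≤ wn m δ p * wn m δ q := by
  classical
  calc wn m δ (p * q)
      ≤ ∑ α ∈ idx n m, ∑ x ∈ Finset.HasAntidiagonal.antidiagonal α,
          (|p.coeff x.1| * δ ^ x.1.degree) * (|q.coeff x.2| * δ ^ x.2.degree) := by
        refine Finset.sum_le_sum fun α _ => ?_
        rw [MvPolynomial.coeff_mul]
        refine (mul_le_mul_of_nonneg_right (Finset.abs_sum_le_sum_abs _ _) (by positivity)).trans ?_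
        rw [Finset.sum_mul]
        refine Finset.sum_le_sum fun x hx => le_of_eq ?_
        rw [← Finset.HasAntidiagonal.mem_antidiagonal.1 hx, map_add, pow_add, abs_mul]; ring
    _ = ∑ y ∈ (idx n m).sigma fun α => Finset.HasAntidiagonal.antidiagonal α,
          (|p.coeff y.2.1| * δ ^ y.2.1.degree) * (|q.coeff y.2.2| * δ ^ y.2.2.degree) := by
        rw [Finset.sum_sigma]
    _ = ∑ y ∈ ((idx n m).sigma fun α => Finset.HasAntidiagonal.antidiagonal α).image (fun y => y.2),
          (|p.coeff y.1| * δ ^ y.1.degree) * (|q.coeff y.2| * δ ^ y.2.degree) := by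
        rw [Finset.sum_image]
        rintro ⟨a, x⟩ hx ⟨b, y⟩ hy (h : x = y)
        simp only [Finset.coe_sigma, Set.mem_sigma_iff, Finset.mem_coe,
          Finset.HasAntidiagonal.mem_antidiagonal] at hx hy
        obtain ⟨_, rfl⟩ := hx
        obtain ⟨_, rfl⟩ := hy
        subst h; rfl
    _ ≤ ∑ y ∈ idx n m ×ˢ idx n m,
          (|p.coeff y.1| * δ ^ y.1.degree) * (|q.coeff y.2| * δ ^ y.2.degree) := by
        refine Finset.sum_le_sum_of_subset_of_nonneg ?_ fun _ _ _ => by positivity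
        intro y hy
        simp only [Finset.mem_image, Finset.mem_sigma, Finset.HasAntidiagonal.mem_antidiagonal] at hy
        obtain ⟨⟨a, x⟩, ⟨h1, h2⟩, rfl⟩ := hy
        dsimp only at h1 h2 ⊢
        rw [mem_idx] at h1
        have : x.1.degree + x.2.degree = a.degree := by rw [← map_add, h2]
        rw [Finset.mem_product, mem_idx, mem_idx]
        omega
    _ = wn m δ p * wn m δ q := by
        rw [Finset.sum_product, wn, wn, Finset.sum_mul_sum]

theorem wn_mono {δ' : ℝ} (hδ : 0 ≤ δ) (h : δ ≤ δ') (p : Poly n) : wn m δ p ≤ wn m δ' p :=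
  Finset.sum_le_sum fun _ _ => by gcongr

theorem wn_scale_le {c : ℝ} (hδ : 0 ≤ δ) (hc : 1 ≤ c) (p : Poly n) :
    wn m (c * δ) p ≤ c ^ m * wn m δ p := by
  rw [wn, wn, Finset.mul_sum]
  refine Finset.sum_le_sum fun α hα => ?_
  rw [mul_pow]
  have : c ^ α.degree ≤ c ^ m := pow_le_pow_right₀ hc (mem_idx.1 hα)
  nlinarith [mul_le_mul_of_nonneg_right this (show 0 ≤ |p.coeff α| * δ ^ α.degree by positivity)]

theorem wn_pow_le (hδ : 0 ≤ δ) (p : Poly n) (N : ℕ) : wn m δ (p ^ N) ≤ wn m δ p ^ N := by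
  induction N with
  | zero => simp [wn_one]
  | succ N ih =>
    rw [pow_succ, pow_succ]
    exact (wn_mul_le hδ _ _).trans (mul_le_mul_of_nonneg_right ih (wn_nonneg hδ _))

end wn

/-- The linear form `∑ i, c i * dx_i`. -/
def lin (c : Fin n → ℝ) : Sp n →L[ℝ] ℝ :=
  ∑ i, c i • (EuclideanSpace.proj i : Sp n →L[ℝ] ℝ)

theorem lin_add (c d : Fin n → ℝ) : lin (fun i => c i + d i) = lin c + lin d := by
  simp [lin, add_smul, Finset.sum_add_distrib]

theorem lin_smul (a : ℝ) (d : Fin n → ℝ) : lin (fun i => a * d i) = a • lin d := by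
  simp [lin, Finset.smul_sum, mul_smul]

theorem lin_sum {ι : Type*} (t : Finset ι) (d : ι → Fin n → ℝ) :
    lin (fun i => ∑ a ∈ t, d a i) = ∑ a ∈ t, lin (d a) := by
  simp only [lin, Finset.sum_smul]
  exact Finset.sum_comm

theorem lin_apply (c : Fin n → ℝ) (x : Sp n) : lin c x = ∑ i, c i * x i := by
  simp [lin]

theorem norm_proj_le (i : Fin n) : ‖(EuclideanSpace.proj i : Sp n →L[ℝ] ℝ)‖ ≤ 1 := by
  refine ContinuousLinearMap.opNorm_le_bound _ zero_le_one fun x => ?_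
  simpa using PiLp.norm_apply_le x i

theorem norm_lin_le {c : Fin n → ℝ} {B : ℝ} (h : ∀ i, |c i| ≤ B) : ‖lin c‖ ≤ n * B := by
  refine (norm_sum_le _ _).trans ?_
  have : ∀ i ∈ (Finset.univ : Finset (Fin n)),
      ‖c i • (EuclideanSpace.proj i : Sp n →L[ℝ] ℝ)‖ ≤ B := fun i _ => by
    rw [norm_smul]
    have hB := (abs_nonneg (c i)).trans (h i)
    exact (mul_le_mul (h i) (norm_proj_le i) (norm_nonneg _) hB).trans (by simp)
  simpa using Finset.sum_le_card_nsmul _ _ _ this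

/-- `T` is a tower of order `m`: its coefficients of order at most `m` behave like the
Taylor coefficients of a single function. -/
def IsTow (m : ℕ) (T : Sp n → Poly n) : Prop :=
  ∀ α : Fin n →₀ ℕ, α.degree < m → ∀ x,
    HasFDerivAt (fun y => (T y).coeff α)
      (lin fun i => (MvPolynomial.pderiv i (T x)).coeff α) x

namespace IsTow
variable {T S : Sp n → Poly n}

theorem add (hT : IsTow m T) (hS : IsTow m S) : IsTow m fun x => T x + S x := by
  intro α hα x
  simp only [MvPolynomial.coeff_add, map_add, lin_add]
  exact (hT α hα x).add (hS α hα x)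

theorem smul (c : ℝ) (hT : IsTow m T) : IsTow m fun x => c • T x := by
  intro α hα x
  simp only [MvPolynomial.coeff_smul, Derivation.map_smul, smul_eq_mul, lin_smul]
  exact (hT α hα x).const_mul c

theorem sub (hT : IsTow m T) (hS : IsTow m S) : IsTow m fun x => T x - S x := by
  have := hT.add (hS.smul (-1))
  simpa [sub_eq_add_neg] using this

theorem C (c : ℝ) : IsTow m fun _ : Sp n => (MvPolynomial.C c : Poly n) := by
  intro α _ x
  have : lin (fun i : Fin n => (MvPolynomial.pderiv i (MvPolynomial.C c : Poly n)).coeff α) = 0 := by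
    simp [lin]
  rw [this]
  exact hasFDerivAt_const _ _

theorem one : IsTow m fun _ : Sp n => (1 : Poly n) := by simpa using C (n := n) (m := m) 1

theorem zero : IsTow m fun _ : Sp n => (0 : Poly n) := by simpa using C (n := n) (m := m) 0

theorem mul (hT : IsTow m T) (hS : IsTow m S) : IsTow m fun x => T x * S x := by
  classical
  intro α hα x
  have key : ∀ a ∈ Finset.HasAntidiagonal.antidiagonal α, HasFDerivAt
      (fun y => (T y).coeff a.1 * (S y).coeff a.2)
      (lin fun i => (MvPolynomial.pderiv i (T x)).coeff a.1 * (S x).coeff a.2 +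
        (T x).coeff a.1 * (MvPolynomial.pderiv i (S x)).coeff a.2) x := by
    intro a ha
    have hd : a.1.degree + a.2.degree = α.degree := by
      rw [← map_add, Finset.HasAntidiagonal.mem_antidiagonal.1 ha]
    refine ((hT a.1 (by omega) x).mul (hS a.2 (by omega) x)).congr_fderiv ?_
    symm
    rw [lin_add, lin_smul, add_comm]
    congr 1
    rw [← lin_smul]
    simp only [mul_comm]
  have := HasFDerivAt.fun_sum key
  simp only [MvPolynomial.coeff_mul, Derivation.leibniz, smul_eq_mul, MvPolynomial.coeff_add]
  refine this.congr_fderiv ?_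
  symm
  rw [← lin_sum]
  congr 1
  funext i
  rw [Finset.sum_add_distrib, add_comm]
  congr 1
  have := mul_comm (S x) (MvPolynomial.pderiv i (T x))
  rw [← MvPolynomial.coeff_mul, this, MvPolynomial.coeff_mul]

theorem sum {ι : Type*} (t : Finset ι) {f : ι → Sp n → Poly n} (h : ∀ i ∈ t, IsTow m (f i)) :
    IsTow m fun x => ∑ i ∈ t, f i x := by
  classical
  induction t using Finset.induction_on with
  | empty => simpa using zero
  | insert a t ha ih =>
    simp only [Finset.sum_insert ha]
    exact (h a (by simp)).add (ih fun i hi => h i (by simp [hi]))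

theorem prod {ι : Type*} (t : Finset ι) {f : ι → Sp n → Poly n} (h : ∀ i ∈ t, IsTow m (f i)) :
    IsTow m fun x => ∏ i ∈ t, f i x := by
  classical
  induction t using Finset.induction_on with
  | empty => simpa using one
  | insert a t ha ih =>
    simp only [Finset.prod_insert ha]
    exact (h a (by simp)).mul (ih fun i hi => h i (by simp [hi]))

theorem pow (hT : IsTow m T) (N : ℕ) : IsTow m fun x => T x ^ N := by
  induction N with
  | zero => simpa using one
  | succ N ih => simpa only [pow_succ] using ih.mul hT

theorem X (i : Fin n) (x₀ : Sp n) :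
    IsTow m fun x => (MvPolynomial.X i + MvPolynomial.C (x i - x₀ i) : Poly n) := by
  classical
  intro α hα x
  simp only [map_add, MvPolynomial.pderiv_X, MvPolynomial.pderiv_C, add_zero,
    MvPolynomial.coeff_add, MvPolynomial.coeff_C]
  refine HasFDerivAt.const_add _ ?_
  by_cases h : α = 0
  · subst h
    simp only [if_true]
    refine HasFDerivAt.sub_const _ ?_
    have : lin (fun j => MvPolynomial.coeff 0 ((Pi.single j 1 : Fin n → Poly n) i)) =
        (EuclideanSpace.proj i : Sp n →L[ℝ] ℝ) := by
      rw [lin, Finset.sum_eq_single i]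
      · simp
      · intro b _ hb; simp [Ne.symm hb]
      · simp
    rw [this]
    exact (EuclideanSpace.proj i : Sp n →L[ℝ] ℝ).hasFDerivAt
  · have : lin (fun j => MvPolynomial.coeff α ((Pi.single j 1 : Fin n → Poly n) i)) = 0 := by
      rw [lin]
      refine Finset.sum_eq_zero fun j _ => ?_
      rw [Pi.single_apply]
      split_ifs <;> simp [MvPolynomial.coeff_one, Ne.symm h]
    rw [this]
    simp only [if_neg (Ne.symm h)]
    exact hasFDerivAt_const _ _

end IsTow

end

section

variable {n m : ℕ}

/-- The coefficients of order `m` of `T` are `ϑ`-Hölder on `U` with constant `M`. -/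
def HSOn (m : ℕ) (ϑ M : ℝ) (U : Set (Sp n)) (T : Sp n → Poly n) : Prop :=
  ∀ α : Fin n →₀ ℕ, α.degree = m → ∀ x ∈ U, ∀ y ∈ U,
    |(T x).coeff α - (T y).coeff α| ≤ M * ‖x - y‖ ^ ϑ

namespace HSOn
variable {ϑ M M' : ℝ} {U U' : Set (Sp n)} {T S : Sp n → Poly n}

theorem mono_const (h : HSOn m ϑ M U T) (hM : M ≤ M') : HSOn m ϑ M' U T :=
  fun α hα x hx y hy => (h α hα x hx y hy).trans (by gcongr)

theorem mono_set (h : HSOn m ϑ M U T) (hU : U' ⊆ U) : HSOn m ϑ M U' T :=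
  fun α hα x hx y hy => h α hα x (hU hx) y (hU hy)

theorem add (h : HSOn m ϑ M U T) (h' : HSOn m ϑ M' U S) :
    HSOn m ϑ (M + M') U fun x => T x + S x := by
  intro α hα x hx y hy
  simp only [MvPolynomial.coeff_add]
  rw [add_sub_add_comm, add_mul]
  exact (abs_add_le _ _).trans (add_le_add (h α hα x hx y hy) (h' α hα x hx y hy))

theorem smul (c : ℝ) (h : HSOn m ϑ M U T) : HSOn m ϑ (|c| * M) U fun x => c • T x := by
  intro α hα x hx y hy
  simp only [MvPolynomial.coeff_smul, smul_eq_mul]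
  rw [← mul_sub, abs_mul, mul_assoc]
  exact mul_le_mul_of_nonneg_left (h α hα x hx y hy) (abs_nonneg _)

theorem sub (h : HSOn m ϑ M U T) (h' : HSOn m ϑ M' U S) :
    HSOn m ϑ (M + M') U fun x => T x - S x := by
  have := h.add (h'.smul (-1))
  simpa [sub_eq_add_neg] using this

end HSOn

/-- Growth estimate for towers. -/
theorem exists_growth (n m : ℕ) : ∃ C : ℝ, 1 ≤ C ∧ ∀ (ϑ M δ A : ℝ) (U : Set (Sp n))
    (T : Sp n → Poly n) (x y : Sp n), 0 < ϑ → ϑ ≤ 1 → 0 ≤ M → 0 < δ → Convex ℝ U → IsTow m T →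
    HSOn m ϑ M U T → x ∈ U → y ∈ U → ‖y - x‖ ≤ δ → wn m δ (T x) ≤ A →
    wn m δ (T y - T x) ≤ C * (A + M * δ ^ (m + ϑ : ℝ)) * (‖y - x‖ / δ) ^ ϑ := by
  have main : ∀ j : ℕ, ∃ C : ℝ, 1 ≤ C ∧ ∀ (ϑ M δ A : ℝ) (U : Set (Sp n))
      (T : Sp n → Poly n) (x : Sp n), 0 < ϑ → ϑ ≤ 1 → 0 ≤ M → 0 < δ → Convex ℝ U → IsTow m T →
      HSOn m ϑ M U T → x ∈ U → wn m δ (T x) ≤ A →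
      ∀ y ∈ U, ‖y - x‖ ≤ δ → ∀ α : Fin n →₀ ℕ, α.degree + j = m →
      |(T y).coeff α - (T x).coeff α| * δ ^ α.degree ≤
        C * (A + M * δ ^ (m + ϑ : ℝ)) * (‖y - x‖ / δ) ^ ϑ := by
    intro j
    induction j with
    | zero =>
      refine ⟨1, le_rfl, ?_⟩
      intro ϑ M δ A U T x hϑ hϑ1 hM hδ hU hT hH hx hA y hy hxy α hα
      have hA0 : 0 ≤ A := (wn_nonneg hδ.le _).trans hA
      have hα' : α.degree = m := by omega
      rw [hα', one_mul]
      calc _ ≤ M * ‖y - x‖ ^ ϑ * δ ^ m := by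
            gcongr; exact hH α hα' y hy x hx
        _ = M * δ ^ (m + ϑ : ℝ) * (‖y - x‖ / δ) ^ ϑ := by
            rw [Real.div_rpow (norm_nonneg _) hδ.le, Real.rpow_add hδ, Real.rpow_natCast]
            have : δ ^ ϑ ≠ 0 := (Real.rpow_pos_of_pos hδ _).ne'
            field_simp
        _ ≤ _ := by gcongr; linarith
    | succ j ih =>
      obtain ⟨C, hC1, hC⟩ := ih
      refine ⟨n * ((m + 1) * (1 + C)) + 1, by nlinarith [show (0:ℝ) ≤ n * ((m + 1) * (1 + C)) by positivity], ?_⟩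
      intro ϑ M δ A U T x hϑ hϑ1 hM hδ hU hT hH hx hA y hy hxy α hα
      have hA0 : 0 ≤ A := (wn_nonneg hδ.le _).trans hA
      set B := A + M * δ ^ (m + ϑ : ℝ) with hB
      have hB0 : 0 ≤ B := by positivity
      have hAB : A ≤ B := by rw [hB]; linarith [show 0 ≤ M * δ ^ (m + ϑ : ℝ) by positivity]
      have hr1 : ∀ z, ‖z - x‖ ≤ δ → (‖z - x‖ / δ) ^ ϑ ≤ 1 := fun z hz =>
        Real.rpow_le_one (by positivity) ((div_le_one hδ).2 hz) hϑ.le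
      have hder : ∀ z ∈ U ∩ Metric.closedBall x δ, ‖lin (fun i =>
          (MvPolynomial.pderiv i (T z)).coeff α)‖ ≤
            n * ((m + 1) * (1 + C) * B / δ ^ (α.degree + 1)) := by
        rintro z ⟨hzU, hz⟩
        rw [mem_closedBall_iff_norm] at hz
        refine norm_lin_le fun i => ?_
        rw [MvPolynomial.coeff_pderiv, abs_mul]
        have hd := degree_add_single α i
        have h1 := hC ϑ M δ A U T x hϑ hϑ1 hM hδ hU hT hH hx hA z hzU hz
          (α + Finsupp.single i 1) (by omega)
        have h2 := abs_coeff_le_wn hδ.le (m := m) (α := α + Finsupp.single i 1) (by omega) (T x)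
        have h3 := hr1 z hz
        rw [hd] at h1 h2
        have h4 : |(T z).coeff (α + Finsupp.single i 1)| * δ ^ (α.degree + 1) ≤ (1 + C) * B := by
          have := abs_sub_abs_le_abs_sub ((T z).coeff (α + Finsupp.single i 1))
            ((T x).coeff (α + Finsupp.single i 1))
          have h5 : C * B * (‖z - x‖ / δ) ^ ϑ ≤ C * B :=
            mul_le_of_le_one_right (by positivity) h3
          have h6 : (|(T z).coeff (α + Finsupp.single i 1)| -
            |(T x).coeff (α + Finsupp.single i 1)|) * δ ^ (α.degree + 1) ≤ _ :=
            (mul_le_mul_of_nonneg_right this (by positivity)).trans h1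
          nlinarith
        have h7 : |((α i : ℕ) : ℝ) + 1| ≤ m + 1 := by
          rw [abs_of_nonneg (by positivity)]
          have : α i ≤ m := (apply_le_degree α i).trans (by omega)
          have : (α i : ℝ) ≤ m := by exact_mod_cast this
          linarith
        rw [← le_div_iff₀ (by positivity)] at h4
        calc _ ≤ ((1 + C) * B / δ ^ (α.degree + 1)) * (m + 1) := by gcongr
          _ = _ := by ring
      have hmv := (hU.inter (convex_closedBall x δ)).norm_image_sub_le_of_norm_hasFDerivWithin_le
        (fun z _ => (hT α (by omega) z).hasFDerivWithinAt) hder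
        (x := x) (y := y) ⟨hx, by simp [hδ.le]⟩ ⟨hy, mem_closedBall_iff_norm.2 hxy⟩
      rw [Real.norm_eq_abs] at hmv
      set t := ‖y - x‖ / δ with ht
      have ht0 : 0 ≤ t := by positivity
      have ht1 : t ≤ 1 := (div_le_one hδ).2 hxy
      have htt : t ≤ t ^ ϑ := Real.self_le_rpow_of_le_one ht0 ht1 hϑ1
      have hyx : ‖y - x‖ = t * δ := by rw [ht]; field_simp
      calc _ ≤ n * ((m + 1) * (1 + C) * B / δ ^ (α.degree + 1)) * ‖y - x‖ * δ ^ α.degree := by gcongr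
        _ = n * ((m + 1) * (1 + C)) * B * t := by
            rw [hyx, pow_succ]; field_simp
        _ ≤ n * ((m + 1) * (1 + C)) * B * t ^ ϑ := by gcongr
        _ ≤ _ := by gcongr; linarith
  choose C hC1 hC using main
  refine ⟨∑ α ∈ idx n m, C (m - α.degree), ?_, ?_⟩
  · refine (hC1 _).trans (Finset.single_le_sum (f := fun α : Fin n →₀ ℕ => C (m - α.degree))
      (fun _ _ => zero_le_one.trans (hC1 _)) (zero_mem_idx (n := n) (m := m)))
  · intro ϑ M δ A U T x y hϑ hϑ1 hM hδ hU hT hH hx hy hxy hA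
    rw [wn, Finset.sum_mul, Finset.sum_mul]
    refine Finset.sum_le_sum fun α hα => ?_
    rw [MvPolynomial.coeff_sub]
    exact hC _ ϑ M δ A U T x hϑ hϑ1 hM hδ hU hT hH hx hA y hy hxy α (by
      have := mem_idx.1 hα; omega)

/-- Boundedness and Hölder continuity of jets at scale `δ`. -/
structure SC (m : ℕ) (ϑ δ A : ℝ) (U : Set (Sp n)) (T : Sp n → Poly n) : Prop where
  bd : ∀ x ∈ U, wn m δ (T x) ≤ A
  hd : ∀ x ∈ U, ∀ y ∈ U, wn m δ (T x - T y) ≤ A * (‖x - y‖ / δ) ^ ϑ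

namespace SC
variable {ϑ δ A B : ℝ} {U U' : Set (Sp n)} {T S : Sp n → Poly n}

theorem mono_set (h : SC m ϑ δ A U T) (hU : U' ⊆ U) : SC m ϑ δ A U' T :=
  ⟨fun x hx => h.bd x (hU hx), fun x hx y hy => h.hd x (hU hx) y (hU hy)⟩

theorem mono_const (h : SC m ϑ δ A U T) (hδ : 0 < δ) (hA : A ≤ B) : SC m ϑ δ B U T :=
  ⟨fun x hx => (h.bd x hx).trans hA, fun x hx y hy => (h.hd x hx y hy).trans (by gcongr)⟩

theorem add (hδ : 0 < δ) (h : SC m ϑ δ A U T) (h' : SC m ϑ δ B U S) :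
    SC m ϑ δ (A + B) U fun x => T x + S x := by
  refine ⟨fun x hx => (wn_add_le hδ.le _ _).trans (add_le_add (h.bd x hx) (h'.bd x hx)),
    fun x hx y hy => ?_⟩
  rw [add_sub_add_comm, add_mul]
  exact (wn_add_le hδ.le _ _).trans (add_le_add (h.hd x hx y hy) (h'.hd x hx y hy))

theorem smul (c : ℝ) (h : SC m ϑ δ A U T) : SC m ϑ δ (|c| * A) U fun x => c • T x := by
  refine ⟨fun x hx => ?_, fun x hx y hy => ?_⟩
  · rw [wn_smul]; exact mul_le_mul_of_nonneg_left (h.bd x hx) (abs_nonneg _)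
  · rw [← smul_sub, wn_smul, mul_assoc]
    exact mul_le_mul_of_nonneg_left (h.hd x hx y hy) (abs_nonneg _)

theorem sub (hδ : 0 < δ) (h : SC m ϑ δ A U T) (h' : SC m ϑ δ B U S) :
    SC m ϑ δ (A + B) U fun x => T x - S x := by
  have := h.add hδ (h'.smul (-1))
  simpa [sub_eq_add_neg] using this

theorem const (hδ : 0 < δ) (p : Poly n) : SC m ϑ δ (wn m δ p) U fun _ => p :=
  ⟨fun _ _ => le_rfl, fun x _ y _ => by
    rw [sub_self, wn_zero]
    exact mul_nonneg (wn_nonneg hδ.le _) (by positivity)⟩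

theorem mul (hδ : 0 < δ) (hA : 0 ≤ A) (hB : 0 ≤ B) (h : SC m ϑ δ A U T) (h' : SC m ϑ δ B U S) :
    SC m ϑ δ (2 * A * B) U fun x => T x * S x := by
  refine ⟨fun x hx => ?_, fun x hx y hy => ?_⟩
  · have := mul_le_mul (h.bd x hx) (h'.bd x hx) (wn_nonneg hδ.le _) hA
    exact (wn_mul_le hδ.le _ _).trans (by nlinarith [mul_nonneg hA hB])
  · have e : T x * S x - T y * S y = (T x - T y) * S x + T y * (S x - S y) := by ring
    rw [e]
    refine (wn_add_le hδ.le _ _).trans ((add_le_add (wn_mul_le hδ.le _ _)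
      (wn_mul_le hδ.le _ _)).trans ?_)
    have h1 := mul_le_mul (h.hd x hx y hy) (h'.bd x hx) (wn_nonneg hδ.le _) (by positivity)
    have h2 := mul_le_mul (h.bd y hy) (h'.hd x hx y hy) (wn_nonneg hδ.le _) (by positivity)
    linarith

/-- Multiplication by a cutoff supported in `U` turns local control into global control. -/
theorem cutoff (hδ : 0 < δ) (hA : 0 ≤ A) (hB : 0 ≤ B) (h : SC m ϑ δ A U T)
    (h' : SC m ϑ δ B univ S) (hS : ∀ x ∉ U, wn m δ (S x) = 0) :
    SC m ϑ δ (2 * A * B) univ fun x => T x * S x := by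
  have h0 : ∀ x ∉ U, wn m δ (T x * S x) = 0 := fun x hx =>
    le_antisymm ((wn_mul_le hδ.le _ _).trans (by rw [hS x hx, mul_zero])) (wn_nonneg hδ.le _)
  have hU := h.mul hδ hA hB (h'.mono_set (subset_univ U))
  have key : ∀ x ∈ U, ∀ y ∉ U, wn m δ (T x * S x - T y * S y) ≤
      2 * A * B * (‖x - y‖ / δ) ^ ϑ := by
    intro x hx y hy
    have e : T x * S x - T y * S y = T x * (S x - S y) + (T x * S y - T y * S y) := by ring
    have h1 : wn m δ (T x * S y - T y * S y) ≤ 0 := by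
      rw [← sub_mul]
      exact (wn_mul_le hδ.le _ _).trans (by rw [hS y hy, mul_zero])
    have h2 := mul_le_mul (h.bd x hx) (h'.hd x trivial y trivial) (wn_nonneg hδ.le _) hA
    rw [e]
    have h3 : 0 ≤ A * B * (‖x - y‖ / δ) ^ ϑ := by positivity
    linarith [wn_add_le (m := m) hδ.le (T x * (S x - S y)) (T x * S y - T y * S y),
      wn_mul_le (m := m) hδ.le (T x) (S x - S y)]
  refine ⟨fun x _ => ?_, fun x _ y _ => ?_⟩
  · by_cases hx : x ∈ U
    · exact hU.bd x hx
    · rw [h0 x hx]; positivity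
  · by_cases hx : x ∈ U
    · by_cases hy : y ∈ U
      · exact hU.hd x hx y hy
      · exact key x hx y hy
    · by_cases hy : y ∈ U
      · rw [wn_sub_comm, norm_sub_rev]; exact key y hy x hx
      · refine (wn_sub_le hδ.le _ _).trans ?_
        rw [h0 x hx, h0 y hy, add_zero]; positivity

theorem hsOn (hδ : 0 < δ) (h : SC m ϑ δ A U T) : HSOn m ϑ (A / δ ^ (m + ϑ : ℝ)) U T := by
  intro α hα x hx y hy
  have h1 := (abs_coeff_le_wn hδ.le (m := m) hα.le (T x - T y)).trans (h.hd x hx y hy)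
  rw [MvPolynomial.coeff_sub, hα, ← le_div_iff₀ (by positivity)] at h1
  refine h1.trans (le_of_eq ?_)
  rw [Real.div_rpow (norm_nonneg _) hδ.le, Real.rpow_add hδ, Real.rpow_natCast]
  have : δ ^ ϑ ≠ 0 := (Real.rpow_pos_of_pos hδ _).ne'
  field_simp

end SC

/-- Local control at scale `δ` from control at one point. -/
theorem exists_sc_of_growth (n m : ℕ) : ∃ C : ℝ, 1 ≤ C ∧ ∀ (ϑ M δ A : ℝ) (U : Set (Sp n))
    (T : Sp n → Poly n) (x : Sp n), 0 < ϑ → ϑ ≤ 1 → 0 ≤ M → 0 < δ → Convex ℝ U → IsTow m T →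
    HSOn m ϑ M U T → x ∈ U → (∀ y ∈ U, ‖y - x‖ ≤ δ) → wn m δ (T x) ≤ A →
    SC m ϑ δ (C * (A + M * δ ^ (m + ϑ : ℝ))) U T := by
  obtain ⟨C, hC1, hC⟩ := exists_growth n m
  refine ⟨2 * C * (1 + C), by nlinarith, ?_⟩
  intro ϑ M δ A U T x hϑ hϑ1 hM hδ hU hT hH hx hUx hA
  have hA0 : 0 ≤ A := (wn_nonneg hδ.le _).trans hA
  set D := M * δ ^ (m + ϑ : ℝ) with hD
  have hD0 : 0 ≤ D := by positivity
  have hb : ∀ y ∈ U, wn m δ (T y) ≤ (1 + C) * (A + D) := by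
    intro y hy
    have h1 := hC ϑ M δ A U T x y hϑ hϑ1 hM hδ hU hT hH hx hy (hUx y hy) hA
    have h2 : (‖y - x‖ / δ) ^ ϑ ≤ 1 :=
      Real.rpow_le_one (by positivity) ((div_le_one hδ).2 (hUx y hy)) hϑ.le
    have h3 : C * (A + D) * (‖y - x‖ / δ) ^ ϑ ≤ C * (A + D) :=
      mul_le_of_le_one_right (by positivity) h2
    linarith [wn_le_add_sub (m := m) hδ.le (T y) (T x)]
  refine ⟨fun y hy => (hb y hy).trans ?_, fun y hy z hz => ?_⟩
  · have : 0 ≤ (1 + C) * (A + D) := by positivity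
    nlinarith
  · by_cases h : ‖y - z‖ ≤ δ
    · refine (hC ϑ M δ _ U T z y hϑ hϑ1 hM hδ hU hT hH hz hy h (hb z hz)).trans ?_
      rw [← hD]
      refine mul_le_mul_of_nonneg_right ?_ (by positivity)
      have : 0 ≤ C * (A * (1 + C)) := by positivity
      have : 0 ≤ C * (D * C) := by positivity
      nlinarith
    · have h2 : 1 ≤ (‖y - z‖ / δ) ^ ϑ :=
        Real.one_le_rpow ((one_le_div hδ).2 (not_le.1 h).le) hϑ.le
      have h3 : 0 ≤ (1 + C) * (A + D) := by positivity
      have h4 : 2 * ((1 + C) * (A + D)) ≤ 2 * C * (1 + C) * (A + D) := by nlinarith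
      calc _ ≤ 2 * ((1 + C) * (A + D)) :=
            (wn_sub_le hδ.le _ _).trans (by linarith [hb y hy, hb z hz])
        _ ≤ 2 * C * (1 + C) * (A + D) * 1 := by linarith
        _ ≤ _ := by gcongr

/-- Towers of polynomials of degree at most `m`. -/
def IsPT (m : ℕ) (G : Sp n → Poly n) : Prop := IsTow m G ∧ HSOn m 1 0 univ G

theorem IsPT.hsOn {G : Sp n → Poly n} (h : IsPT m G) (ϑ : ℝ) (U : Set (Sp n)) :
    HSOn m ϑ 0 U G := fun α hα x _ y _ => by
  simpa using h.2 α hα x trivial y trivial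

theorem IsPT.sub {G H : Sp n → Poly n} (h : IsPT m G) (h' : IsPT m H) :
    IsPT m fun x => G x - H x :=
  ⟨h.1.sub h'.1, by simpa using h.2.sub h'.2⟩

theorem exists_isPT (m : ℕ) (x₀ : Sp n) (p : Poly n) :
    ∃ G, IsPT m G ∧ ∀ δ, wn m δ (G x₀ - p) = 0 := by
  classical
  let G : Sp n → Poly n := fun x => ∑ α ∈ idx n m, p.coeff α •
    ∏ i, (MvPolynomial.X i + MvPolynomial.C (x i - x₀ i) : Poly n) ^ α i
  have hG : ∀ k, IsTow k G := fun k => IsTow.sum _ fun α _ => IsTow.smul _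
    (IsTow.prod _ fun i _ => (IsTow.X i x₀).pow _)
  have hdeg : ∀ x, (G x).totalDegree ≤ m := by
    intro x
    refine MvPolynomial.totalDegree_finsetSum_le fun α hα => ?_
    refine (MvPolynomial.totalDegree_smul_le _ _).trans ?_
    refine (MvPolynomial.totalDegree_finsetProd _ _).trans ?_
    refine le_trans ?_ (mem_idx.1 hα)
    rw [Finsupp.degree_eq_sum]
    refine Finset.sum_le_sum fun i _ => (MvPolynomial.totalDegree_pow _ _).trans ?_
    have : (MvPolynomial.X i + MvPolynomial.C (x i - x₀ i) : Poly n).totalDegree ≤ 1 :=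
      (MvPolynomial.totalDegree_add _ _).trans
        (max_le (by simp) (by rw [MvPolynomial.totalDegree_C]; exact zero_le_one))
    nlinarith
  refine ⟨G, ⟨hG m, ?_⟩, ?_⟩
  · intro α hα x _ y _
    have h0 : ∀ z, fderiv ℝ (fun y => (G y).coeff α) z = 0 := by
      intro z
      rw [(hG (m + 1) α (by omega) z).fderiv, lin]
      refine Finset.sum_eq_zero fun i _ => ?_
      rw [MvPolynomial.coeff_pderiv, MvPolynomial.coeff_eq_zero_of_totalDegree_lt, zero_mul,
        zero_smul]
      refine (hdeg z).trans_lt ?_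
      have := degree_add_single α i
      rw [Finsupp.degree_apply] at this
      omega
    have := is_const_of_fderiv_eq_zero (fun z => (hG (m + 1) α (by omega) z).differentiableAt)
      h0 x y
    simp [this]
  · intro δ
    have : ∀ α : Fin n →₀ ℕ, (∏ i, (MvPolynomial.X i + MvPolynomial.C (x₀ i - x₀ i) : Poly n) ^ α i)
        = MvPolynomial.monomial α 1 := by
      intro α
      simp only [sub_self, map_zero, add_zero]
      rw [MvPolynomial.monomial_eq, map_one, one_mul, Finsupp.prod_fintype _ _ (by simp)]
    refine Finset.sum_eq_zero fun β hβ => ?_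
    simp only [G, this, MvPolynomial.coeff_sub, MvPolynomial.coeff_sum, MvPolynomial.coeff_smul,
      MvPolynomial.coeff_monomial, smul_eq_mul, mul_ite, mul_one, mul_zero]
    rw [Finset.sum_ite_eq' , if_pos hβ]
    simp

end

section

variable {n m : ℕ}

/-- Iterated partial derivatives. -/
def partials (F : Sp n → ℝ) : List (Fin n) → Sp n → ℝ
  | [] => F
  | i :: l => fun x => fderiv ℝ (partials F l) x (EuclideanSpace.single i 1)

theorem contDiff_partials {F : Sp n → ℝ} (hF : ContDiff ℝ m F) (l : List (Fin n)) (k : ℕ)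
    (h : l.length + k ≤ m) : ContDiff ℝ k (partials F l) := by
  induction l generalizing k with
  | nil => exact hF.of_le (by exact_mod_cast (by simpa using h))
  | cons i l ih =>
    have h1 := ih (k + 1) (by simp at h; omega)
    exact (h1.fderiv_right (m := k) (by exact_mod_cast le_rfl)).clm_apply contDiff_const

theorem partials_perm {F : Sp n → ℝ} (hF : ContDiff ℝ m F) {l l' : List (Fin n)}
    (h : l.Perm l') (hl : l.length ≤ m) : partials F l = partials F l' := by
  induction h with
  | nil => rfl
  | cons i h ih =>
    have := ih (by simp at hl; omega)
    simp only [partials, this]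
  | swap i j l =>
    have h2 := contDiff_partials hF l 2 (by simp at hl; omega)
    funext x
    have hs : IsSymmSndFDerivAt ℝ (partials F l) x :=
      h2.contDiffAt.isSymmSndFDerivAt (by simp)
    have hd : ∀ v : Sp n, fderiv ℝ (fun y => fderiv ℝ (partials F l) y v) x =
        (fderiv ℝ (fderiv ℝ (partials F l)) x).flip v := by
      intro v
      have h3 : DifferentiableAt ℝ (fderiv ℝ (partials F l)) x :=
        ((h2.fderiv_right (m := 1) (by norm_num)).differentiable (by norm_num)) x
      ext w
      rw [fderiv_clm_apply h3 (differentiableAt_const v)]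
      simp
    simp only [partials, hd]
    exact hs _ _
  | trans h1 _ ih1 ih2 => exact (ih1 hl).trans (ih2 (h1.length_eq ▸ hl))

theorem partials_eq {F : Sp n → ℝ} (hF : ContDiff ℝ m F) (l : List (Fin n))
    (hl : l.length ≤ m) (x : Sp n) : partials F l x =
      iteratedFDeriv ℝ l.length F x fun j => EuclideanSpace.single (l.get j) 1 := by
  induction l generalizing x with
  | nil => simp [partials]
  | cons i l ih =>
    have h1 := fun x => ih (by simp at hl; omega) x
    have h2 : partials F l = fun x => iteratedFDeriv ℝ l.length F x fun j =>
      EuclideanSpace.single (l.get j) 1 := funext h1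
    have hd : DifferentiableAt ℝ (iteratedFDeriv ℝ l.length F) x :=
      (hF.differentiable_iteratedFDeriv (m := l.length)
        (by exact_mod_cast (by simpa using hl))) x
    simp only [partials, h2, List.length_cons]
    rw [iteratedFDeriv_succ_apply_left]
    have h3 : HasFDerivAt (fun y => iteratedFDeriv ℝ l.length F y fun j =>
      EuclideanSpace.single (l.get j) 1) _ x :=
      ((ContinuousMultilinearMap.apply ℝ (fun _ : Fin l.length => Sp n) ℝ
        fun j => EuclideanSpace.single (l.get j) 1).hasFDerivAt (x := iteratedFDeriv ℝ l.length F x)).comp x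
        hd.hasFDerivAt
    rw [h3.fderiv]
    rfl

/-- The factorial of a multi-index. -/
def mfact (α : Fin n →₀ ℕ) : ℕ := ∏ i, (α i).factorial

theorem mfact_pos (α : Fin n →₀ ℕ) : 0 < mfact α :=
  Finset.prod_pos fun _ _ => Nat.factorial_pos _

theorem mfact_add_single (α : Fin n →₀ ℕ) (i : Fin n) :
    mfact (α + Finsupp.single i 1) = mfact α * (α i + 1) := by
  classical
  unfold mfact
  rw [← Finset.mul_prod_erase _ _ (Finset.mem_univ i),
    ← Finset.mul_prod_erase _ (fun j => (α j).factorial) (Finset.mem_univ i)]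
  have : ∀ j ∈ Finset.univ.erase i, ((α + Finsupp.single i 1 : Fin n →₀ ℕ) j).factorial = (α j).factorial := by
    intro j hj
    simp [Finset.ne_of_mem_erase hj]
  rw [Finset.prod_congr rfl this]
  simp [Nat.factorial_succ]
  ring

theorem length_toList (α : Fin n →₀ ℕ) : (Finsupp.toMultiset α).toList.length = α.degree := by
  rw [Multiset.length_toList, Finsupp.card_toMultiset, Finsupp.degree_eq_sum,
    Finsupp.sum_fintype _ _ (by simp)]
  rfl

/-- The tower of Taylor coefficients of a `C^m` function. -/
def tay (m : ℕ) (F : Sp n → ℝ) (x : Sp n) : Poly n :=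
  ∑ α ∈ idx n m, MvPolynomial.monomial α
    (partials F (Finsupp.toMultiset α).toList x / mfact α)

theorem coeff_tay (F : Sp n → ℝ) (x : Sp n) {α : Fin n →₀ ℕ} (hα : α.degree ≤ m) :
    (tay m F x).coeff α = partials F (Finsupp.toMultiset α).toList x / mfact α := by
  classical
  rw [tay, MvPolynomial.coeff_sum]
  simp only [MvPolynomial.coeff_monomial]
  rw [Finset.sum_ite_eq', if_pos (mem_idx.2 hα)]

theorem coeff_zero_tay (F : Sp n → ℝ) (x : Sp n) : (tay m F x).coeff 0 = F x := by
  rw [coeff_tay F x (by simp)]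
  simp [partials, mfact]

theorem isTow_tay {F : Sp n → ℝ} (hF : ContDiff ℝ m F) : IsTow m (tay m F) := by
  intro α hα x
  have hl := length_toList α
  have h1 : (fun y => (tay m F y).coeff α) = fun y =>
      partials F (Finsupp.toMultiset α).toList y / mfact α := by
    funext y; exact coeff_tay F y hα.le
  rw [h1]
  have hd : HasFDerivAt (partials F (Finsupp.toMultiset α).toList)
      (fderiv ℝ (partials F (Finsupp.toMultiset α).toList) x) x :=
    ((contDiff_partials hF _ 1 (by omega)).differentiable (by norm_num) x).hasFDerivAt
  have h2 := hd.mul_const ((mfact α : ℝ)⁻¹)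
  simp only [div_eq_mul_inv]
  refine h2.congr_fderiv ?_
  have h3 : ∀ i, (MvPolynomial.pderiv i (tay m F x)).coeff α = (mfact α : ℝ)⁻¹ *
      fderiv ℝ (partials F (Finsupp.toMultiset α).toList) x (EuclideanSpace.single i 1) := by
    intro i
    have hd := degree_add_single α i
    rw [MvPolynomial.coeff_pderiv, coeff_tay F x (by omega)]
    have hp : (Finsupp.toMultiset (α + Finsupp.single i 1)).toList.Perm
        (i :: (Finsupp.toMultiset α).toList) := by
      rw [← Multiset.coe_eq_coe, Multiset.coe_toList, ← Multiset.cons_coe, Multiset.coe_toList,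
        map_add, Finsupp.toMultiset_single, one_smul, add_comm]
      rfl
    rw [partials_perm hF hp (by rw [length_toList]; omega), mfact_add_single]
    simp only [partials]
    have := mfact_pos α
    push_cast
    field_simp
  rw [funext h3, lin_smul]
  congr 1
  ext v
  rw [lin_apply]
  conv_lhs => rw [← (EuclideanSpace.basisFun (Fin n) ℝ).sum_repr v]
  simp [mul_comm]

theorem abs_coeff_tay_sub_le {F : Sp n → ℝ} (hF : ContDiff ℝ m F) {α : Fin n →₀ ℕ}
    (hα : α.degree ≤ m) (x y : Sp n) : |(tay m F x).coeff α - (tay m F y).coeff α| ≤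
      ‖iteratedFDeriv ℝ α.degree F x - iteratedFDeriv ℝ α.degree F y‖ := by
  have hl := length_toList α
  rw [coeff_tay F x hα, coeff_tay F y hα, ← sub_div, abs_div,
    partials_eq hF _ (by omega), partials_eq hF _ (by omega), ← _root_.sub_apply, ← hl]
  have h1 : (1 : ℝ) ≤ |(mfact α : ℝ)| := by
    rw [abs_of_nonneg (by positivity)]; exact_mod_cast mfact_pos α
  refine (div_le_self (abs_nonneg _) h1).trans ?_
  rw [← Real.norm_eq_abs]
  refine (ContinuousMultilinearMap.le_opNorm _ _).trans ?_
  simp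

theorem abs_coeff_tay_le {F : Sp n → ℝ} (hF : ContDiff ℝ m F) {α : Fin n →₀ ℕ}
    (hα : α.degree ≤ m) (x : Sp n) : |(tay m F x).coeff α| ≤
      ‖iteratedFDeriv ℝ α.degree F x‖ := by
  have hl := length_toList α
  rw [coeff_tay F x hα, abs_div, partials_eq hF _ (by omega), ← hl]
  have h1 : (1 : ℝ) ≤ |(mfact α : ℝ)| := by
    rw [abs_of_nonneg (by positivity)]; exact_mod_cast mfact_pos α
  refine (div_le_self (abs_nonneg _) h1).trans ?_
  rw [← Real.norm_eq_abs]
  refine (ContinuousMultilinearMap.le_opNorm _ _).trans ?_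
  simp

end

section

variable {n m : ℕ}

theorem wn_eq_zero {p : Poly n} {δ : ℝ} (h : ∀ α : Fin n →₀ ℕ, α.degree ≤ m → p.coeff α = 0) :
    wn m δ p = 0 :=
  Finset.sum_eq_zero fun α hα => by rw [h α (mem_idx.1 hα)]; simp

theorem continuous_coeff {T : Sp n → Poly n} (hT : IsTow m T)
    (hc : ∀ α : Fin n →₀ ℕ, α.degree = m → Continuous fun x => (T x).coeff α)
    {α : Fin n →₀ ℕ} (hα : α.degree ≤ m) : Continuous fun x => (T x).coeff α := by
  rcases hα.lt_or_eq with h | h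
  · exact continuous_iff_continuousAt.2 fun x => (hT α h x).continuousAt
  · exact hc α h

theorem HSOn.continuous_top {T : Sp n → Poly n} {ϑ M : ℝ} (hϑ : 0 < ϑ) (h : HSOn m ϑ M univ T)
    (α : Fin n →₀ ℕ) (hα : α.degree = m) : Continuous fun x => (T x).coeff α := by
  rw [continuous_iff_continuousAt]
  intro x
  rw [ContinuousAt, tendsto_iff_dist_tendsto_zero]
  have h1 : Filter.Tendsto (fun y : Sp n => M * ‖y - x‖ ^ ϑ) (nhds x) (nhds (M * ‖x - x‖ ^ ϑ)) := by
    have : Continuous fun y : Sp n => M * ‖y - x‖ ^ ϑ :=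
      continuous_const.mul ((continuous_id.sub continuous_const).norm.rpow_const fun _ => Or.inr hϑ.le)
    exact this.tendsto x
  rw [sub_self, norm_zero, Real.zero_rpow hϑ.ne', mul_zero] at h1
  exact squeeze_zero (fun _ => dist_nonneg) (fun y => h α hα y trivial x trivial) h1

/-- A tower with continuous top coefficients comes from a `C^m` function. -/
theorem exists_iteratedFDeriv_le (n m : ℕ) : ∃ C : ℝ, 1 ≤ C ∧ ∀ T : Sp n → Poly n, IsTow m T →
    (∀ α : Fin n →₀ ℕ, α.degree = m → Continuous fun x => (T x).coeff α) →
    ContDiff ℝ m (fun x => (T x).coeff 0) ∧ ∀ k ≤ m, ∀ (x : Sp n) (B : ℝ), 0 ≤ B →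
      (∀ α : Fin n →₀ ℕ, α.degree = k → |(T x).coeff α| ≤ B) →
        ‖iteratedFDeriv ℝ k (fun x => (T x).coeff 0) x‖ ≤ C * B := by
  have main : ∀ j : ℕ, ∃ C : ℝ, 1 ≤ C ∧ ∀ T : Sp n → Poly n, IsTow m T →
      (∀ α : Fin n →₀ ℕ, α.degree = m → Continuous fun x => (T x).coeff α) →
      ∀ α : Fin n →₀ ℕ, α.degree + j ≤ m →
      ContDiff ℝ j (fun x => (T x).coeff α) ∧ ∀ (x : Sp n) (B : ℝ), 0 ≤ B →
        (∀ β : Fin n →₀ ℕ, β.degree = α.degree + j → |(T x).coeff β| ≤ B) →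
          ‖iteratedFDeriv ℝ j (fun x => (T x).coeff α) x‖ ≤ C * B := by
    intro j
    induction j with
    | zero =>
      refine ⟨1, le_rfl, fun T hT hc α hα => ⟨?_, ?_⟩⟩
      · exact contDiff_zero.2 (continuous_coeff hT hc (by omega))
      · intro x B _ hB
        rw [norm_iteratedFDeriv_zero, one_mul]
        exact hB α rfl
    | succ j ih =>
      obtain ⟨C, hC1, hC⟩ := ih
      refine ⟨n * ((m + 1) * C) + 1, by nlinarith [show (0:ℝ) ≤ n * ((m + 1) * C) by positivity], ?_⟩
      intro T hT hc α hα
      let L : Fin n → ℝ →L[ℝ] (Sp n →L[ℝ] ℝ) := fun i =>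
        ContinuousLinearMap.smulRight (1 : ℝ →L[ℝ] ℝ)
          (((α i : ℝ) + 1) • (EuclideanSpace.proj i : Sp n →L[ℝ] ℝ))
      have hf : fderiv ℝ (fun x => (T x).coeff α) = 
          fun x => ∑ i, (L i ∘ fun x => (T x).coeff (α + Finsupp.single i 1)) x := by
        funext x
        rw [(hT α (by omega) x).fderiv, lin]
        refine Finset.sum_congr rfl fun i _ => ?_
        simp [L, MvPolynomial.coeff_pderiv, smul_smul]
      have hcd : ∀ i, ContDiff ℝ j (L i ∘ fun x => (T x).coeff (α + Finsupp.single i 1)) := by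
        intro i
        have hd := degree_add_single α i
        exact (L i).contDiff.comp (hC T hT hc _ (by omega)).1
      refine ⟨?_, ?_⟩
      · rw [show ((j + 1 : ℕ) : WithTop ℕ∞) = (j : WithTop ℕ∞) + 1 by norm_cast,
          contDiff_succ_iff_fderiv]
        refine ⟨fun x => (hT α (by omega) x).differentiableAt, by simp, ?_⟩
        rw [hf]
        exact ContDiff.sum fun i _ => hcd i
      · intro x B hB0 hB
        rw [← norm_iteratedFDeriv_fderiv, hf]
        rw [iteratedFDeriv_sum fun i _ => hcd i]
        have hi : ∀ i ∈ (Finset.univ : Finset (Fin n)), ‖iteratedFDeriv ℝ j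
            (L i ∘ fun x => (T x).coeff (α + Finsupp.single i 1)) x‖ ≤ (m + 1) * C * B := by
          intro i _
          have hd := degree_add_single α i
          have h1 := hC T hT hc (α + Finsupp.single i 1) (by omega)
          refine ((L i).norm_iteratedFDeriv_comp_left h1.1.contDiffAt le_rfl).trans ?_
          have h2 := h1.2 x B hB0 (fun β hβ => hB β (by omega))
          have hL : ‖L i‖ ≤ m + 1 := by
            have : α i ≤ m := (apply_le_degree α i).trans (by omega)
            have : (α i : ℝ) ≤ m := by exact_mod_cast this
            have h0 : (0 : ℝ) ≤ (α i : ℝ) + 1 := by positivity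
            simp only [L, ContinuousLinearMap.norm_smulRight_apply, norm_one, one_mul, norm_smul,
              Real.norm_eq_abs, abs_of_nonneg h0]
            nlinarith [norm_proj_le i]
          calc _ ≤ ((m : ℝ) + 1) * (C * B) := by gcongr
            _ = _ := by ring
        simp only [Finset.sum_apply]
        refine (norm_sum_le _ _).trans ((Finset.sum_le_card_nsmul _ _ _ hi).trans ?_)
        simp only [Finset.card_univ, Fintype.card_fin, nsmul_eq_mul]
        nlinarith
  choose C hC1 hC using main
  have hnn : ∀ j, 0 ≤ C j := fun j => zero_le_one.trans (hC1 j)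
  refine ⟨∑ j ∈ Finset.range (m + 1), C j, (hC1 0).trans
    (Finset.single_le_sum (fun j _ => hnn j) (by simp)), fun T hT hc => ⟨?_, ?_⟩⟩
  · exact (hC m T hT hc 0 (by simp)).1
  · intro k hk x B hB0 hB
    refine ((hC k T hT hc 0 (by simpa using hk)).2 x B hB0
      (fun β hβ => hB β (by simpa using hβ))).trans ?_
    gcongr
    exact Finset.single_le_sum (fun j _ => hnn j) (by simp; omega)

end

section

variable {n m : ℕ}

/-- Transport of a tower by a dilation and translation. -/
def rescale (m : ℕ) (y : Sp n) (r : ℝ) (T : Sp n → Poly n) (x : Sp n) : Poly n :=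
  ∑ α ∈ idx n m, MvPolynomial.monomial α ((T (r⁻¹ • (x - y))).coeff α * r⁻¹ ^ α.degree)

theorem coeff_rescale (y : Sp n) (r : ℝ) (T : Sp n → Poly n) (x : Sp n) {α : Fin n →₀ ℕ}
    (hα : α.degree ≤ m) :
    (rescale m y r T x).coeff α = (T (r⁻¹ • (x - y))).coeff α * r⁻¹ ^ α.degree := by
  classical
  rw [rescale, MvPolynomial.coeff_sum]
  simp only [MvPolynomial.coeff_monomial]
  rw [Finset.sum_ite_eq', if_pos (mem_idx.2 hα)]

theorem IsTow.rescale {T : Sp n → Poly n} (hT : IsTow m T) (y : Sp n) (r : ℝ) :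
    IsTow m (rescale m y r T) := by
  intro α hα x
  have h1 : (fun z => (FlatFP.rescale m y r T z).coeff α) = fun z =>
      (T (r⁻¹ • (z - y))).coeff α * r⁻¹ ^ α.degree := funext fun z => coeff_rescale y r T z hα.le
  rw [h1]
  have h2 : HasFDerivAt (fun z : Sp n => r⁻¹ • (z - y))
      (r⁻¹ • ContinuousLinearMap.id ℝ (Sp n)) x :=
    ((hasFDerivAt_id x).sub_const y).const_smul r⁻¹
  have h3 := ((hT α hα (r⁻¹ • (x - y))).comp x h2).mul_const (r⁻¹ ^ α.degree)
  refine h3.congr_fderiv ?_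
  ext v
  simp only [_root_.smul_apply, ContinuousLinearMap.comp_apply, lin_apply,
    ContinuousLinearMap.id_apply, smul_eq_mul, MvPolynomial.coeff_pderiv]
  rw [Finset.mul_sum]
  refine Finset.sum_congr rfl fun i _ => ?_
  have hd := degree_add_single α i
  rw [coeff_rescale y r T x (by omega), hd]
  simp only [PiLp.smul_apply, smul_eq_mul]
  ring

theorem wn_rescale_sub {r : ℝ} (hr : 0 < r) (y : Sp n) (T : Sp n → Poly n) (x x' : Sp n) :
    wn m r (rescale m y r T x - rescale m y r T x') =
      wn m 1 (T (r⁻¹ • (x - y)) - T (r⁻¹ • (x' - y))) := by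
  refine Finset.sum_congr rfl fun α hα => ?_
  rw [MvPolynomial.coeff_sub, MvPolynomial.coeff_sub, coeff_rescale _ _ _ _ (mem_idx.1 hα),
    coeff_rescale _ _ _ _ (mem_idx.1 hα), ← sub_mul, abs_mul, one_pow, mul_one, mul_assoc,
    abs_of_nonneg (a := r⁻¹ ^ _) (by positivity), ← mul_pow, inv_mul_cancel₀ hr.ne', one_pow, mul_one]

theorem wn_rescale {r : ℝ} (hr : 0 < r) (y : Sp n) (T : Sp n → Poly n) (x : Sp n) :
    wn m r (rescale m y r T x) = wn m 1 (T (r⁻¹ • (x - y))) := by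
  refine Finset.sum_congr rfl fun α hα => ?_
  rw [coeff_rescale _ _ _ _ (mem_idx.1 hα), abs_mul, one_pow, mul_one, mul_assoc,
    abs_of_nonneg (a := r⁻¹ ^ _) (by positivity), ← mul_pow, inv_mul_cancel₀ hr.ne', one_pow, mul_one]

theorem exists_unit_bump (n m : ℕ) : ∃ (A : ℝ) (θ : Sp n → Poly n), 1 ≤ A ∧ IsTow m θ ∧
    (∀ ϑ, 0 < ϑ → ϑ ≤ 1 → SC m ϑ 1 A univ θ) ∧
    (∀ x : Sp n, ‖x‖ < 1 → ∀ α : Fin n →₀ ℕ, α.degree ≤ m →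
      (θ x).coeff α = (1 : Poly n).coeff α) ∧
    (∀ x : Sp n, 2 < ‖x‖ → ∀ α : Fin n →₀ ℕ, α.degree ≤ m → (θ x).coeff α = 0) ∧
    ∀ x, 0 ≤ (θ x).coeff 0 ∧ (θ x).coeff 0 ≤ 1 := by
  classical
  let b : ContDiffBump (0 : Sp n) := ⟨1, 2, by norm_num, by norm_num⟩
  have hb : ContDiff ℝ (m + 1 : ℕ) b := b.contDiff
  let θ := tay (m + 1) b
  have hθ : IsTow (m + 1) θ := isTow_tay hb
  have hbd : ∀ k : ℕ, ∃ B : ℝ, ∀ x, k ≤ m + 1 → ‖iteratedFDeriv ℝ k b x‖ ≤ B := by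
    intro k
    by_cases hk : k ≤ m + 1
    · obtain ⟨B, hB⟩ := Continuous.bounded_above_of_compact_support
        (hb.continuous_iteratedFDeriv (m := k) (by exact_mod_cast hk))
        (b.hasCompactSupport.iteratedFDeriv k)
      exact ⟨B, fun x _ => hB x⟩
    · exact ⟨0, fun x h => absurd h hk⟩
  choose B hB using hbd
  have hB0 : ∀ k ≤ m + 1, 0 ≤ B k := fun k hk => (norm_nonneg _).trans (hB k 0 hk)
  set D := ∑ k ∈ Finset.range (m + 2), B k with hD
  have hBD : ∀ k ≤ m + 1, B k ≤ D := fun k hk => Finset.single_le_sum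
    (fun j hj => hB0 j (by simp at hj; omega)) (by simp; omega)
  have hD0 : 0 ≤ D := (hB0 0 (by omega)).trans (hBD 0 (by omega))
  have hc : ∀ x, ∀ α : Fin n →₀ ℕ, α.degree ≤ m + 1 → |(θ x).coeff α| ≤ D := fun x α hα =>
    (abs_coeff_tay_le hb hα x).trans ((hB _ x hα).trans (hBD _ hα))
  have hlip : ∀ x y, ∀ α : Fin n →₀ ℕ, α.degree ≤ m →
      |(θ x).coeff α - (θ y).coeff α| ≤ n * (D * (m + 1)) * ‖x - y‖ := by
    intro x y α hα
    have := convex_univ.norm_image_sub_le_of_norm_hasFDerivWithin_le (𝕜 := ℝ)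
      (fun z _ => (hθ α (by omega) z).hasFDerivWithinAt) (C := n * (D * (m + 1))) (fun z _ => by
        refine norm_lin_le fun i => ?_
        have hd := degree_add_single α i
        rw [MvPolynomial.coeff_pderiv, abs_mul]
        have h1 := hc z (α + Finsupp.single i 1) (by omega)
        have h7 : |((α i : ℕ) : ℝ) + 1| ≤ m + 1 := by
          rw [abs_of_nonneg (by positivity)]
          have : (α i : ℝ) ≤ m := by exact_mod_cast (apply_le_degree α i).trans hα
          linarith
        gcongr) (mem_univ y) (mem_univ x)
    simpa using this
  set K := n * (D * (m + 1)) + 2 * D + 1 with hK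
  have hK1 : 1 ≤ K := by rw [hK]; linarith [show 0 ≤ n * (D * (m + 1)) by positivity]
  have hhol : ∀ ϑ : ℝ, 0 < ϑ → ϑ ≤ 1 → ∀ x y, ∀ α : Fin n →₀ ℕ, α.degree ≤ m →
      |(θ x).coeff α - (θ y).coeff α| ≤ K * ‖x - y‖ ^ ϑ := by
    intro ϑ h0 h1 x y α hα
    have hnn : 0 ≤ n * (D * (m + 1)) := by positivity
    rcases le_total ‖x - y‖ 1 with h | h
    · have h2 : ‖x - y‖ ≤ ‖x - y‖ ^ ϑ := Real.self_le_rpow_of_le_one (norm_nonneg _) h h1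
      refine (hlip x y α hα).trans (mul_le_mul (by rw [hK]; linarith) h2 (norm_nonneg _) (by linarith))
    · have h2 : 1 ≤ ‖x - y‖ ^ ϑ := Real.one_le_rpow h h0.le
      have h3 : |(θ x).coeff α - (θ y).coeff α| ≤ 2 * D :=
        (abs_sub _ _).trans (by linarith [hc x α (by omega), hc y α (by omega)])
      have : K * 1 ≤ K * ‖x - y‖ ^ ϑ := by gcongr
      linarith
  refine ⟨((idx n m).card + 1) * K, θ, ?_, ?_, ?_, ?_, ?_, ?_⟩
  · nlinarith [show (0 : ℝ) ≤ (idx n m).card * K by positivity]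
  · exact fun α hα => hθ α (by omega)
  · intro ϑ h0 h1
    refine ⟨fun x _ => ?_, fun x _ y _ => ?_⟩
    · refine (Finset.sum_le_card_nsmul _ _ K fun α hα => ?_).trans ?_
      · rw [one_pow, mul_one]
        have := hc x α (by have := mem_idx.1 hα; omega)
        have : 0 ≤ n * (D * (m + 1)) := by positivity
        linarith
      · rw [nsmul_eq_mul]; nlinarith
    · refine (Finset.sum_le_card_nsmul _ _ (K * ‖x - y‖ ^ ϑ) fun α hα => ?_).trans ?_
      · rw [one_pow, mul_one, MvPolynomial.coeff_sub]
        exact hhol ϑ h0 h1 x y α (mem_idx.1 hα)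
      · rw [nsmul_eq_mul, div_one]
        nlinarith [show 0 ≤ K * ‖x - y‖ ^ ϑ by positivity]
  · intro x hx α hα
    by_cases h : α = 0
    · subst h
      simp only [θ, coeff_zero_tay]
      simp [b.one_of_mem_closedBall (x := x) (by simpa [b] using hx.le)]
    · rw [MvPolynomial.coeff_one, if_neg (Ne.symm h)]
      have hev : (b : Sp n → ℝ) =ᶠ[nhds x] fun _ => (1 : ℝ) := by
        filter_upwards [Metric.isOpen_ball.mem_nhds (mem_ball_zero_iff.2 hx)] with z hz
        exact b.one_of_mem_closedBall (Metric.ball_subset_closedBall hz)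
      have h1 := abs_coeff_tay_le hb (α := α) (by omega) x
      rw [(hev.iteratedFDeriv ℝ α.degree).eq_of_nhds, iteratedFDeriv_const_of_ne] at h1
      · simpa using h1
      · rwa [Ne, Finsupp.degree_eq_zero_iff]
  · intro x hx α hα
    have hev : (b : Sp n → ℝ) =ᶠ[nhds x] fun _ => (0 : ℝ) := by
      have : {z : Sp n | 2 < ‖z‖} ∈ nhds x := (isOpen_lt continuous_const continuous_norm).mem_nhds hx
      filter_upwards [this] with z hz
      exact b.zero_of_le_dist (by simpa [b] using (le_of_lt hz : (2:ℝ) ≤ ‖z‖))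
    have h1 := abs_coeff_tay_le hb (α := α) (by omega) x
    rw [(hev.iteratedFDeriv ℝ α.degree).eq_of_nhds] at h1
    have h0 : iteratedFDeriv ℝ α.degree (fun _ : Sp n => (0 : ℝ)) x = 0 := by
      rw [iteratedFDeriv_fun_zero]; rfl
    rw [h0] at h1
    simpa using h1
  · intro x
    simp only [θ, coeff_zero_tay]
    exact ⟨b.nonneg, b.le_one⟩

/-- Cutoff towers at every centre and scale, with uniform bounds. -/
theorem exists_bump (n m : ℕ) : ∃ A : ℝ, 1 ≤ A ∧ ∀ ϑ, 0 < ϑ → ϑ ≤ 1 → ∀ (y : Sp n) (r : ℝ),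
    0 < r → ∃ θ : Sp n → Poly n, IsTow m θ ∧ SC m ϑ r A univ θ ∧
      (∀ x ∈ Metric.ball y r, ∀ δ, wn m δ (θ x - 1) = 0) ∧
      (∀ x ∉ Metric.closedBall y (2 * r), ∀ δ, wn m δ (θ x) = 0) ∧
      ∀ x, 0 ≤ (θ x).coeff 0 ∧ (θ x).coeff 0 ≤ 1 := by
  obtain ⟨A, θ, hA, hT, hSC, h1, h2, h3⟩ := exists_unit_bump n m
  refine ⟨A, hA, fun ϑ h0 hϑ1 y r hr => ⟨rescale m y r θ, hT.rescale y r, ⟨?_, ?_⟩, ?_, ?_, ?_⟩⟩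
  · intro x _
    rw [wn_rescale hr]; exact (hSC ϑ h0 hϑ1).bd _ trivial
  · intro x _ x' _
    rw [wn_rescale_sub hr]
    refine ((hSC ϑ h0 hϑ1).hd _ trivial _ trivial).trans (le_of_eq ?_)
    rw [← smul_sub, norm_smul, Real.norm_of_nonneg (by positivity), sub_sub_sub_cancel_right]
    congr 2
    field_simp
  · intro x hx δ
    refine wn_eq_zero fun α hα => ?_
    rw [MvPolynomial.coeff_sub, coeff_rescale _ _ _ _ hα, h1 _ _ α hα, sub_eq_zero]
    · by_cases h : α = 0
      · subst h; simp
      · simp [MvPolynomial.coeff_one, Ne.symm h]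
    · rw [norm_smul, Real.norm_of_nonneg (by positivity), inv_mul_lt_iff₀ hr, mul_one]
      exact mem_ball_iff_norm.1 hx
  · intro x hx δ
    refine wn_eq_zero fun α hα => ?_
    rw [coeff_rescale _ _ _ _ hα, h2 _ _ α hα, zero_mul]
    rw [mem_closedBall_iff_norm, not_le] at hx
    rw [norm_smul, Real.norm_of_nonneg (by positivity), lt_inv_mul_iff₀ hr]
    linarith
  · intro x
    rw [coeff_rescale _ _ _ _ (by simp)]
    simpa using h3 _

end

section

section Graded
open Filter Topology

variable {ι : Type*} [Fintype ι]

/-- The operator multiplying the `a`-th coordinate by `c (deg a)`. -/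
def Dg (deg : ι → ℕ) (c : ℕ → ℝ) : EuclideanSpace ℝ ι →L[ℝ] EuclideanSpace ℝ ι :=
  LinearMap.toContinuousLinearMap
    { toFun := fun u => WithLp.toLp 2 (fun a => c (deg a) * u a)
      map_add' := fun u v => by ext a; simp [mul_add]
      map_smul' := fun r u => by ext a; simp; ring }

@[simp] theorem Dg_apply (deg : ι → ℕ) (c : ℕ → ℝ) (u : EuclideanSpace ℝ ι) (a : ι) :
    Dg deg c u a = c (deg a) * u a := rfl

theorem Dg_Dg (deg : ι → ℕ) (c d : ℕ → ℝ) (u : EuclideanSpace ℝ ι) :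
    Dg deg c (Dg deg d u) = Dg deg (c * d) u := by
  ext a; simp [mul_assoc]

theorem Dg_one (deg : ι → ℕ) (u : EuclideanSpace ℝ ι) : Dg deg 1 u = u := by
  ext a; simp

theorem Dg_zero (deg : ι → ℕ) (u : EuclideanSpace ℝ ι) : Dg deg 0 u = 0 := by
  ext a; simp

theorem Dg_congr {deg : ι → ℕ} {m : ℕ} (hdeg : ∀ a, deg a ≤ m) {c d : ℕ → ℝ}
    (h : ∀ j ≤ m, c j = d j) : Dg deg c = Dg deg d := by
  ext u a; simp [h _ (hdeg a)]

theorem inner_Dg (deg : ι → ℕ) (c : ℕ → ℝ) (u v : EuclideanSpace ℝ ι) :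
    inner ℝ (Dg deg c u) v = inner ℝ u (Dg deg c v) := by
  simp only [PiLp.inner_apply, Dg_apply]
  refine Finset.sum_congr rfl fun a _ => ?_
  simp; ring

theorem norm_Dg_le {deg : ι → ℕ} {m : ℕ} (hdeg : ∀ a, deg a ≤ m) {c : ℕ → ℝ} {K : ℝ}
    (hK : 0 ≤ K) (h : ∀ j ≤ m, |c j| ≤ K) : ‖Dg deg c‖ ≤ K := by
  refine ContinuousLinearMap.opNorm_le_bound _ hK fun u => ?_
  rw [EuclideanSpace.norm_eq, EuclideanSpace.norm_eq]
  rw [← Real.sqrt_sq hK, ← Real.sqrt_mul (sq_nonneg K), Finset.mul_sum]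
  refine Real.sqrt_le_sqrt (Finset.sum_le_sum fun a _ => ?_)
  rw [Dg_apply, norm_mul, mul_pow]
  have := h _ (hdeg a)
  rw [Real.norm_eq_abs]
  gcongr

theorem Dg_eq_sum {deg : ι → ℕ} {m : ℕ} (hdeg : ∀ a, deg a ≤ m) (c : ℕ → ℝ) :
    Dg deg c = ∑ j ∈ Finset.range (m + 1), c j • Dg deg (Pi.single j 1) := by
  ext u a
  simp only [FunLike.coe_sum, Finset.sum_apply, FunLike.coe_smul, 
    Pi.smul_apply, PiLp.smul_apply, smul_eq_mul, Dg_apply, WithLp.ofLp_sum]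
  rw [Finset.sum_eq_single (deg a)]
  · simp
  · intro b _ hb; simp [hb.symm]
  · intro h; exact absurd (Finset.mem_range.2 (Nat.lt_succ_of_le (hdeg a))) h

/-- The indicator of degrees less than `i`. -/
def below (i : ℕ) : ℕ → ℝ := fun j => if j < i then 1 else 0

/-- The weights of the parabolic dilation. -/
def dil (s ρ : ℝ) : ℕ → ℝ := fun j => ρ ^ ((j : ℝ) - s)

theorem dil_mul {s ρ ρ' : ℝ} (h : 0 ≤ ρ) (h' : 0 ≤ ρ') : dil s ρ * dil s ρ' = dil s (ρ * ρ') := by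
  ext j; simp [dil, Real.mul_rpow h h']

theorem dil_one (s : ℝ) : dil s 1 = 1 := by ext j; simp [dil]

theorem image_dil_dil (deg : ι → ℕ) {s ρ ρ' : ℝ} (h : 0 ≤ ρ) (h' : 0 ≤ ρ')
    (Ω : Set (EuclideanSpace ℝ ι)) :
    Dg deg (dil s ρ) '' (Dg deg (dil s ρ') '' Ω) = Dg deg (dil s (ρ * ρ')) '' Ω := by
  rw [Set.image_image]; simp only [Dg_Dg, dil_mul h h']

/-- A symmetric convex set containing the origin. -/
structure CS {V : Type*} [AddCommGroup V] [Module ℝ V] (Ω : Set V) : Prop where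
  convex : Convex ℝ Ω
  zero : (0 : V) ∈ Ω
  neg : ∀ u ∈ Ω, -u ∈ Ω

theorem CS.smul_mem {V : Type*} [AddCommGroup V] [Module ℝ V] {Ω : Set V} (h : CS Ω) {a : ℝ}
    (ha : |a| ≤ 1) {u : V} (hu : u ∈ Ω) : a • u ∈ Ω := by
  rcases le_total 0 a with h0 | h0
  · exact h.convex.smul_mem_of_zero_mem h.zero hu ⟨h0, (abs_of_nonneg h0) ▸ ha⟩
  · have := h.convex.smul_mem_of_zero_mem h.zero (h.neg u hu) (t := -a)
      ⟨by linarith, (abs_of_nonpos h0) ▸ ha⟩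
    simpa using this

theorem CS.sum_mem {V : Type*} [AddCommGroup V] [Module ℝ V] {Ω : Set V} (h : CS Ω) {τ : Type*}
    (t : Finset τ) {a : τ → ℝ} {u : τ → V} (ha : ∑ i ∈ t, |a i| ≤ 1) (hu : ∀ i ∈ t, u i ∈ Ω) :
    ∑ i ∈ t, a i • u i ∈ Ω := by
  have key := h.convex.sum_mem (t := Finset.insertNone t)
    (w := fun o : Option τ => o.elim (1 - ∑ i ∈ t, |a i|) fun i => |a i|)
    (z := fun o : Option τ => o.elim 0 fun i => (SignType.sign (a i) : ℝ) • u i) ?_ ?_ ?_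
  · simpa [Finset.sum_insertNone, smul_smul, abs_mul_sign] using key
  · intro o ho
    cases o with
    | none => simpa using ha
    | some i => simp
  · simp [Finset.sum_insertNone]
  · intro o ho
    cases o with
    | none => simpa using h.zero
    | some i =>
      refine h.smul_mem ?_ (hu i (by simpa using ho))
      rcases lt_trichotomy (a i) 0 with h0 | h0 | h0 <;> simp [h0]

theorem CS.image {V V' : Type*} [AddCommGroup V] [Module ℝ V] [AddCommGroup V'] [Module ℝ V']
    {Ω : Set V} (h : CS Ω) (f : V →ₗ[ℝ] V') : CS (f '' Ω) where
  convex := h.convex.linear_image f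
  zero := ⟨0, h.zero, map_zero f⟩
  neg := by rintro _ ⟨u, hu, rfl⟩; exact ⟨-u, h.neg u hu, map_neg f u⟩

theorem CS.smul_mem_of_le {V : Type*} [AddCommGroup V] [Module ℝ V] {Ω : Set V} (h : CS Ω)
    {R R' : ℝ} (hR : 0 ≤ R) (hRR : R ≤ R') {u : V} (hu : u ∈ Ω) : ∃ v ∈ Ω, R • u = R' • v := by
  rcases hR.eq_or_lt with rfl | hR0
  · exact ⟨0, h.zero, by simp⟩
  · have hR' : 0 < R' := hR0.trans_le hRR
    refine ⟨(R / R') • u, h.smul_mem ?_ hu, ?_⟩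
    · rw [abs_of_nonneg (by positivity)]; exact (div_le_one hR').2 hRR
    · rw [smul_smul]; congr 1; field_simp

end Graded

end

section

section Graded
open Filter Topology

variable {ι κ : Type*} [Fintype ι]

/-- A graded subspace which is invariant under the operators `Z i`. -/
structure Good (deg : ι → ℕ) (Z : κ → EuclideanSpace ℝ ι →ₗ[ℝ] EuclideanSpace ℝ ι)
    (W : Submodule ℝ (EuclideanSpace ℝ ι)) : Prop where
  graded : ∀ c, ∀ w ∈ W, Dg deg c w ∈ W
  mul : ∀ i, ∀ w ∈ W, Z i w ∈ W

theorem Good.starProjection_Dg {deg : ι → ℕ} {Z : κ → EuclideanSpace ℝ ι →ₗ[ℝ] EuclideanSpace ℝ ι}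
    {W : Submodule ℝ (EuclideanSpace ℝ ι)} (h : Good deg Z W) (c : ℕ → ℝ)
    (x : EuclideanSpace ℝ ι) :
    W.starProjection (Dg deg c x) = Dg deg c (W.starProjection x) := by
  refine (Submodule.eq_starProjection_of_mem_orthogonal
    (h.graded c _ (Submodule.starProjection_apply_mem W x)) ?_)
  rw [← map_sub, Submodule.mem_orthogonal]
  intro w hw
  rw [← inner_Dg]
  exact (Submodule.mem_orthogonal W _).1 (Submodule.sub_starProjection_mem_orthogonal x) _
    (h.graded c w hw)

theorem Good.bot (deg : ι → ℕ) (Z : κ → EuclideanSpace ℝ ι →ₗ[ℝ] EuclideanSpace ℝ ι) :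
    Good deg Z ⊥ where
  graded := by rintro c w hw; rw [(Submodule.mem_bot ℝ).1 hw]; simp
  mul := by rintro c w hw; rw [(Submodule.mem_bot ℝ).1 hw]; simp

/-- The unit ball of `W` is `ε`-close to `Ω`. -/
def Weak (ε : ℝ) (Ω : Set (EuclideanSpace ℝ ι)) (W : Submodule ℝ (EuclideanSpace ℝ ι)) : Prop :=
  ∀ w ∈ W, ‖w‖ ≤ 1 → ∃ q ∈ Ω, ‖q - w‖ ≤ ε

/-- There is a linear section of the projection to `W` with values in a multiple of `Ω`. -/
def Strong (R : ℝ) (Ω : Set (EuclideanSpace ℝ ι)) (W : Submodule ℝ (EuclideanSpace ℝ ι)) : Prop :=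
  ∃ A : EuclideanSpace ℝ ι →L[ℝ] EuclideanSpace ℝ ι, (∀ x, W.starProjection (A x) = W.starProjection x) ∧
    (∀ x, A (W.starProjection x) = A x) ∧ ‖A‖ ≤ R ∧ ∀ x, ‖x‖ ≤ 1 → ∃ u ∈ Ω, A x = R • u

theorem Weak.mono {ε ε' : ℝ} {Ω Ω' : Set (EuclideanSpace ℝ ι)}
    {W : Submodule ℝ (EuclideanSpace ℝ ι)} (h : Weak ε Ω W) (hε : ε ≤ ε') (hΩ : Ω ⊆ Ω') :
    Weak ε' Ω' W := fun w hw hw1 =>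
  let ⟨q, hq, hqw⟩ := h w hw hw1
  ⟨q, hΩ hq, hqw.trans hε⟩

theorem Strong.mono_set {R : ℝ} {Ω Ω' : Set (EuclideanSpace ℝ ι)}
    {W : Submodule ℝ (EuclideanSpace ℝ ι)} (h : Strong R Ω W) (hΩ : Ω ⊆ Ω') :
    Strong R Ω' W := by
  obtain ⟨A, h1, h2, h3, h4⟩ := h
  refine ⟨A, h1, h2, h3, fun x hx => ?_⟩
  obtain ⟨u, hu, hAu⟩ := h4 x hx
  exact ⟨u, hΩ hu, hAu⟩

theorem Weak.strong {ε : ℝ} {Ω : Set (EuclideanSpace ℝ ι)} (hΩ : CS Ω)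
    {W : Submodule ℝ (EuclideanSpace ℝ ι)} (hε0 : 0 ≤ ε)
    (hε : 2 * (Fintype.card ι + 1) * ε ≤ 1) (h : Weak ε Ω W) :
    Strong (4 * (Fintype.card ι + 1)) Ω W := by
  classical
  set D : ℝ := (Fintype.card ι : ℝ) with hD
  have hD0 : 0 ≤ D := Nat.cast_nonneg _
  set P := W.starProjection with hP
  let b := stdOrthonormalBasis ℝ W
  have hdim : ((Module.finrank ℝ W : ℕ) : ℝ) ≤ D := by
    have := Submodule.finrank_le W
    rw [finrank_euclideanSpace] at this
    rw [hD]; exact_mod_cast this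
  have hb1 : ∀ i, ‖((b i : W) : EuclideanSpace ℝ ι)‖ = 1 := fun i => by
    exact b.orthonormal.1 i
  choose q hqΩ hq using fun i => h (b i) (b i).2 (hb1 i).le
  have hPx : ∀ x, P x = ∑ i, inner ℝ ((b i : W) : EuclideanSpace ℝ ι) x • ((b i : W) : EuclideanSpace ℝ ι) := by
    intro x
    rw [hP, Submodule.starProjection_apply, ← b.sum_repr (W.orthogonalProjectionOnto x)]
    simp only [Submodule.coe_sum, Submodule.coe_smul]
    refine Finset.sum_congr rfl fun i _ => ?_
    rw [b.repr_apply_apply, Submodule.inner_orthogonalProjectionOnto_eq_of_mem_left]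
  let A0 : EuclideanSpace ℝ ι →L[ℝ] EuclideanSpace ℝ ι :=
    ∑ i, (innerSL ℝ ((b i : W) : EuclideanSpace ℝ ι)).smulRight (q i)
  have hA0 : ∀ x, A0 x = ∑ i, inner ℝ ((b i : W) : EuclideanSpace ℝ ι) x • q i := by
    intro x; simp [A0]
  have hin : ∀ i x, |inner ℝ ((b i : W) : EuclideanSpace ℝ ι) x| ≤ ‖x‖ := fun i x => by
    have := abs_real_inner_le_norm ((b i : W) : EuclideanSpace ℝ ι) x
    rwa [hb1, one_mul] at this
  have hPn : ∀ x, ‖P x‖ ≤ ‖x‖ := fun x => Submodule.norm_starProjection_apply_le W x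
  have hPP : ∀ x, P (P x) = P x := fun x =>
    Submodule.starProjection_eq_self_iff.2 (Submodule.starProjection_apply_mem W x)
  let N : EuclideanSpace ℝ ι →L[ℝ] EuclideanSpace ℝ ι := P - P.comp A0
  have hN : ‖N‖ ≤ 1 / 2 := by
    refine ContinuousLinearMap.opNorm_le_bound _ (by norm_num) fun x => ?_
    have h1 : N x = -P (A0 x - P x) := by
      simp [N, hPP]
    rw [h1, norm_neg]
    refine (hPn _).trans ?_
    rw [hA0, hPx, ← Finset.sum_sub_distrib]
    simp only [← smul_sub]
    calc ‖∑ i, inner ℝ ((b i : W) : EuclideanSpace ℝ ι) x • (q i - ((b i : W) : EuclideanSpace ℝ ι))‖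
        ≤ ∑ i, ‖inner ℝ ((b i : W) : EuclideanSpace ℝ ι) x • (q i - ((b i : W) : EuclideanSpace ℝ ι))‖ :=
          norm_sum_le _ _
      _ ≤ ∑ i : Fin (Module.finrank ℝ W), ‖x‖ * ε := by
          refine Finset.sum_le_sum fun i _ => ?_
          rw [norm_smul]
          exact mul_le_mul (hin i x) (hq i) (norm_nonneg _) (norm_nonneg _)
      _ = Module.finrank ℝ W * (‖x‖ * ε) := by simp
      _ ≤ D * (‖x‖ * ε) := by gcongr
      _ ≤ 1 / 2 * ‖x‖ := by nlinarith [norm_nonneg x]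
  obtain ⟨v, hv⟩ := isUnit_one_sub_of_norm_lt_one (x := N) (by linarith)
  set S : EuclideanSpace ℝ ι →L[ℝ] EuclideanSpace ℝ ι := ↑v⁻¹ with hS
  have hTS : (1 - N) * S = 1 := by rw [← hv, hS]; exact v.mul_inv
  have hSn : ‖S‖ ≤ 2 := by
    have h1 : S = 1 + N * S := by
      rw [sub_mul, one_mul] at hTS; rw [← hTS]; abel
    have h2 : ‖S‖ ≤ 1 + 1 / 2 * ‖S‖ := by
      calc ‖S‖ = ‖1 + N * S‖ := by rw [← h1]
        _ ≤ ‖(1 : EuclideanSpace ℝ ι →L[ℝ] EuclideanSpace ℝ ι)‖ + ‖N * S‖ := norm_add_le _ _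
        _ ≤ 1 + ‖N‖ * ‖S‖ := add_le_add ContinuousLinearMap.norm_id_le (norm_mul_le _ _)
        _ ≤ 1 + 1 / 2 * ‖S‖ := by gcongr
    linarith
  have hPA0S : ∀ x, P (A0 (S x)) = P x := by
    intro x
    have h1 : ((1 - N) * S) x = x := by rw [hTS]; rfl
    have h2 : S x - N (S x) = x := by simpa using h1
    have h3 := congrArg P h2
    rw [map_sub] at h3
    simp only [N, _root_.sub_apply, ContinuousLinearMap.comp_apply, map_sub, hPP] at h3
    simpa using h3
  have hq2 : ∀ i, ‖q i‖ ≤ 2 := fun i => by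
    have h1 : ‖q i‖ ≤ ‖q i - (b i : W)‖ + ‖((b i : W) : EuclideanSpace ℝ ι)‖ := by
      simpa using norm_add_le (q i - ((b i : W) : EuclideanSpace ℝ ι)) (b i : W)
    rw [hb1] at h1
    nlinarith [hq i]
  have hSP : ∀ x, ‖S (P x)‖ ≤ 2 * ‖x‖ := fun x =>
    (S.le_opNorm _).trans (mul_le_mul hSn (hPn x) (norm_nonneg _) (by norm_num))
  refine ⟨A0.comp (S.comp P), fun x => ?_, fun x => ?_, ?_, fun x hx => ?_⟩
  · simp only [ContinuousLinearMap.comp_apply, ← hP, hPA0S, hPP]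
  · simp only [ContinuousLinearMap.comp_apply, ← hP, hPP]
  · refine ContinuousLinearMap.opNorm_le_bound _ (by positivity) fun x => ?_
    simp only [ContinuousLinearMap.comp_apply, hA0]
    calc _ ≤ ∑ i, ‖inner ℝ ((b i : W) : EuclideanSpace ℝ ι) (S (P x)) • q i‖ := norm_sum_le _ _
      _ ≤ ∑ i : Fin (Module.finrank ℝ W), 2 * ‖x‖ * 2 := by
          refine Finset.sum_le_sum fun i _ => ?_
          rw [norm_smul]
          exact mul_le_mul ((hin i _).trans (hSP x)) (hq2 i) (norm_nonneg _) (by positivity)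
      _ = Module.finrank ℝ W * (2 * ‖x‖ * 2) := by simp
      _ ≤ (D + 1) * (2 * ‖x‖ * 2) := by gcongr; linarith
      _ = _ := by ring
  · refine ⟨∑ i, ((4 * (D + 1))⁻¹ * inner ℝ ((b i : W) : EuclideanSpace ℝ ι) (S (P x))) • q i,
      hΩ.sum_mem _ ?_ fun i _ => hqΩ i, ?_⟩
    · calc _ ≤ ∑ i : Fin (Module.finrank ℝ W), (4 * (D + 1))⁻¹ * 2 := by
            refine Finset.sum_le_sum fun i _ => ?_
            rw [abs_mul, abs_of_nonneg (a := (4 * (D + 1))⁻¹) (by positivity)]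
            gcongr
            refine ((hin i _).trans (hSP x)).trans (by linarith)
        _ = Module.finrank ℝ W * ((4 * (D + 1))⁻¹ * 2) := by simp
        _ ≤ D * ((4 * (D + 1))⁻¹ * 2) := by gcongr
        _ ≤ 1 := by
          rw [inv_mul_eq_div, mul_div_assoc', div_le_one (by positivity)]; linarith
    · simp only [ContinuousLinearMap.comp_apply, hA0, Finset.smul_sum, smul_smul]
      refine Finset.sum_congr rfl fun i _ => ?_
      congr 1
      field_simp

theorem exists_tendsto_hyperfilter {V : Type*} [PseudoMetricSpace V] [ProperSpace V] {f : ℕ → V}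
    {c : V} {R : ℝ} (h : ∀ j, dist (f j) c ≤ R) : ∃ v, Tendsto f (hyperfilter ℕ) (𝓝 v) := by
  obtain ⟨x, -, hx⟩ := (isCompact_closedBall c R).ultrafilter_le_nhds' ((hyperfilter ℕ).map f)
    (Filter.mem_map.2 (Filter.Eventually.of_forall fun j => by simpa using h j))
  exact ⟨x, hx⟩

end Graded

end

section

section Graded
open Filter Topology

variable {ι κ : Type*} [Fintype ι]

/-- `Ω` is stable under the operators `Z i`, up to the factor `Cw`, near the origin. -/
def ZStable (Cw : ℝ) (Z : κ → EuclideanSpace ℝ ι →ₗ[ℝ] EuclideanSpace ℝ ι)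
    (Ω : Set (EuclideanSpace ℝ ι)) : Prop :=
  ∀ u ∈ Ω, ‖u‖ ≤ 1 → ∀ i, ∃ v ∈ Ω, Z i u = Cw • v

theorem CS.add_mem {V : Type*} [AddCommGroup V] [Module ℝ V] {Ω : Set V} (h : CS Ω) {a b : ℝ}
    (hab : |a| + |b| ≤ 1) {u v : V} (hu : u ∈ Ω) (hv : v ∈ Ω) : a • u + b • v ∈ Ω := by
  have := h.sum_mem (Finset.univ : Finset (Fin 2)) (a := ![a, b]) (u := ![u, v])
    (by simpa using hab) (by intro i _; fin_cases i <;> simpa)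
  simpa using this

/-- Directions which are attained in the limit by the sets `Ω j`. -/
def limSp (Ω : ℕ → Set (EuclideanSpace ℝ ι)) (hΩ : ∀ j, CS (Ω j)) :
    Submodule ℝ (EuclideanSpace ℝ ι) where
  carrier := {y | ∃ c : ℝ, 0 < c ∧ ∃ u : ℕ → EuclideanSpace ℝ ι, (∀ᶠ j in hyperfilter ℕ, u j ∈ Ω j) ∧
    Tendsto u (hyperfilter ℕ) (𝓝 (c • y))}
  zero_mem' := ⟨1, one_pos, fun _ => 0, Eventually.of_forall fun j => (hΩ j).zero, by
    simp⟩
  add_mem' := by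
    rintro y y' ⟨c, hc, u, hu, hl⟩ ⟨c', hc', u', hu', hl'⟩
    set d := min c c' / 2 with hd
    have hmin : 0 < min c c' := lt_min hc hc'
    have hd0 : 0 < d := by positivity
    refine ⟨d, hd0, fun j => (d / c) • u j + (d / c') • u' j, ?_, ?_⟩
    · filter_upwards [hu, hu'] with j h1 h2
      refine (hΩ j).add_mem ?_ h1 h2
      rw [abs_of_pos (by positivity), abs_of_pos (by positivity)]
      have e1 : d / c ≤ 1 / 2 := by
        rw [div_le_iff₀ hc]; linarith [min_le_left c c']
      have e2 : d / c' ≤ 1 / 2 := by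
        rw [div_le_iff₀ hc']; linarith [min_le_right c c']
      linarith
    · have := (hl.const_smul (d / c)).add (hl'.const_smul (d / c'))
      simpa only [smul_smul, div_mul_cancel₀ _ hc.ne', div_mul_cancel₀ _ hc'.ne', ← smul_add]
        using this
  smul_mem' := by
    rintro r y ⟨c, hc, u, hu, hl⟩
    have hr : 0 < |r| + 1 := by positivity
    refine ⟨c / (|r| + 1), by positivity, fun j => (r / (|r| + 1)) • u j, ?_, ?_⟩
    · filter_upwards [hu] with j h1
      refine (hΩ j).smul_mem ?_ h1
      rw [abs_div, abs_of_pos hr, div_le_one hr]; linarith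
    · have := hl.const_smul (r / (|r| + 1))
      rw [smul_smul] at this ⊢
      convert this using 3; ring

theorem limSp_mul {Ω : ℕ → Set (EuclideanSpace ℝ ι)} (hΩ : ∀ j, CS (Ω j)) {Cw : ℝ} (hCw : 0 < Cw)
    {Z : κ → EuclideanSpace ℝ ι →ₗ[ℝ] EuclideanSpace ℝ ι} (hZ : ∀ j, ZStable Cw Z (Ω j)) (i : κ)
    {y : EuclideanSpace ℝ ι} (hy : y ∈ limSp Ω hΩ) : Z i y ∈ limSp Ω hΩ := by
  obtain ⟨c, hc, u, hu, hl⟩ := hy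
  set a : ℝ := (1 + c * ‖y‖)⁻¹ with ha
  have hpos : 0 < 1 + c * ‖y‖ := by positivity
  have ha0 : 0 < a := by positivity
  have ha1 : a ≤ 1 := inv_le_one_of_one_le₀ (by nlinarith [norm_nonneg y])
  have hl' : Tendsto (fun j => a • u j) (hyperfilter ℕ) (𝓝 (a • c • y)) := hl.const_smul a
  have hn : ‖a • c • y‖ < 1 := by
    rw [norm_smul, norm_smul, Real.norm_of_nonneg ha0.le, Real.norm_of_nonneg hc.le, ha,
      inv_mul_eq_div, div_lt_one hpos]
    linarith
  have hev : ∀ᶠ j in hyperfilter ℕ, ∃ v ∈ Ω j, Z i (a • u j) = Cw • v := by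
    filter_upwards [hu, hl'.norm.eventually (gt_mem_nhds hn)] with j h1 h2
    exact hZ j _ ((hΩ j).smul_mem (by rwa [abs_of_pos ha0]) h1) h2.le i
  refine ⟨a * c / Cw, by positivity, fun j => Cw⁻¹ • Z i (a • u j), ?_, ?_⟩
  · filter_upwards [hev] with j hj
    obtain ⟨v, hv, hz⟩ := hj
    rw [hz, smul_smul, inv_mul_cancel₀ hCw.ne', one_smul]; exact hv
  · have hcont : Continuous (Z i) := LinearMap.continuous_of_finiteDimensional _
    have := ((hcont.tendsto _).comp hl').const_smul Cw⁻¹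
    have e : Cw⁻¹ • Z i (a • c • y) = (a * c / Cw) • Z i y := by
      rw [map_smul, map_smul, smul_smul, smul_smul]; congr 1; ring
    rw [← e]; exact this

/-- The initial subspace of `Y`. -/
def inSp (deg : ι → ℕ) (Y : Submodule ℝ (EuclideanSpace ℝ ι)) :
    Submodule ℝ (EuclideanSpace ℝ ι) where
  carrier := {w | ∀ k, ∃ y ∈ Y, Dg deg (below k) y = 0 ∧
    Dg deg (Pi.single k 1) y = Dg deg (Pi.single k 1) w}
  zero_mem' := fun k => ⟨0, Y.zero_mem, by simp, rfl⟩
  add_mem' := by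
    intro w w' h h' k
    obtain ⟨y, hy, h1, h2⟩ := h k
    obtain ⟨y', hy', h1', h2'⟩ := h' k
    exact ⟨y + y', Y.add_mem hy hy', by simp [h1, h1'], by simp [h2, h2']⟩
  smul_mem' := by
    intro r w h k
    obtain ⟨y, hy, h1, h2⟩ := h k
    exact ⟨r • y, Y.smul_mem r hy, by simp [h1], by simp [h2]⟩

theorem good_inSp {deg : ι → ℕ} {Z : κ → EuclideanSpace ℝ ι →ₗ[ℝ] EuclideanSpace ℝ ι}
    (hZ : ∀ c i u, Dg deg c (Z i u) = Z i (Dg deg (c ∘ Nat.succ) u))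
    {Y : Submodule ℝ (EuclideanSpace ℝ ι)} (hY : ∀ i, ∀ y ∈ Y, Z i y ∈ Y) :
    Good deg Z (inSp deg Y) where
  graded := by
    intro c w h k
    obtain ⟨y, hy, h1, h2⟩ := h k
    refine ⟨c k • y, Y.smul_mem _ hy, by simp [h1], ?_⟩
    rw [map_smul, h2]
    ext a
    by_cases hk : deg a = k
    · simp [hk]
    · simp [hk]
  mul := by
    intro i w h k
    cases k with
    | zero =>
      refine ⟨0, Y.zero_mem, by simp, ?_⟩
      rw [hZ]
      have : (Pi.single 0 1 : ℕ → ℝ) ∘ Nat.succ = 0 := by ext j; simp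
      rw [this, Dg_zero]; simp
    | succ k =>
      obtain ⟨y, hy, h1, h2⟩ := h k
      refine ⟨Z i y, hY i y hy, ?_, ?_⟩
      · rw [hZ]
        have : below (k + 1) ∘ Nat.succ = below k := by ext j; simp [below]
        rw [this, h1, map_zero]
      · rw [hZ, hZ]
        have : (Pi.single (k + 1) 1 : ℕ → ℝ) ∘ Nat.succ = Pi.single k 1 := by
          ext j; simp [Pi.single_apply]
        rw [this, h2]

/-- The quantity on which the induction is based. -/
def mu (m : ℕ) (deg : ι → ℕ) (W : Submodule ℝ (EuclideanSpace ℝ ι)) : ℕ :=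
  ∑ i ∈ Finset.range (m + 1),
    Module.finrank ℝ (W.map (Dg deg (below (i + 1)) : EuclideanSpace ℝ ι →ₗ[ℝ] EuclideanSpace ℝ ι))

theorem mu_le (m : ℕ) (deg : ι → ℕ) (W : Submodule ℝ (EuclideanSpace ℝ ι)) :
    mu m deg W ≤ (m + 1) * Fintype.card ι := by
  refine (Finset.sum_le_card_nsmul _ _ (Fintype.card ι) fun i _ => ?_).trans (by simp)
  have := Submodule.finrank_le
    (W.map (Dg deg (below (i + 1)) : EuclideanSpace ℝ ι →ₗ[ℝ] EuclideanSpace ℝ ι))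
  rwa [finrank_euclideanSpace] at this

theorem finrank_map_add {V V' : Type*} [AddCommGroup V] [Module ℝ V] [FiniteDimensional ℝ V]
    [AddCommGroup V'] [Module ℝ V'] (S : Submodule ℝ V) (f : V →ₗ[ℝ] V') :
    Module.finrank ℝ (S.map f) + Module.finrank ℝ (S ⊓ LinearMap.ker f : Submodule ℝ V) =
      Module.finrank ℝ S := by
  have h := (f.domRestrict S).finrank_range_add_finrank_ker
  have h1 : LinearMap.range (f.domRestrict S) = S.map f := by
    ext x; simp
  have h2 : (LinearMap.ker (f.domRestrict S)).map S.subtype = S ⊓ LinearMap.ker f := by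
    ext x; simp [and_comm]
  rw [h1] at h
  rw [← h2, Submodule.finrank_map_subtype_eq]
  exact h

theorem below_succ_apply {deg : ι → ℕ} {i : ℕ} {y : EuclideanSpace ℝ ι}
    (h : Dg deg (below i) y = 0) : Dg deg (below (i + 1)) y = Dg deg (Pi.single i 1) y := by
  ext a
  have ha : Dg deg (below i) y a = 0 := by rw [h]; rfl
  rw [Dg_apply] at ha ⊢
  rw [Dg_apply]
  rcases lt_trichotomy (deg a) i with h1 | h1 | h1
  · have : y a = 0 := by simpa [below, h1] using ha
    simp [this]
  · simp [below, h1]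
  · have e1 : ¬ deg a < i + 1 := by omega
    simp [below, e1, h1.ne']

theorem below_below (deg : ι → ℕ) {i k : ℕ} (hik : i ≤ k) (y : EuclideanSpace ℝ ι) :
    Dg deg (below i) (Dg deg (below k) y) = Dg deg (below i) y := by
  rw [Dg_Dg]; congr 2
  ext j
  by_cases h : j < i
  · simp [below, h, h.trans_le hik]
  · simp [below, h]

theorem finrank_le_inSp (deg : ι → ℕ) (Y : Submodule ℝ (EuclideanSpace ℝ ι)) (i : ℕ) :
    Module.finrank ℝ (Y.map (Dg deg (below i) : EuclideanSpace ℝ ι →ₗ[ℝ] EuclideanSpace ℝ ι)) ≤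
    Module.finrank ℝ ((inSp deg Y).map
      (Dg deg (below i) : EuclideanSpace ℝ ι →ₗ[ℝ] EuclideanSpace ℝ ι)) := by
  induction i with
  | zero =>
    have h0 : (Dg deg (below 0) : EuclideanSpace ℝ ι →ₗ[ℝ] EuclideanSpace ℝ ι) = 0 := by
      ext u a; simp [below]
    rw [h0, Submodule.map_zero, Submodule.map_zero]
  | succ i ih =>
    have hmap : ∀ S : Submodule ℝ (EuclideanSpace ℝ ι),
        (S.map (Dg deg (below (i + 1)) : EuclideanSpace ℝ ι →ₗ[ℝ] EuclideanSpace ℝ ι)).map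
          (Dg deg (below i) : EuclideanSpace ℝ ι →ₗ[ℝ] EuclideanSpace ℝ ι) =
        S.map (Dg deg (below i) : EuclideanSpace ℝ ι →ₗ[ℝ] EuclideanSpace ℝ ι) := by
      intro S
      rw [← Submodule.map_comp]
      congr 1
      ext1 u
      exact below_below deg (Nat.le_succ i) u
    rw [← finrank_map_add (Y.map _) (Dg deg (below i) : EuclideanSpace ℝ ι →ₗ[ℝ] EuclideanSpace ℝ ι),
      ← finrank_map_add ((inSp deg Y).map _)
        (Dg deg (below i) : EuclideanSpace ℝ ι →ₗ[ℝ] EuclideanSpace ℝ ι), hmap, hmap]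
    refine add_le_add ih (Submodule.finrank_mono ?_)
    rintro _ ⟨⟨y, hy, rfl⟩, hk⟩
    have hk' : Dg deg (below i) y = 0 := by
      rw [← below_below deg (Nat.le_succ i) y]; exact hk
    refine ⟨⟨Dg deg (Pi.single i 1) y, ?_, ?_⟩, hk⟩
    · intro k
      by_cases hki : k = i
      · subst hki
        refine ⟨y, hy, hk', ?_⟩
        rw [Dg_Dg]; congr 2; ext j; by_cases hj : j = k <;> simp [hj]
      · refine ⟨0, Y.zero_mem, by simp, ?_⟩
        rw [Dg_Dg, map_zero]
        have : (Pi.single k 1 * Pi.single i 1 : ℕ → ℝ) = 0 := by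
          ext j
          by_cases hj : j = k
          · subst hj; simp [hki]
          · simp [hj]
        rw [this, Dg_zero]
    · change Dg deg (below (i + 1)) (Dg deg (Pi.single i 1) y) = Dg deg (below (i + 1)) y
      rw [below_succ_apply hk', Dg_Dg]
      congr 2; ext j; by_cases hj : j = i
      · subst hj; simp [below]
      · simp [hj]

theorem mu_le_inSp (m : ℕ) (deg : ι → ℕ) (Y : Submodule ℝ (EuclideanSpace ℝ ι)) :
    mu m deg Y ≤ mu m deg (inSp deg Y) :=
  Finset.sum_le_sum fun _ _ => finrank_le_inSp deg Y _

theorem tendsto_euclidean {τ : Type*} {l : Filter τ} {f : τ → EuclideanSpace ℝ ι}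
    {b : EuclideanSpace ℝ ι} (h : ∀ a, Tendsto (fun t => f t a) l (𝓝 (b a))) :
    Tendsto f l (𝓝 b) := by
  have h1 : Tendsto (fun t => (f t).ofLp) l (𝓝 b.ofLp) := tendsto_pi_nhds.2 h
  exact ((PiLp.continuous_toLp 2 (fun _ : ι => ℝ)).tendsto _).comp h1

theorem tendsto_rpow_nhdsGT {p : ℝ} (hp : 0 < p) :
    Tendsto (fun ρ : ℝ => ρ ^ p) (𝓝[>] 0) (𝓝 0) := by
  have := (Real.continuousAt_rpow_const 0 p (Or.inr hp.le)).tendsto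
  rw [Real.zero_rpow hp.ne'] at this
  exact this.mono_left nhdsWithin_le_nhds

theorem tendsto_dil_initial {deg : ι → ℕ} {m : ℕ} (hdeg : ∀ a, deg a ≤ m) {s : ℝ}
    {w : EuclideanSpace ℝ ι} {y : ℕ → EuclideanSpace ℝ ι}
    (h0 : ∀ k, Dg deg (below k) (y k) = 0)
    (h1 : ∀ k, Dg deg (Pi.single k 1) (y k) = Dg deg (Pi.single k 1) w) :
    Tendsto (fun ρ : ℝ => Dg deg (dil s ρ) (∑ k ∈ Finset.range (m + 1), ρ ^ (s - k) • y k))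
      (𝓝[>] 0) (𝓝 w) := by
  refine tendsto_euclidean fun a => ?_
  have hw : w a = ∑ k ∈ Finset.range (m + 1), if k = deg a then w a else 0 := by
    rw [Finset.sum_ite_eq', if_pos (Finset.mem_range.2 (Nat.lt_succ_of_le (hdeg a)))]
  rw [hw]
  simp only [Dg_apply, WithLp.ofLp_sum, Finset.sum_apply, PiLp.smul_apply, smul_eq_mul,
    Finset.mul_sum, dil]
  refine tendsto_finsetSum _ fun k _ => ?_
  have key : ∀ ρ ∈ Ioi (0 : ℝ), ρ ^ ((deg a : ℝ) - s) * (ρ ^ (s - k) * y k a) =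
      ρ ^ ((deg a : ℝ) - k) * y k a := by
    intro ρ hρ
    rw [← mul_assoc, ← Real.rpow_add hρ]; congr 2; ring
  refine Tendsto.congr' (eventually_nhdsWithin_of_forall fun ρ hρ => (key ρ hρ).symm) ?_
  rcases lt_trichotomy (deg a) k with h | h | h
  · have : y k a = 0 := by
      have := congrArg (fun v : EuclideanSpace ℝ ι => v a) (h0 k)
      simpa [below, h] using this
    simp [this, h.ne']
  · subst h
    have := congrArg (fun v : EuclideanSpace ℝ ι => v a) (h1 (deg a))
    simp at this
    simp [this]
  · rw [if_neg h.ne]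
    have hp : (0 : ℝ) < (deg a : ℝ) - k := sub_pos.2 (by exact_mod_cast h)
    simpa using (tendsto_rpow_nhdsGT hp).mul_const (y k a)

theorem exists_weak_inSp {deg : ι → ℕ} {m : ℕ} (hdeg : ∀ a, deg a ≤ m) {s : ℝ} (hs : m < s)
    {ε : ℝ} (hε : 0 < ε) {Ω : ℕ → Set (EuclideanSpace ℝ ι)} (hΩ : ∀ j, CS (Ω j)) :
    ∃ ρ : ℝ, 0 < ρ ∧ ρ ≤ 1 ∧ ∀ᶠ j in hyperfilter ℕ,
      Weak ε (Dg deg (dil s ρ) '' Ω j) (inSp deg (limSp Ω hΩ)) := by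
  classical
  set W := inSp deg (limSp Ω hΩ) with hW
  let b := stdOrthonormalBasis ℝ W
  choose y hyY hy0 hy1 using fun i => (b i).2
  choose c hc u hu hl using hyY
  have t1 : Tendsto (fun ρ : ℝ => ∑ i, ‖Dg deg (dil s ρ)
      (∑ k ∈ Finset.range (m + 1), ρ ^ (s - k) • y i k) - (b i : W)‖) (𝓝[>] 0) (𝓝 0) := by
    have h0 : ∑ i, ‖((b i : W) : EuclideanSpace ℝ ι) - (b i : W)‖ = 0 := by simp
    refine Tendsto.mono_right ?_ (congrArg 𝓝 h0).le
    exact tendsto_finsetSum _ fun i _ =>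
      ((tendsto_dil_initial hdeg (hy0 i) (hy1 i)).sub_const _).norm
  have t2 : Tendsto (fun ρ : ℝ => ∑ i, ∑ k ∈ Finset.range (m + 1), ρ ^ (s - k) / c i k)
      (𝓝[>] 0) (𝓝 0) := by
    have h0 : ∑ i, ∑ k ∈ Finset.range (m + 1), 0 / c i k = 0 := by simp
    refine Tendsto.mono_right ?_ (congrArg 𝓝 h0).le
    refine tendsto_finsetSum _ fun i _ => tendsto_finsetSum _ fun k hk => ?_
    refine (tendsto_rpow_nhdsGT ?_).div_const _
    have : (k : ℝ) ≤ m := by exact_mod_cast Nat.lt_succ_iff.1 (Finset.mem_range.1 hk)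
    linarith
  have t3 : ∀ᶠ ρ : ℝ in 𝓝[>] 0, ρ ≤ 1 :=
    eventually_nhdsWithin_of_eventually_nhds (eventually_le_nhds (by norm_num))
  obtain ⟨ρ, h1, h2, h3, h4⟩ := ((t1.eventually (gt_mem_nhds hε)).and
    ((t2.eventually (gt_mem_nhds one_pos)).and (t3.and self_mem_nhdsWithin))).exists
  have hρ : 0 < ρ := h4
  refine ⟨ρ, hρ, h3, ?_⟩
  have t4 : Tendsto (fun j => ∑ i, ‖Dg deg (dil s ρ)
      (∑ k ∈ Finset.range (m + 1), (ρ ^ (s - k) / c i k) • u i k j) - (b i : W)‖) (hyperfilter ℕ)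
      (𝓝 (∑ i, ‖Dg deg (dil s ρ)
      (∑ k ∈ Finset.range (m + 1), ρ ^ (s - k) • y i k) - (b i : W)‖)) := by
    refine tendsto_finsetSum _ fun i _ => (Tendsto.sub_const ?_ _).norm
    refine ((Dg deg (dil s ρ)).continuous.tendsto _).comp (tendsto_finsetSum _ fun k _ => ?_)
    have := (hl i k).const_smul (ρ ^ (s - k) / c i k)
    rwa [smul_smul, div_mul_cancel₀ _ (hc i k).ne'] at this
  have hu' : ∀ᶠ j in hyperfilter ℕ, ∀ i, ∀ k ∈ Finset.range (m + 1), u i k j ∈ Ω j :=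
    eventually_all.2 fun i => (Filter.eventually_all_finset _).2 fun k _ => hu i k
  filter_upwards [t4.eventually (gt_mem_nhds h1), hu'] with j hj huj
  intro w hw hw1
  have hws : w = ∑ i, inner ℝ (b i) (⟨w, hw⟩ : W) • ((b i : W) : EuclideanSpace ℝ ι) := by
    have := congrArg (Subtype.val) (b.sum_repr' ⟨w, hw⟩)
    simpa using this.symm
  have ha : ∀ i, |inner ℝ (b i) (⟨w, hw⟩ : W)| ≤ 1 := fun i => by
    refine (abs_real_inner_le_norm _ _).trans ?_
    rw [b.orthonormal.1 i, one_mul]; exact hw1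
  refine ⟨_, ⟨∑ p ∈ Finset.univ ×ˢ Finset.range (m + 1),
    (inner ℝ (b p.1) (⟨w, hw⟩ : W) * (ρ ^ (s - p.2) / c p.1 p.2)) • u p.1 p.2 j,
    (hΩ j).sum_mem _ ?_ ?_, rfl⟩, ?_⟩
  · rw [Finset.sum_product]
    refine le_trans (Finset.sum_le_sum fun i _ => Finset.sum_le_sum fun k _ => ?_) h2.le
    have hq : 0 ≤ ρ ^ (s - k) / c i k := div_nonneg (Real.rpow_nonneg hρ.le _) (hc i k).le
    rw [abs_mul, abs_of_nonneg hq]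
    exact mul_le_of_le_one_left hq (ha i)
  · intro p hp
    exact huj p.1 p.2 (Finset.mem_product.1 hp).2
  · rw [Finset.sum_product]
    simp only [mul_smul, ← Finset.smul_sum, map_sum, map_smul]
    simp only [← map_sum, ← map_smul]
    refine le_of_eq_of_le (congrArg (fun v => ‖_ - v‖) hws) ?_
    rw [map_sum, ← Finset.sum_sub_distrib]
    refine (norm_sum_le _ _).trans ((Finset.sum_le_sum fun i _ => ?_).trans hj.le)
    rw [map_smul, ← smul_sub, norm_smul]
    exact mul_le_of_le_one_left (norm_nonneg _) (ha i)

end Graded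

end

section

section Graded
open Filter Topology

variable {ι κ : Type*} [Fintype ι]

theorem Dg_mul (deg : ι → ℕ) (c d : ℕ → ℝ) : Dg deg c * Dg deg d = Dg deg (c * d) := by
  ext1 u; exact Dg_Dg deg c d u

theorem mu_mono_of_norm_lt {m : ℕ} {deg : ι → ℕ}
    {Z : κ → EuclideanSpace ℝ ι →ₗ[ℝ] EuclideanSpace ℝ ι}
    {W : Submodule ℝ (EuclideanSpace ℝ ι)} (hW : Good deg Z W)
    {P : EuclideanSpace ℝ ι →L[ℝ] EuclideanSpace ℝ ι}
    (hP : ∀ c x, P (Dg deg c x) = Dg deg c (P x)) (h : ‖W.starProjection - P‖ < 1) :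
    mu m deg W ≤ mu m deg (LinearMap.range (P : EuclideanSpace ℝ ι →ₗ[ℝ] EuclideanSpace ℝ ι)) := by
  refine Finset.sum_le_sum fun i _ => ?_
  set S := W.map (Dg deg (below (i + 1)) : EuclideanSpace ℝ ι →ₗ[ℝ] EuclideanSpace ℝ ι) with hS
  have hSW : ∀ v ∈ S, v ∈ W := by
    rintro _ ⟨w, hw, rfl⟩; exact hW.graded _ w hw
  rw [← finrank_map_add S (P : EuclideanSpace ℝ ι →ₗ[ℝ] EuclideanSpace ℝ ι)]
  have h1 : S ⊓ LinearMap.ker (P : EuclideanSpace ℝ ι →ₗ[ℝ] EuclideanSpace ℝ ι) = ⊥ := by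
    refine (Submodule.eq_bot_iff _).2 ?_
    rintro v ⟨hv, hk⟩
    have hk' : P v = 0 := hk
    have e1 : (W.starProjection - P) v = v := by
      rw [_root_.sub_apply, hk', sub_zero, Submodule.starProjection_eq_self_iff.2 (hSW v hv)]
    have e2 := (W.starProjection - P).le_opNorm v
    rw [e1] at e2
    by_contra hne
    have := norm_pos_iff.2 hne
    nlinarith
  rw [h1, finrank_bot, add_zero]
  refine Submodule.finrank_mono ?_
  rintro _ ⟨_, ⟨w, hw, rfl⟩, rfl⟩
  exact ⟨P w, ⟨w, rfl⟩, (hP _ w).symm⟩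

theorem mu_lt_of_section {m : ℕ} {deg : ι → ℕ} {Y : Submodule ℝ (EuclideanSpace ℝ ι)}
    {P Q : EuclideanSpace ℝ ι →L[ℝ] EuclideanSpace ℝ ι}
    (hP : ∀ c x, P (Dg deg c x) = Dg deg c (P x)) (hPQ : ∀ x, P (Q x) = P x)
    (hQY : ∀ x, Q x ∈ Y)
    (h : ∃ i ≤ m, ∃ y ∈ Y, Dg deg (below (i + 1)) y ≠ 0 ∧ P (Dg deg (below (i + 1)) y) = 0) :
    mu m deg (LinearMap.range (P : EuclideanSpace ℝ ι →ₗ[ℝ] EuclideanSpace ℝ ι)) < mu m deg Y := by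
  have key : ∀ i, Module.finrank ℝ
      ((LinearMap.range (P : EuclideanSpace ℝ ι →ₗ[ℝ] EuclideanSpace ℝ ι)).map
        (Dg deg (below (i + 1)) : EuclideanSpace ℝ ι →ₗ[ℝ] EuclideanSpace ℝ ι)) +
      Module.finrank ℝ ((Y.map (Dg deg (below (i + 1)) : EuclideanSpace ℝ ι →ₗ[ℝ] EuclideanSpace ℝ ι))
        ⊓ LinearMap.ker (P : EuclideanSpace ℝ ι →ₗ[ℝ] EuclideanSpace ℝ ι) : Submodule ℝ _) ≤
      Module.finrank ℝ (Y.map (Dg deg (below (i + 1)) :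
        EuclideanSpace ℝ ι →ₗ[ℝ] EuclideanSpace ℝ ι)) := by
    intro i
    rw [← finrank_map_add (Y.map (Dg deg (below (i + 1)) :
      EuclideanSpace ℝ ι →ₗ[ℝ] EuclideanSpace ℝ ι)) (P : EuclideanSpace ℝ ι →ₗ[ℝ] EuclideanSpace ℝ ι)]
    refine Nat.add_le_add_right (Submodule.finrank_mono ?_) _
    rintro _ ⟨_, ⟨x, rfl⟩, rfl⟩
    refine ⟨Dg deg (below (i + 1)) (Q x), ⟨Q x, hQY x, rfl⟩, ?_⟩
    change P (Dg deg (below (i + 1)) (Q x)) = Dg deg (below (i + 1)) (P x)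
    rw [hP, hPQ]
  obtain ⟨i, hi, y, hy, hne, hker⟩ := h
  refine Finset.sum_lt_sum (fun i _ => le_trans (Nat.le_add_right _ _) (key i))
    ⟨i, Finset.mem_range.2 (Nat.lt_succ_of_le hi), lt_of_lt_of_le ?_ (key i)⟩
  refine Nat.lt_add_of_pos_right (Nat.pos_of_ne_zero fun h0 => hne ?_)
  have hb := Submodule.finrank_eq_zero.1 h0
  exact (Submodule.eq_bot_iff _).1 hb _ ⟨⟨y, hy, rfl⟩, hker⟩

/-- Conjugation by the parabolic dilation. -/
def conj (deg : ι → ℕ) (s ρ : ℝ) (A : EuclideanSpace ℝ ι →L[ℝ] EuclideanSpace ℝ ι) :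
    EuclideanSpace ℝ ι →L[ℝ] EuclideanSpace ℝ ι :=
  Dg deg (dil s ρ) * A * Dg deg (dil s ρ⁻¹)

/-- The size of the part of an operator which lowers the degree. -/
def lower (m : ℕ) (deg : ι → ℕ) (A : EuclideanSpace ℝ ι →L[ℝ] EuclideanSpace ℝ ι) : ℝ :=
  ∑ i ∈ Finset.range (m + 1), ‖Dg deg (below (i + 1)) * A * Dg deg (1 - below (i + 1))‖

theorem continuous_lower (m : ℕ) (deg : ι → ℕ) : Continuous (lower m deg) := by
  unfold lower; fun_prop

theorem conj_one (deg : ι → ℕ) (s : ℝ) (A : EuclideanSpace ℝ ι →L[ℝ] EuclideanSpace ℝ ι) :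
    conj deg s 1 A = A := by
  have : Dg deg (1 : ℕ → ℝ) = 1 := by ext1 u; exact Dg_one deg u
  rw [conj, inv_one, dil_one, this, one_mul, mul_one]

theorem continuousOn_conj {deg : ι → ℕ} {m : ℕ} (hdeg : ∀ a, deg a ≤ m) (s : ℝ)
    (A : EuclideanSpace ℝ ι →L[ℝ] EuclideanSpace ℝ ι) :
    ContinuousOn (fun ρ => conj deg s ρ A) (Ioi 0) := by
  have h : ContinuousOn (fun ρ => Dg deg (dil s ρ)) (Ioi 0) := by
    simp only [Dg_eq_sum hdeg (dil s _)]
    refine continuousOn_finsetSum _ fun j _ => ?_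
    intro ρ hρ
    have hd : ContinuousWithinAt (fun ρ => dil s ρ j) (Ioi 0) ρ :=
      (Real.continuousAt_rpow_const ρ _ (Or.inl (ne_of_gt hρ))).continuousWithinAt
    exact hd.smul continuousWithinAt_const
  refine (h.mul continuousOn_const).mul (h.comp ?_ fun ρ (hρ : 0 < ρ) => show 0 < ρ⁻¹ from inv_pos.2 hρ)
  exact continuousOn_inv₀.mono fun ρ hρ => ne_of_gt hρ

theorem single_mul_dil (s ρ : ℝ) (i : ℕ) :
    (Pi.single i 1 * dil s ρ : ℕ → ℝ) = ρ ^ ((i : ℝ) - s) • Pi.single i 1 := by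
  ext j; by_cases h : j = i
  · subst h; simp [dil]
  · simp [h]

theorem Dg_smul (deg : ι → ℕ) (r : ℝ) (c : ℕ → ℝ) : Dg deg (r • c) = r • Dg deg c := by
  ext u a; simp [mul_assoc]

theorem norm_conj_le {deg : ι → ℕ} {m : ℕ} (hdeg : ∀ a, deg a ≤ m) (s : ℝ) {ρ : ℝ} (hρ : 0 < ρ)
    (hρ1 : ρ ≤ 1) (A : EuclideanSpace ℝ ι →L[ℝ] EuclideanSpace ℝ ι) :
    ‖conj deg s ρ A‖ ≤ (m + 1) ^ 2 * (‖A‖ + lower m deg (conj deg s ρ A)) := by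
  have hone : Dg deg (1 : ℕ → ℝ) = 1 := by ext1 u; exact Dg_one deg u
  set B := conj deg s ρ A with hB
  have hl0 : 0 ≤ lower m deg B := Finset.sum_nonneg fun _ _ => norm_nonneg _
  have hsum : B = ∑ i ∈ Finset.range (m + 1), ∑ j ∈ Finset.range (m + 1),
      Dg deg (Pi.single i 1) * B * Dg deg (Pi.single j 1) := by
    have h1 : (1 : EuclideanSpace ℝ ι →L[ℝ] EuclideanSpace ℝ ι) =
        ∑ j ∈ Finset.range (m + 1), Dg deg (Pi.single j 1) := by
      rw [← hone, Dg_eq_sum hdeg]; simp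
    calc B = 1 * B * 1 := by rw [one_mul, mul_one]
      _ = _ := by
        rw [h1, Finset.sum_mul, Finset.sum_mul]
        simp only [Finset.mul_sum]
  have hs1 : ∀ i, ‖Dg deg (Pi.single i 1)‖ ≤ 1 := fun i => by
    refine norm_Dg_le hdeg zero_le_one fun j _ => ?_
    by_cases h : j = i
    · subst h; simp
    · simp [h]
  have hterm : ∀ i ∈ Finset.range (m + 1), ∀ j,
      ‖Dg deg (Pi.single i 1) * B * Dg deg (Pi.single j 1)‖ ≤ ‖A‖ + lower m deg B := by
    intro i hi j
    rcases lt_or_ge i j with hij | hij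
    · have e1 : Dg deg (Pi.single i 1) = Dg deg (Pi.single i 1) * Dg deg (below (i + 1)) := by
        rw [Dg_mul]; congr 1; ext k; by_cases h : k = i
        · subst h; simp [below]
        · simp [h]
      have e2 : Dg deg (Pi.single j 1) = Dg deg (1 - below (i + 1)) * Dg deg (Pi.single j 1) := by
        rw [Dg_mul]; congr 1; ext k; by_cases h : k = j
        · subst h
          have : ¬ k < i + 1 := by omega
          simp [below, this]
        · simp [h]
      rw [e1, e2]
      set L := Dg deg (below (i + 1)) * B * Dg deg (1 - below (i + 1)) with hL
      have e3 : Dg deg (Pi.single i 1) * Dg deg (below (i + 1)) * B *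
          (Dg deg (1 - below (i + 1)) * Dg deg (Pi.single j 1)) =
          Dg deg (Pi.single i 1) * L * Dg deg (Pi.single j 1) := by
        rw [hL]; simp only [mul_assoc]
      rw [e3]
      have e4 : ‖L‖ ≤ lower m deg B :=
        Finset.single_le_sum (f := fun i => ‖Dg deg (below (i + 1)) * B * Dg deg (1 - below (i + 1))‖)
          (fun _ _ => norm_nonneg _) hi
      calc _ ≤ ‖Dg deg (Pi.single i 1)‖ * ‖L‖ * ‖Dg deg (Pi.single j 1)‖ :=
            (norm_mul_le _ _).trans (by gcongr; exact norm_mul_le _ _)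
        _ ≤ 1 * ‖L‖ * 1 := by gcongr <;> exact hs1 _
        _ ≤ ‖A‖ + lower m deg B := by linarith [norm_nonneg A]
    · have e1 : Dg deg (Pi.single i 1) * B * Dg deg (Pi.single j 1) =
          ρ ^ ((i : ℝ) - j) • (Dg deg (Pi.single i 1) * A * Dg deg (Pi.single j 1)) := by
        have a1 : Dg deg (Pi.single i 1) * B * Dg deg (Pi.single j 1) =
            (Dg deg (Pi.single i 1) * Dg deg (dil s ρ)) * A *
              (Dg deg (dil s ρ⁻¹) * Dg deg (Pi.single j 1)) := by
          rw [hB, conj]; simp only [mul_assoc]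
        rw [a1, Dg_mul, Dg_mul, mul_comm (dil s ρ⁻¹), single_mul_dil, single_mul_dil, Dg_smul,
          Dg_smul]
        generalize Dg deg (Pi.single i 1) = L, Dg deg (Pi.single j 1) = L'
        have a2 : ∀ a b : ℝ, (a • L) * A * (b • L') = (a * b) • (L * A * L') := by
          intro a b; ext1 u; simp [smul_smul, mul_comm]
        rw [a2]
        congr 1
        rw [Real.inv_rpow hρ.le, ← Real.rpow_neg hρ.le, ← Real.rpow_add hρ]
        congr 1; ring
      rw [e1, norm_smul, Real.norm_of_nonneg (Real.rpow_nonneg hρ.le _)]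
      have e2 : ρ ^ ((i : ℝ) - j) ≤ 1 := Real.rpow_le_one hρ.le hρ1 (by
        have : (j : ℝ) ≤ i := by exact_mod_cast hij
        linarith)
      calc _ ≤ 1 * (‖Dg deg (Pi.single i 1)‖ * ‖A‖ * ‖Dg deg (Pi.single j 1)‖) :=
            mul_le_mul e2 ((norm_mul_le _ _).trans (by gcongr; exact norm_mul_le _ _))
              (norm_nonneg _) zero_le_one
        _ ≤ 1 * (1 * ‖A‖ * 1) := by gcongr <;> exact hs1 _
        _ ≤ _ := by linarith
  calc ‖B‖ ≤ ∑ i ∈ Finset.range (m + 1), ∑ j ∈ Finset.range (m + 1),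
        ‖Dg deg (Pi.single i 1) * B * Dg deg (Pi.single j 1)‖ := by
        conv_lhs => rw [hsum]
        exact (norm_sum_le _ _).trans (Finset.sum_le_sum fun i _ => norm_sum_le _ _)
    _ ≤ ∑ i ∈ Finset.range (m + 1), ∑ j ∈ Finset.range (m + 1), (‖A‖ + lower m deg B) :=
        Finset.sum_le_sum fun i hi => Finset.sum_le_sum fun j _ => hterm i hi j
    _ = _ := by simp; ring

theorem lower_le {deg : ι → ℕ} {m : ℕ} (hdeg : ∀ a, deg a ≤ m)
    (A : EuclideanSpace ℝ ι →L[ℝ] EuclideanSpace ℝ ι) : lower m deg A ≤ (m + 1) * ‖A‖ := by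
  have h1 : ∀ i, ‖Dg deg (below i)‖ ≤ 1 := fun i =>
    norm_Dg_le hdeg zero_le_one fun j _ => by by_cases h : j < i <;> simp [below, h]
  have h2 : ∀ i, ‖Dg deg (1 - below i)‖ ≤ 1 := fun i =>
    norm_Dg_le hdeg zero_le_one fun j _ => by by_cases h : j < i <;> simp [below, h]
  calc lower m deg A ≤ ∑ i ∈ Finset.range (m + 1), 1 * ‖A‖ * 1 := by
        refine Finset.sum_le_sum fun i _ => ?_
        refine (norm_mul_le _ _).trans ?_
        gcongr
        · exact (norm_mul_le _ _).trans (by gcongr; exact h1 _)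
        · exact h2 _
    _ = _ := by simp

end Graded

end

section

section Graded
open Filter Topology

variable {ι κ : Type*} [Fintype ι]

theorem dil_le_one {s ρ : ℝ} {m : ℕ} (hs : m < s) (hρ : 1 ≤ ρ) {j : ℕ} (hj : j ≤ m) :
    |dil s ρ j| ≤ 1 := by
  have : (j : ℝ) ≤ m := by exact_mod_cast hj
  rw [dil, abs_of_nonneg (Real.rpow_nonneg (by linarith) _)]
  exact Real.rpow_le_one_of_one_le_of_nonpos hρ (by linarith)

theorem conj_mem {deg : ι → ℕ} {m : ℕ} (hdeg : ∀ a, deg a ≤ m) {s : ℝ} (hs : m < s) {ρ : ℝ}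
    (hρ : 0 < ρ) (hρ1 : ρ ≤ 1) {Ω : Set (EuclideanSpace ℝ ι)} {R : ℝ}
    {A : EuclideanSpace ℝ ι →L[ℝ] EuclideanSpace ℝ ι}
    (h : ∀ x, ‖x‖ ≤ 1 → ∃ u ∈ Ω, A x = R • u) (x : EuclideanSpace ℝ ι) (hx : ‖x‖ ≤ 1) :
    ∃ u ∈ Dg deg (dil s ρ) '' Ω, conj deg s ρ A x = R • u := by
  have h1 : ‖Dg deg (dil s ρ⁻¹) x‖ ≤ 1 := by
    refine ((Dg deg (dil s ρ⁻¹)).le_opNorm x).trans ?_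
    have := norm_Dg_le hdeg zero_le_one fun j hj =>
      dil_le_one hs (one_le_inv_iff₀.2 ⟨hρ, hρ1⟩) hj
    exact mul_le_one₀ this (norm_nonneg _) hx
  obtain ⟨u, hu, hAu⟩ := h _ h1
  refine ⟨_, ⟨u, hu, rfl⟩, ?_⟩
  rw [← map_smul, ← hAu]; rfl

theorem conj_section {deg : ι → ℕ} {Z : κ → EuclideanSpace ℝ ι →ₗ[ℝ] EuclideanSpace ℝ ι} {s ρ : ℝ}
    (hρ : 0 < ρ) {W : Submodule ℝ (EuclideanSpace ℝ ι)} (hW : Good deg Z W)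
    {A : EuclideanSpace ℝ ι →L[ℝ] EuclideanSpace ℝ ι}
    (h1 : ∀ x, W.starProjection (A x) = W.starProjection x)
    (h2 : ∀ x, A (W.starProjection x) = A x) (x : EuclideanSpace ℝ ι) :
    W.starProjection (conj deg s ρ A x) = W.starProjection x ∧
    conj deg s ρ A (W.starProjection x) = conj deg s ρ A x := by
  constructor
  · change W.starProjection (Dg deg (dil s ρ) (A (Dg deg (dil s ρ⁻¹) x))) = _
    rw [hW.starProjection_Dg, h1, hW.starProjection_Dg, Dg_Dg, dil_mul hρ.le (inv_nonneg.2 hρ.le),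
      mul_inv_cancel₀ hρ.ne', dil_one, Dg_one]
  · change Dg deg (dil s ρ) (A (Dg deg (dil s ρ⁻¹) (W.starProjection x))) =
      Dg deg (dil s ρ) (A (Dg deg (dil s ρ⁻¹) x))
    rw [← hW.starProjection_Dg, h2]

theorem tendsto_clm_apply {V τ : Type*} [NormedAddCommGroup V] [NormedSpace ℝ V] {l : Filter τ}
    {F : τ → V →L[ℝ] V} {P : V →L[ℝ] V} {x : τ → V} {y : V} (hF : Tendsto F l (𝓝 P))
    (hx : Tendsto x l (𝓝 y)) : Tendsto (fun t => F t (x t)) l (𝓝 (P y)) :=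
  (isBoundedBilinearMap_apply.continuous.tendsto (P, y)).comp (hF.prodMk_nhds hx)

set_option maxHeartbeats 800000 in
theorem no_degenerate_sequence {deg : ι → ℕ} {m : ℕ} (hdeg : ∀ a, deg a ≤ m) {s : ℝ} (hs : m < s)
    {Z : κ → EuclideanSpace ℝ ι →ₗ[ℝ] EuclideanSpace ℝ ι}
    (hZ : ∀ c i u, Dg deg c (Z i u) = Z i (Dg deg (c ∘ Nat.succ) u))
    {ε Cw R K G : ℝ} (hε : 0 < ε) (hCw : 0 < Cw) (hR : 0 < R) (hG : 0 < G)
    {Ω : ℕ → Set (EuclideanSpace ℝ ι)} (hΩ : ∀ j, CS (Ω j)) (hΩZ : ∀ j, ZStable Cw Z (Ω j))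
    {W : ℕ → Submodule ℝ (EuclideanSpace ℝ ι)} (hW : ∀ j, Good deg Z (W j))
    {B : ℕ → EuclideanSpace ℝ ι →L[ℝ] EuclideanSpace ℝ ι}
    (hB1 : ∀ j x, (W j).starProjection (B j x) = (W j).starProjection x)
    (hBn : ∀ j, ‖B j‖ ≤ K)
    (hBΩ : ∀ j x, ‖x‖ ≤ 1 → ∃ u ∈ Ω j, B j x = R • u)
    (hdegen : ∀ j, lower m deg (B j) = G ∨
      ∃ p ∈ Ω j, (W j).starProjection p = 0 ∧ ‖p‖ = 1) :
    ∃ ρ : ℝ, 0 < ρ ∧ ρ ≤ 1 ∧ ∀ᶠ j in hyperfilter ℕ, ∃ W', Good deg Z W' ∧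
      mu m deg (W j) < mu m deg W' ∧ Weak ε (Dg deg (dil s ρ) '' Ω j) W' := by
  set Y := limSp Ω hΩ with hY
  obtain ⟨ρ, hρ, hρ1, hweak⟩ := exists_weak_inSp hdeg hs hε hΩ
  obtain ⟨P, hP⟩ : ∃ P, Tendsto (fun j => (W j).starProjection) (hyperfilter ℕ) (𝓝 P) :=
    exists_tendsto_hyperfilter (c := 0) (R := 1) fun j => by
      rw [dist_zero_right]; exact Submodule.starProjection_norm_le _
  obtain ⟨Q, hQ⟩ : ∃ Q, Tendsto B (hyperfilter ℕ) (𝓝 Q) :=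
    exists_tendsto_hyperfilter (c := 0) (R := K) fun j => by
      rw [dist_zero_right]; exact hBn j
  have hPx : ∀ x, Tendsto (fun j => (W j).starProjection x) (hyperfilter ℕ) (𝓝 (P x)) :=
    fun x => ((ContinuousLinearMap.apply ℝ _ x).continuous.tendsto P).comp hP
  have hQx : ∀ x, Tendsto (fun j => B j x) (hyperfilter ℕ) (𝓝 (Q x)) :=
    fun x => ((ContinuousLinearMap.apply ℝ _ x).continuous.tendsto Q).comp hQ
  have hPc : ∀ c x, P (Dg deg c x) = Dg deg c (P x) := by
    intro c x
    refine tendsto_nhds_unique (hPx _) ?_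
    refine Tendsto.congr (fun j => ((hW j).starProjection_Dg c x).symm) ?_
    exact ((Dg deg c).continuous.tendsto _).comp (hPx x)
  have hPQ : ∀ x, P (Q x) = P x := by
    intro x
    have h2 := tendsto_clm_apply hP (hQx x)
    refine tendsto_nhds_unique h2 (Tendsto.congr (fun j => ?_) (hPx x))
    exact (hB1 j x).symm
  have hQY : ∀ x, Q x ∈ Y := by
    intro x
    have hpos : 0 < ‖x‖ + 1 := by positivity
    refine ⟨(R * (‖x‖ + 1))⁻¹, by positivity, fun j => (R * (‖x‖ + 1))⁻¹ • B j x,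
      Eventually.of_forall fun j => ?_, (hQx x).const_smul _⟩
    obtain ⟨u, hu, hBu⟩ := hBΩ j ((‖x‖ + 1)⁻¹ • x) (by
      rw [norm_smul, norm_inv, Real.norm_of_nonneg hpos.le, inv_mul_le_iff₀ hpos]; linarith)
    rw [map_smul] at hBu
    have : (R * (‖x‖ + 1))⁻¹ • B j x = u := by
      rw [mul_inv, mul_smul, hBu, smul_smul, inv_mul_cancel₀ hR.ne', one_smul]
    change (R * (‖x‖ + 1))⁻¹ • B j x ∈ Ω j
    rw [this]; exact hu
  have hex : ∃ i ≤ m, ∃ y ∈ Y, Dg deg (below (i + 1)) y ≠ 0 ∧ P (Dg deg (below (i + 1)) y) = 0 := by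
    rcases Ultrafilter.eventually_or.1 (Eventually.of_forall hdegen : ∀ᶠ j in hyperfilter ℕ, _)
      with hd | hd
    · have hlow : lower m deg Q = G := by
        refine tendsto_nhds_unique (((continuous_lower m deg).tendsto Q).comp hQ) ?_
        refine Tendsto.congr' ?_ (tendsto_const_nhds (x := G))
        filter_upwards [hd] with j hj using hj.symm
      have : ∃ i ∈ Finset.range (m + 1),
          Dg deg (below (i + 1)) * Q * Dg deg (1 - below (i + 1)) ≠ 0 := by
        by_contra! hc
        have : lower m deg Q = 0 := Finset.sum_eq_zero fun i hi => by rw [hc i hi, norm_zero]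
        linarith
      obtain ⟨i, hi, hne⟩ := this
      obtain ⟨x, hx⟩ : ∃ x, (Dg deg (below (i + 1)) * Q * Dg deg (1 - below (i + 1))) x ≠ 0 := by
        by_contra! hc
        exact hne (ContinuousLinearMap.ext fun x => hc x)
      refine ⟨i, Nat.lt_succ_iff.1 (Finset.mem_range.1 hi), Q (Dg deg (1 - below (i + 1)) x),
        hQY _, hx, ?_⟩
      rw [hPc, hPQ, hPc, Dg_Dg]
      have : below (i + 1) * (1 - below (i + 1)) = 0 := by
        ext j; by_cases h : j < i + 1 <;> simp [below, h]
      rw [this, Dg_zero]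
    · have hd' : ∃ p : ℕ → EuclideanSpace ℝ ι, ∀ j, ‖p j‖ ≤ 1 ∧
          ((∃ p ∈ Ω j, (W j).starProjection p = 0 ∧ ‖p‖ = 1) →
            p j ∈ Ω j ∧ (W j).starProjection (p j) = 0 ∧ ‖p j‖ = 1) := by
        refine ⟨fun j => open Classical in if h : ∃ p ∈ Ω j, (W j).starProjection p = 0 ∧ ‖p‖ = 1 then
          h.choose else 0, fun j => ?_⟩
        by_cases h : ∃ p ∈ Ω j, (W j).starProjection p = 0 ∧ ‖p‖ = 1
        · simp only [h, dif_pos]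
          exact ⟨h.choose_spec.2.2.le, fun _ => h.choose_spec⟩
        · simp only [h, dif_neg, not_false_iff]
          exact ⟨by simp, fun h' => h'.elim⟩
      obtain ⟨p, hp⟩ := hd'
      obtain ⟨q, hq⟩ : ∃ q, Tendsto p (hyperfilter ℕ) (𝓝 q) :=
        exists_tendsto_hyperfilter (c := 0) (R := 1) fun j => by
          rw [dist_zero_right]; exact (hp j).1
      have hev : ∀ᶠ j in hyperfilter ℕ, p j ∈ Ω j ∧ (W j).starProjection (p j) = 0 ∧ ‖p j‖ = 1 := by
        filter_upwards [hd] with j hj using (hp j).2 hj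
      have hfull : Dg deg (below (m + 1)) = Dg deg 1 :=
        Dg_congr hdeg fun j hj => by simp [below, Nat.lt_succ_of_le hj]
      refine ⟨m, le_rfl, q, ⟨1, one_pos, p, hev.mono fun j h => h.1, by rwa [one_smul]⟩, ?_, ?_⟩
      · rw [hfull, Dg_one]
        have : ‖q‖ = 1 := tendsto_nhds_unique hq.norm
          (Tendsto.congr' (hev.mono fun j h => h.2.2.symm) tendsto_const_nhds)
        intro h0; rw [h0, norm_zero] at this; exact zero_ne_one this
      · rw [hfull, Dg_one]
        have h1 : Tendsto (fun j => (W j).starProjection (p j)) (hyperfilter ℕ) (𝓝 (P q)) :=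
          tendsto_clm_apply hP hq
        exact tendsto_nhds_unique h1
          (Tendsto.congr' (hev.mono fun j h => h.2.1.symm) tendsto_const_nhds)
  have hlt := mu_lt_of_section hPc hPQ hQY hex
  have hgood : Good deg Z (inSp deg Y) := good_inSp hZ fun i y hy => limSp_mul hΩ hCw hΩZ i hy
  have hclose : ∀ᶠ j in hyperfilter ℕ, ‖(W j).starProjection - P‖ < 1 := by
    have := (hP.sub_const P).norm
    rw [sub_self, norm_zero] at this
    exact this.eventually (gt_mem_nhds one_pos)
  refine ⟨ρ, hρ, hρ1, ?_⟩
  filter_upwards [hweak, hclose] with j h1 h2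
  exact ⟨_, hgood, ((mu_mono_of_norm_lt (hW j) hPc h2).trans_lt hlt).trans_le (mu_le_inSp m deg Y), h1⟩

theorem exists_dichotomy {deg : ι → ℕ} {m : ℕ} (hdeg : ∀ a, deg a ≤ m) {s : ℝ} (hs : m < s)
    {Z : κ → EuclideanSpace ℝ ι →ₗ[ℝ] EuclideanSpace ℝ ι}
    (hZ : ∀ c i u, Dg deg c (Z i u) = Z i (Dg deg (c ∘ Nat.succ) u))
    {ε Cw Rh : ℝ} (hε : 0 < ε) (hCw : 0 < Cw) (hRh : 0 < Rh) :
    ∃ R : ℝ, 1 ≤ R ∧ ∃ ρ₁ : ℝ, 0 < ρ₁ ∧ ρ₁ ≤ 1 ∧ ∀ (Ω : Set (EuclideanSpace ℝ ι))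
      (W : Submodule ℝ (EuclideanSpace ℝ ι)) (ρ : ℝ), CS Ω →
      (∀ ρ', 0 < ρ' → ρ' ≤ 1 → ZStable Cw Z (Dg deg (dil s ρ') '' Ω)) → Good deg Z W →
      Strong Rh Ω W → 0 < ρ → ρ ≤ 1 →
      (∀ ρ', ρ₁ * ρ ≤ ρ' → ρ' ≤ 1 → ∀ W', Good deg Z W' → mu m deg W < mu m deg W' →
        ¬ Weak ε (Dg deg (dil s ρ') '' Ω) W') →
      Strong R (Dg deg (dil s ρ) '' Ω) W ∧
        ∀ u ∈ Dg deg (dil s ρ) '' Ω, W.starProjection u = 0 → ‖u‖ ≤ R := by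
  by_contra! hcon
  set G : ℝ := (m + 1) * Rh + 1 with hG
  have hG0 : 0 < G := by positivity
  set K : ℝ := (m + 1) ^ 2 * (Rh + G) with hK
  have hK0 : 0 ≤ K := by positivity
  choose Ω W ρ hΩ hΩZ hW hstr hρ hρ1 hno hfail using fun j : ℕ =>
    hcon (K + Rh + 1 + j) (by have : (0:ℝ) ≤ j := Nat.cast_nonneg j; linarith) (1 / ((j : ℝ) + 1))
      (by positivity) (by
        rw [div_le_one (by positivity)]; have : (0:ℝ) ≤ j := Nat.cast_nonneg j; linarith)
  choose A hA1 hA2 hAn hAΩ using hstr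
  have key : ∀ j, ∃ ρ', ρ j ≤ ρ' ∧ ρ' ≤ 1 ∧ lower m deg (conj deg s ρ' (A j)) ≤ G ∧
      (lower m deg (conj deg s ρ' (A j)) = G ∨
        ∃ p ∈ Dg deg (dil s ρ') '' Ω j, (W j).starProjection p = 0 ∧ ‖p‖ = 1) := by
    intro j
    rcases le_or_gt (lower m deg (conj deg s (ρ j) (A j))) G with hle | hgt
    · refine ⟨ρ j, le_rfl, hρ1 j, hle, Or.inr ?_⟩
      have hcs : CS (Dg deg (dil s (ρ j)) '' Ω j) := (hΩ j).image (Dg deg (dil s (ρ j))).toLinearMap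
      have hj0 : (0 : ℝ) ≤ j := Nat.cast_nonneg j
      have hn : ‖conj deg s (ρ j) (A j)‖ ≤ K := by
        refine (norm_conj_le hdeg s (hρ j) (hρ1 j) (A j)).trans ?_
        rw [hK]; gcongr; exact hAn j
      have hS : Strong (K + Rh + 1 + j) (Dg deg (dil s (ρ j)) '' Ω j) (W j) := by
        refine ⟨conj deg s (ρ j) (A j), fun x => (conj_section (hρ j) (hW j) (hA1 j) (hA2 j) x).1,
          fun x => (conj_section (hρ j) (hW j) (hA1 j) (hA2 j) x).2, by linarith, fun x hx => ?_⟩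
        obtain ⟨u, hu, hc⟩ := conj_mem hdeg hs (hρ j) (hρ1 j) (hAΩ j) x hx
        obtain ⟨v, hv, e⟩ := hcs.smul_mem_of_le (R' := K + Rh + 1 + j) hRh.le (by linarith) hu
        exact ⟨v, hv, hc.trans e⟩
      obtain ⟨u, hu, hu0, hun⟩ := hfail j hS
      have hu1 : 1 ≤ ‖u‖ := by linarith
      refine ⟨‖u‖⁻¹ • u, hcs.smul_mem ?_ hu, by rw [map_smul, hu0, smul_zero], ?_⟩
      · rw [abs_of_nonneg (by positivity)]; exact inv_le_one_of_one_le₀ hu1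
      · rw [norm_smul, norm_inv, norm_norm, inv_mul_cancel₀ (by linarith)]
    · have hcont : ContinuousOn (fun t => lower m deg (conj deg s t (A j))) (Icc (ρ j) 1) :=
        ((continuous_lower m deg).comp_continuousOn (continuousOn_conj hdeg s (A j))).mono
          fun t ht => (hρ j).trans_le ht.1
      have h1 : lower m deg (conj deg s 1 (A j)) ≤ G := by
        rw [conj_one]
        refine (lower_le hdeg _).trans ?_
        have : (m + 1) * ‖A j‖ ≤ (m + 1) * Rh := by gcongr; exact hAn j
        rw [hG]; linarith
      obtain ⟨t, ht, htG⟩ := intermediate_value_Icc' (hρ1 j) hcont ⟨h1, hgt.le⟩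
      exact ⟨t, ht.1, ht.2, htG.le, Or.inl htG⟩
  choose t ht ht1 htG htd using key
  have ht0 : ∀ j, 0 < t j := fun j => (hρ j).trans_le (ht j)
  have hfin := no_degenerate_sequence hdeg hs hZ hε hCw hRh hG0 (K := K)
    (Ω := fun j => Dg deg (dil s (t j)) '' Ω j)
    (fun j => (hΩ j).image (Dg deg (dil s (t j))).toLinearMap)
    (fun j => hΩZ j _ (ht0 j) (ht1 j)) hW (B := fun j => conj deg s (t j) (A j))
    (fun j x => (conj_section (ht0 j) (hW j) (hA1 j) (hA2 j) x).1)
    (fun j => by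
        refine (norm_conj_le hdeg s (ht0 j) (ht1 j) (A j)).trans ?_
        rw [hK]; gcongr
        · exact hAn j
        · exact htG j)
    (fun j x hx => conj_mem hdeg hs (ht0 j) (ht1 j) (hAΩ j) x hx) htd
  obtain ⟨ρ₀, hρ₀, hρ₀1, hev⟩ := hfin
  have hlarge : ∀ᶠ j : ℕ in hyperfilter ℕ, 1 / ((j : ℝ) + 1) ≤ ρ₀ := by
    have : ∀ᶠ j : ℕ in atTop, 1 / ((j : ℝ) + 1) < ρ₀ :=
      tendsto_one_div_add_atTop_nhds_zero_nat.eventually (gt_mem_nhds hρ₀)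
    exact (this.filter_mono Nat.hyperfilter_le_atTop).mono fun _ h => h.le
  obtain ⟨j, ⟨W', hW', hmu, hwk⟩, hj⟩ := (hev.and hlarge).exists
  rw [image_dil_dil deg hρ₀.le (ht0 j).le] at hwk
  refine hno j (ρ₀ * t j) ?_ ?_ W' hW' hmu hwk
  · exact mul_le_mul hj (ht j) (hρ j).le hρ₀.le
  · exact mul_le_one₀ hρ₀1 (ht0 j).le (ht1 j)

end Graded

end

section

variable {n m : ℕ}

/-- Coordinate space of jets of order `m`. -/
abbrev XX (n m : ℕ) := EuclideanSpace ℝ ↥(idx n m)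

/-- The order of a multi-index. -/
def dg (n m : ℕ) : ↥(idx n m) → ℕ := fun a => a.1.degree

theorem dg_le (a : ↥(idx n m)) : dg n m a ≤ m := mem_idx.1 a.2

/-- Normalized coordinates of a jet at scale `δ`. -/
def jet (m : ℕ) (s δ : ℝ) : Poly n →ₗ[ℝ] XX n m where
  toFun p := WithLp.toLp 2 fun a => √(mfact a.1) * δ ^ ((a.1.degree : ℝ) - s) * p.coeff a.1
  map_add' p q := by ext a; simp [mul_add]
  map_smul' c p := by ext a; simp; ring

@[simp] theorem jet_apply (s δ : ℝ) (p : Poly n) (a : ↥(idx n m)) :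
    jet m s δ p a = √(mfact a.1) * δ ^ ((a.1.degree : ℝ) - s) * p.coeff a.1 := rfl

theorem jet_eq_dil (s δ : ℝ) (p : Poly n) : jet m s δ p = Dg (dg n m) (dil s δ) (jet m s 1 p) := by
  ext a; simp [dil, dg]; ring

theorem one_le_sqrt_mfact (α : Fin n →₀ ℕ) : 1 ≤ √(mfact α : ℝ) := by
  rw [Real.one_le_sqrt]; exact_mod_cast mfact_pos α

theorem exists_norm_jet_le (n m : ℕ) : ∃ C : ℝ, 1 ≤ C ∧ ∀ (s δ : ℝ) (p : Poly n), 0 < δ →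
    ‖jet m s δ p‖ ≤ C * (wn m δ p / δ ^ s) := by
  refine ⟨∑ α ∈ idx n m, √(mfact α), ?_, ?_⟩
  · exact (one_le_sqrt_mfact 0).trans (Finset.single_le_sum (f := fun α => √(mfact α : ℝ))
      (fun _ _ => Real.sqrt_nonneg _) (zero_mem_idx (n := n) (m := m)))
  · intro s δ p hδ
    have h1 : ‖jet m s δ p‖ ≤ ∑ a : ↥(idx n m), |jet m s δ p a| := by
      have := norm_sum_le Finset.univ fun a : ↥(idx n m) =>
        EuclideanSpace.single (𝕜 := ℝ) a (jet m s δ p a)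
      simp only [PiLp.norm_single, Real.norm_eq_abs] at this
      refine le_trans (le_of_eq ?_) this
      congr 1
      ext a
      simp [Finset.sum_apply, Pi.single_apply]
    refine h1.trans ?_
    rw [Finset.sum_mul, ← Finset.sum_coe_sort (idx n m)]
    refine Finset.sum_le_sum fun a _ => ?_
    have h2 := abs_coeff_le_wn hδ.le (mem_idx.1 a.2) p
    rw [jet_apply, abs_mul, abs_mul, abs_of_nonneg (Real.sqrt_nonneg _),
      abs_of_pos (Real.rpow_pos_of_pos hδ _), mul_assoc, Real.rpow_sub hδ, Real.rpow_natCast]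
    gcongr
    rw [div_mul_eq_mul_div]
    gcongr
    linarith

theorem exists_wn_le_jet (n m : ℕ) : ∃ C : ℝ, 1 ≤ C ∧ ∀ (s δ : ℝ) (p : Poly n), 0 < δ →
    wn m δ p ≤ C * (δ ^ s * ‖jet m s δ p‖) := by
  refine ⟨(idx n m).card, ?_, ?_⟩
  · exact_mod_cast Finset.card_pos.2 ⟨0, zero_mem_idx⟩
  · intro s δ p hδ
    unfold wn
    rw [← nsmul_eq_mul]
    refine Finset.sum_le_card_nsmul _ _ _ fun α hα => ?_
    have h := PiLp.norm_apply_le (jet m s δ p) ⟨α, hα⟩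
    rw [jet_apply, Real.norm_eq_abs, abs_mul, abs_mul, abs_of_nonneg (Real.sqrt_nonneg _),
      abs_of_pos (Real.rpow_pos_of_pos hδ _), Real.rpow_sub hδ, Real.rpow_natCast] at h
    have h3 : δ ^ s * (1 * (δ ^ α.degree / δ ^ s) * |p.coeff α|) ≤ δ ^ s * ‖jet m s δ p‖ := by
      refine mul_le_mul_of_nonneg_left (le_trans ?_ h) (by positivity)
      gcongr
      exact one_le_sqrt_mfact α
    have h4 : δ ^ s ≠ 0 := (Real.rpow_pos_of_pos hδ _).ne'
    refine le_trans (le_of_eq ?_) h3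
    field_simp

theorem jet_surjective (s : ℝ) (u : XX n m) : ∃ p : Poly n, jet m s 1 p = u := by
  refine ⟨∑ a : ↥(idx n m), MvPolynomial.monomial a.1 (u a / √(mfact a.1)), ?_⟩
  ext a
  have h : √(mfact a.1 : ℝ) ≠ 0 := (zero_lt_one.trans_le (one_le_sqrt_mfact a.1)).ne'
  have h2 : (∑ b : ↥(idx n m), if b.1 = a.1 then u b / √(mfact b.1 : ℝ) else 0)
      = u a / √(mfact a.1 : ℝ) := by
    rw [Finset.sum_eq_single a]
    · simp
    · intro b _ hb
      exact if_neg fun h => hb (Subtype.ext h)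
    · simp
  simp only [jet_apply, MvPolynomial.coeff_sum, MvPolynomial.coeff_monomial, h2]
  simp
  field_simp

theorem jet_eq_jet_iff {s : ℝ} {p q : Poly n} :
    jet m s 1 p = jet m s 1 q ↔ ∀ α : Fin n →₀ ℕ, α.degree ≤ m → p.coeff α = q.coeff α := by
  constructor
  · intro h α hα
    have h1 := congrArg (fun u : XX n m => u ⟨α, mem_idx.2 hα⟩) h
    have h0 : √(mfact α : ℝ) ≠ 0 := (zero_lt_one.trans_le (one_le_sqrt_mfact α)).ne'
    simpa [jet_apply, h0] using h1
  · intro h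
    ext a
    simp [h a.1 (mem_idx.1 a.2)]

/-- Multiplication by the `i`-th coordinate, in normalized coordinates. -/
def Zop (n m : ℕ) (i : Fin n) : XX n m →ₗ[ℝ] XX n m where
  toFun u := WithLp.toLp 2 fun a => if h : a.1 i = 0 then 0 else
    √(a.1 i) * u ⟨a.1 - Finsupp.single i 1, mem_idx.2 ((Finsupp.degree_mono (by
      exact tsub_le_self)).trans (mem_idx.1 a.2))⟩
  map_add' u v := by ext a; simp; split_ifs <;> simp [mul_add]
  map_smul' c u := by
    ext a
    simp only [PiLp.smul_apply, smul_eq_mul, RingHom.id_apply, mul_dite, mul_zero]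
    split_ifs
    · rfl
    · ring

theorem Zop_apply_zero {i : Fin n} (u : XX n m) {a : ↥(idx n m)} (h : a.1 i = 0) :
    Zop n m i u a = 0 := by simp [Zop, h]

theorem Zop_apply_add {i : Fin n} (u : XX n m) {α : Fin n →₀ ℕ} (h : α ∈ idx n m)
    (h' : α + Finsupp.single i 1 ∈ idx n m) :
    Zop n m i u ⟨α + Finsupp.single i 1, h'⟩ = √(α i + 1) * u ⟨α, h⟩ := by
  simp [Zop]

theorem eq_add_single {i : Fin n} {α : Fin n →₀ ℕ} (h : α i ≠ 0) :
    ∃ β, α = β + Finsupp.single i 1 := by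
  refine ⟨α - Finsupp.single i 1, (tsub_add_cancel_of_le ?_).symm⟩
  rw [Finsupp.single_le_iff]; omega

theorem mem_idx_of_add_single {i : Fin n} {α : Fin n →₀ ℕ}
    (h : α + Finsupp.single i 1 ∈ idx n m) : α ∈ idx n m := by
  rw [mem_idx, degree_add_single] at h; rw [mem_idx]; omega

theorem Dg_Zop (c : ℕ → ℝ) (i : Fin n) (u : XX n m) :
    Dg (dg n m) c (Zop n m i u) = Zop n m i (Dg (dg n m) (c ∘ Nat.succ) u) := by
  ext ⟨α, hα⟩
  by_cases h : α i = 0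
  · simp [Zop_apply_zero (a := ⟨α, hα⟩) _ h]
  · obtain ⟨β, rfl⟩ := eq_add_single h
    have hβ := mem_idx_of_add_single hα
    rw [Dg_apply, Zop_apply_add _ hβ, Zop_apply_add _ hβ, Dg_apply]
    simp [dg, degree_add_single]
    ring

theorem jet_X_mul {s δ : ℝ} (hδ : 0 < δ) (i : Fin n) (p : Poly n) :
    jet m s δ (MvPolynomial.X i * p) = δ • Zop n m i (jet m s δ p) := by
  ext ⟨α, hα⟩
  rw [PiLp.smul_apply]
  by_cases h : α i = 0
  · rw [Zop_apply_zero (a := ⟨α, hα⟩) _ h]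
    simp [MvPolynomial.coeff_X_mul', h]
  · obtain ⟨β, rfl⟩ := eq_add_single h
    have hβ := mem_idx_of_add_single hα
    have hc : (MvPolynomial.X i * p).coeff (β + Finsupp.single i 1) = p.coeff β := by
      rw [add_comm, MvPolynomial.coeff_X_mul]
    rw [Zop_apply_add _ hβ, jet_apply, jet_apply, hc, mfact_add_single, degree_add_single]
    push_cast
    rw [Real.sqrt_mul (by positivity), show (β.degree : ℝ) + 1 - s = 1 + (β.degree - s) by ring,
      Real.rpow_add hδ, Real.rpow_one]
    simp
    ring

theorem hasFDerivAt_inner_jet {s : ℝ} {G : Sp n → Poly n} (hG : IsPT m G) (w : XX n m)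
    (x : Sp n) : HasFDerivAt (fun y => inner ℝ w (jet m s 1 (G y)))
      (lin fun i => inner ℝ (Zop n m i w) (jet m s 1 (G x))) x := by
  have hcomp : ∀ a : ↥(idx n m), HasFDerivAt (fun y => jet m s 1 (G y) a)
      (lin fun i => √(mfact a.1) * (if a.1.degree < m then
        (MvPolynomial.pderiv i (G x)).coeff a.1 else 0)) x := by
    intro a
    by_cases ha : a.1.degree < m
    · simp only [ha, if_true, jet_apply, Real.one_rpow, mul_one]
      have := (hG.1 a.1 ha x).const_mul √(mfact a.1 : ℝ)
      refine this.congr_fderiv ?_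
      ext v
      simp [lin_apply, Finset.mul_sum, mul_assoc]
    · have hd : a.1.degree = m := le_antisymm (mem_idx.1 a.2) (not_lt.1 ha)
      have hc : (fun y => jet m s 1 (G y) a) = fun _ => jet m s 1 (G x) a := by
        ext y
        have := hG.2 a.1 hd y trivial x trivial
        simp only [zero_mul] at this
        have := sub_eq_zero.1 (abs_eq_zero.1 (le_antisymm this (abs_nonneg _)))
        simp [jet_apply, this]
      rw [hc]
      refine (hasFDerivAt_const _ _).congr_fderiv ?_
      ext v
      simp [lin_apply, ha]
  have hsum := HasFDerivAt.fun_sum (u := Finset.univ) fun a _ => (hcomp a).const_mul (w a)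
  have hfun : (fun y => inner ℝ w (jet m s 1 (G y))) =
      fun y => ∑ a, w a * jet m s 1 (G y) a := by
    ext y
    simp [PiLp.inner_apply, mul_comm]
  rw [hfun]
  refine hsum.congr_fderiv ?_
  ext v
  simp only [_root_.sum_apply, _root_.smul_apply, lin_apply, smul_eq_mul,
    Finset.mul_sum]
  rw [Finset.sum_comm]
  refine Finset.sum_congr rfl fun i _ => ?_
  rw [PiLp.inner_apply, Finset.sum_mul]
  simp only [RCLike.inner_apply, conj_trivial]
  -- compare the two sums through the shift of multi-indices by `single i 1`
  have hL : ∀ a : ↥(idx n m), ¬ a.1.degree < m →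
      w a * (√(mfact a.1) * (if a.1.degree < m then
        (MvPolynomial.pderiv i (G x)).coeff a.1 else 0) * v i) = 0 := by
    intro a ha; simp [ha]
  symm
  rw [← Finset.sum_filter_of_ne (p := fun b : ↥(idx n m) => b.1 i ≠ 0),
    ← Finset.sum_filter_of_ne (s := Finset.univ) (p := fun a : ↥(idx n m) => a.1.degree < m)]
  · refine (Finset.sum_bij (fun (a : ↥(idx n m)) ha =>
      (⟨a.1 + Finsupp.single i 1, mem_idx.2 (by
        rw [degree_add_single]; exact (Finset.mem_filter.1 ha).2)⟩ : ↥(idx n m))) ?_ ?_ ?_ ?_).symm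
    · intro a ha; simp
    · intro a ha b hb hab
      exact Subtype.ext (add_right_cancel (Subtype.ext_iff.1 hab))
    · rintro ⟨β, hβ⟩ hb
      obtain ⟨α, rfl⟩ := eq_add_single (Finset.mem_filter.1 hb).2
      refine ⟨⟨α, mem_idx_of_add_single hβ⟩, ?_, rfl⟩
      rw [Finset.mem_filter]
      refine ⟨Finset.mem_univ _, ?_⟩
      rw [mem_idx, degree_add_single] at hβ
      exact hβ
    · intro a ha
      have ha' := (Finset.mem_filter.1 ha).2
      rw [Zop_apply_add _ a.2, jet_apply]
      simp only [ha', if_true, Real.one_rpow, mfact_add_single, MvPolynomial.coeff_pderiv]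
      push_cast
      rw [Real.sqrt_mul (by positivity)]
      have : √((a.1 i : ℝ) + 1) * √((a.1 i : ℝ) + 1) = (a.1 i : ℝ) + 1 :=
        Real.mul_self_sqrt (by positivity)
      linear_combination (-(w a * √(mfact a.1 : ℝ) * (G x).coeff (a.1 + Finsupp.single i 1) * v i)) * this
  · intro a _ h
    by_contra ha
    exact h (hL a ha)
  · intro b _ h hb
    exact h (by rw [Zop_apply_zero _ hb]; simp)

/-- Orthogonality to an invariant subspace is preserved by translating a polynomial tower. -/
theorem Good.mem_orthogonal_of_isPT {s : ℝ} {W : Submodule ℝ (XX n m)}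
    (hW : Good (dg n m) (Zop n m) W) {G : Sp n → Poly n} (hG : IsPT m G) {x : Sp n}
    (hx : jet m s 1 (G x) ∈ Wᗮ) (y : Sp n) : jet m s 1 (G y) ∈ Wᗮ := by
  have key : ∀ k : ℕ, ∀ w ∈ W, (∀ a, dg n m a + k < m + 1 → w a = 0) →
      ∀ y, inner ℝ w (jet m s 1 (G y)) = 0 := by
    intro k
    induction k with
    | zero =>
      intro w _ hw y
      have : w = 0 := by ext a; exact hw a (by have := dg_le a; omega)
      simp [this]
    | succ k ih =>
      intro w hwW hw y
      have hd : ∀ z, HasFDerivAt (fun y => inner ℝ w (jet m s 1 (G y))) (0 : Sp n →L[ℝ] ℝ) z := by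
        intro z
        refine (hasFDerivAt_inner_jet hG w z).congr_fderiv ?_
        have : (fun i => inner ℝ (Zop n m i w) (jet m s 1 (G z))) = fun _ => (0 : ℝ) := by
          ext i
          refine ih _ (hW.mul i w hwW) ?_ z
          rintro ⟨α, hα⟩ hk
          by_cases h : α i = 0
          · exact Zop_apply_zero (a := ⟨α, hα⟩) _ h
          · obtain ⟨β, rfl⟩ := eq_add_single h
            have hβ := mem_idx_of_add_single hα
            rw [Zop_apply_add _ hβ, hw ⟨β, hβ⟩ (by simp only [dg, degree_add_single] at hk ⊢; omega),
              mul_zero]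
        rw [this]
        ext v
        simp [lin_apply]
      have hc := is_const_of_fderiv_eq_zero (𝕜 := ℝ) (fun z => (hd z).differentiableAt)
        (fun z => (hd z).fderiv) y x
      rw [hc]
      exact (Submodule.mem_orthogonal W _).1 hx w hwW
  rw [Submodule.mem_orthogonal]
  exact fun w hw => key (m + 1) w hw (fun a ha => by omega) y

end

section

variable {n m : ℕ}

/-- Equality of jets of order `m`. -/
def JEq (m : ℕ) (p q : Poly n) : Prop := ∀ α : Fin n →₀ ℕ, α.degree ≤ m → p.coeff α = q.coeff α

namespace JEq
variable {p q p' q' r : Poly n}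

theorem refl (p : Poly n) : JEq m p p := fun _ _ => rfl

theorem symm (h : JEq m p q) : JEq m q p := fun α hα => (h α hα).symm

theorem trans (h : JEq m p q) (h' : JEq m q r) : JEq m p r :=
  fun α hα => (h α hα).trans (h' α hα)

theorem add (h : JEq m p q) (h' : JEq m p' q') : JEq m (p + p') (q + q') :=
  fun α hα => by simp [h α hα, h' α hα]

theorem sub (h : JEq m p q) (h' : JEq m p' q') : JEq m (p - p') (q - q') :=
  fun α hα => by simp [h α hα, h' α hα]

theorem mul (h : JEq m p q) (h' : JEq m p' q') : JEq m (p * p') (q * q') := by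
  intro α hα
  rw [MvPolynomial.coeff_mul, MvPolynomial.coeff_mul]
  refine Finset.sum_congr rfl fun x hx => ?_
  have hx' := Finset.HasAntidiagonal.mem_antidiagonal.1 hx
  have hd : x.1.degree + x.2.degree = α.degree := by rw [← hx', map_add]
  rw [h x.1 (by omega), h' x.2 (by omega)]

theorem sum {ι : Type*} (t : Finset ι) {f g : ι → Poly n} (h : ∀ i ∈ t, JEq m (f i) (g i)) :
    JEq m (∑ i ∈ t, f i) (∑ i ∈ t, g i) := by
  intro α hα
  rw [MvPolynomial.coeff_sum, MvPolynomial.coeff_sum]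
  exact Finset.sum_congr rfl fun i hi => h i hi α hα

theorem prod {ι : Type*} (t : Finset ι) {f g : ι → Poly n} (h : ∀ i ∈ t, JEq m (f i) (g i)) :
    JEq m (∏ i ∈ t, f i) (∏ i ∈ t, g i) := by
  classical
  induction t using Finset.induction_on with
  | empty => exact refl _
  | insert a t ha ih =>
    rw [Finset.prod_insert ha, Finset.prod_insert ha]
    exact (h a (Finset.mem_insert_self _ _)).mul
      (ih fun i hi => h i (Finset.mem_insert_of_mem hi))

theorem pow (h : JEq m p q) (N : ℕ) : JEq m (p ^ N) (q ^ N) := by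
  have := prod (Finset.range N) (f := fun _ => p) (g := fun _ => q) fun _ _ => h
  simpa using this

theorem wn_eq (h : JEq m p q) (δ : ℝ) : wn m δ p = wn m δ q :=
  Finset.sum_congr rfl fun α hα => by rw [h α (mem_idx.1 hα)]

theorem coeff_zero (h : JEq m p q) : p.coeff 0 = q.coeff 0 := h 0 (by simp)

theorem of_wn (h : wn m 1 (p - q) = 0) : JEq m p q := fun α hα => by
  have := (wn_eq_zero_iff one_pos).1 h α hα
  rwa [MvPolynomial.coeff_sub, sub_eq_zero] at this

end JEq

namespace SC
variable {ϑ δ A B : ℝ} {U U' : Set (Sp n)} {T S : Sp n → Poly n}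

theorem congr (h : SC m ϑ δ A U T) (hS : ∀ x ∈ U, JEq m (S x) (T x)) : SC m ϑ δ A U S :=
  ⟨fun x hx => by rw [(hS x hx).wn_eq]; exact h.bd x hx,
    fun x hx y hy => by rw [((hS x hx).sub (hS y hy)).wn_eq]; exact h.hd x hx y hy⟩

theorem mono_scale {δ' : ℝ} (h : SC m ϑ δ A U T) (hϑ : 0 < ϑ) (hA : 0 ≤ A) (hδ' : 0 < δ')
    (hδ : δ' ≤ δ) : SC m ϑ δ' A U T := by
  refine ⟨fun x hx => (wn_mono hδ'.le hδ _).trans (h.bd x hx), fun x hx y hy =>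
    (wn_mono hδ'.le hδ _).trans ((h.hd x hx y hy).trans ?_)⟩
  have : 0 < δ := hδ'.trans_le hδ
  gcongr

theorem sum {ι : Type*} (hδ : 0 < δ) (t : Finset ι) {f : ι → Sp n → Poly n}
    (h : ∀ i ∈ t, SC m ϑ δ A U (f i)) : SC m ϑ δ (t.card * A) U fun x => ∑ i ∈ t, f i x := by
  classical
  induction t using Finset.induction_on with
  | empty =>
    have := const (m := m) (ϑ := ϑ) (U := U) hδ (0 : Poly n)
    simpa [wn_zero] using this
  | insert a t ha ih =>
    simp only [Finset.sum_insert ha, Finset.card_insert_of_notMem ha]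
    refine ((h a (Finset.mem_insert_self _ _)).add hδ
      (ih fun i hi => h i (Finset.mem_insert_of_mem hi))).mono_const hδ (le_of_eq ?_)
    push_cast; ring

theorem prod {ι : Type*} (hδ : 0 < δ) (hA : 1 ≤ A) (t : Finset ι) {f : ι → Sp n → Poly n}
    (h : ∀ i ∈ t, SC m ϑ δ A U (f i)) :
    SC m ϑ δ ((2 * A) ^ t.card) U fun x => ∏ i ∈ t, f i x := by
  classical
  induction t using Finset.induction_on with
  | empty =>
    have := const (m := m) (ϑ := ϑ) (U := U) hδ (1 : Poly n)
    simpa [wn_one] using this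
  | insert a t ha ih =>
    simp only [Finset.prod_insert ha, Finset.card_insert_of_notMem ha]
    refine ((h a (Finset.mem_insert_self _ _)).mul hδ (by linarith) (by positivity)
      (ih fun i hi => h i (Finset.mem_insert_of_mem hi))).mono_const hδ (le_of_eq ?_)
    ring

theorem pow (hδ : 0 < δ) (hA : 1 ≤ A) (h : SC m ϑ δ A U T) (N : ℕ) :
    SC m ϑ δ ((2 * A) ^ N) U fun x => T x ^ N := by
  have := prod hδ hA (Finset.range N) (f := fun _ => T) fun _ _ => h
  simpa using this

end SC

/-- The ordered partition of unity generated by the functions `ψ i`. -/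
def pou {k : ℕ} (ψ : Fin k → Sp n → Poly n) (i : Fin k) (x : Sp n) : Poly n :=
  ψ i x * ∏ j ∈ Finset.univ.filter (· < i), (1 - ψ j x)

section pou
variable {k : ℕ} {ψ : Fin k → Sp n → Poly n}

theorem isTow_pou (h : ∀ i, IsTow m (ψ i)) (i : Fin k) : IsTow m (pou ψ i) :=
  (h i).mul (IsTow.prod _ fun j _ => IsTow.one.sub (h j))

theorem sum_pou (x : Sp n) : ∑ i, pou ψ i x = 1 - ∏ i, (1 - ψ i x) := by
  rw [Finset.prod_one_sub_ordered]; simp [pou]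

theorem sum_pou_jeq {x : Sp n} {i : Fin k} (h : JEq m (ψ i x) 1) : JEq m (∑ i, pou ψ i x) 1 := by
  have h1 : JEq m (∏ i, (1 - ψ i x)) 0 := by
    rw [← Finset.mul_prod_erase _ _ (Finset.mem_univ i)]
    have := ((JEq.refl (m := m) (1 : Poly n)).sub h).mul
      (JEq.refl (∏ i ∈ Finset.univ.erase i, (1 - ψ i x)))
    simpa using this
  rw [sum_pou]
  simpa using (JEq.refl (m := m) (1 : Poly n)).sub h1

theorem pou_jeq_zero {x : Sp n} {i : Fin k} (h : JEq m (ψ i x) 0) : JEq m (pou ψ i x) 0 := by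
  have := h.mul (JEq.refl (∏ j ∈ Finset.univ.filter (· < i), (1 - ψ j x)))
  simpa [pou] using this

theorem sum_pou_mul_jeq {x : Sp n} (S : Finset (Fin k)) (hS : ∀ i ∉ S, JEq m (ψ i x) 0)
    (H : Fin k → Poly n) : JEq m (∑ i, pou ψ i x * H i)
      (∑ i ∈ S, (ψ i x * ∏ j ∈ S.filter (· < i), (1 - ψ j x)) * H i) := by
  have h1 : JEq m (∑ i, pou ψ i x * H i) (∑ i ∈ S, pou ψ i x * H i) := by
    rw [← Finset.sum_add_sum_compl S]
    have h2 := JEq.sum Sᶜ (f := fun i => pou ψ i x * H i) (g := fun _ => 0) fun i hi => by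
      simpa using (pou_jeq_zero (hS i (Finset.mem_compl.1 hi))).mul (JEq.refl (m := m) (H i))
    simpa using (JEq.refl (m := m) (∑ i ∈ S, pou ψ i x * H i)).add h2
  refine h1.trans (JEq.sum S fun i _ => JEq.mul (JEq.mul (JEq.refl _) ?_) (JEq.refl _))
  rw [← Finset.prod_filter_mul_prod_filter_not (Finset.univ.filter (· < i)) (· ∈ S)]
  have e : (Finset.univ.filter (· < i)).filter (· ∈ S) = S.filter (· < i) := by
    ext j; simp [and_comm]
  rw [e]
  have h3 := JEq.prod (m := m) ((Finset.univ.filter (· < i)).filter (· ∉ S))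
    (f := fun j => 1 - ψ j x) (g := fun _ => 1) fun j hj => by
      simpa using (JEq.refl (m := m) (1 : Poly n)).sub (hS j (Finset.mem_filter.1 hj).2)
  simpa using (JEq.refl (m := m) (∏ j ∈ S.filter (· < i), (1 - ψ j x))).mul h3

end pou

theorem exists_sc_sum_pou (n m N : ℕ) (A : ℝ) (hA : 1 ≤ A) : ∃ C : ℝ, 1 ≤ C ∧
    ∀ (k : ℕ) (ϑ M δ : ℝ) (x : Sp n) (U : Set (Sp n)) (ψ H : Fin k → Sp n → Poly n)
      (S : Finset (Fin k)), 0 < ϑ → ϑ ≤ 1 → 0 ≤ M → 0 < δ → Convex ℝ U → x ∈ U →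
      (∀ y ∈ U, ‖y - x‖ ≤ δ) → S.card ≤ N → (∀ i ∈ S, SC m ϑ δ A U (ψ i)) →
      (∀ i ∉ S, ∀ y ∈ U, JEq m (ψ i y) 0) → (∀ i ∈ S, IsTow m (H i)) →
      (∀ i ∈ S, HSOn m ϑ M U (H i)) → (∀ i ∈ S, wn m δ (H i x) ≤ M * δ ^ (m + ϑ : ℝ)) →
      SC m ϑ δ (C * (M * δ ^ (m + ϑ : ℝ))) U fun y => ∑ i, pou ψ i y * H i y := by
  obtain ⟨C, hC1, hC⟩ := exists_sc_of_growth n m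
  set K : ℝ := 2 * (2 * A * (2 * (1 + A)) ^ N) * (2 * C) with hK
  have hK0 : 0 ≤ K := by positivity
  refine ⟨N * K + 1, by nlinarith [(Nat.cast_nonneg N : (0:ℝ) ≤ N)], ?_⟩
  intro k ϑ M δ x U ψ H S hϑ hϑ1 hM hδ hU hx hUx hSN hψ hψ0 hT hHS hH
  set D := M * δ ^ (m + ϑ : ℝ) with hD
  have hD0 : 0 ≤ D := by positivity
  have h1 : ∀ i ∈ S, SC m ϑ δ (K * D) U fun y =>
      (ψ i y * ∏ j ∈ S.filter (· < i), (1 - ψ j y)) * H i y := by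
    intro i hi
    have e1 : SC m ϑ δ ((2 * (1 + A)) ^ N) U fun y => ∏ j ∈ S.filter (· < i), (1 - ψ j y) := by
      refine (SC.prod hδ (A := 1 + A) (by linarith) _ fun j hj => ?_).mono_const hδ
        (pow_le_pow_right₀ (by linarith) ((Finset.card_le_card (Finset.filter_subset _ _)).trans hSN))
      have := (SC.const (m := m) (ϑ := ϑ) (U := U) hδ (1 : Poly n)).sub hδ
        (hψ j (Finset.mem_filter.1 hj).1)
      rwa [wn_one] at this
    have e2 := (hψ i hi).mul hδ (by linarith) (by positivity) e1
    have e3 := hC ϑ M δ D U (H i) x hϑ hϑ1 hM hδ hU (hT i hi) (hHS i hi) hx hUx (hH i hi)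
    refine (e2.mul hδ (by positivity) (by positivity) e3).mono_const hδ (le_of_eq ?_)
    rw [hK, ← hD]; ring
  refine ((SC.sum hδ S h1).congr fun y hy => sum_pou_mul_jeq S (fun i hi => hψ0 i hi y hy)
    fun i => H i y).mono_const hδ ?_
  have : (S.card : ℝ) ≤ N := by exact_mod_cast hSN
  have : (S.card : ℝ) * (K * D) ≤ N * (K * D) := by gcongr
  linarith

/-- A bounded separated set in Euclidean space has a bounded number of points. -/
theorem exists_card_le_of_separated (n : ℕ) (K : ℝ) : ∃ N : ℕ, ∀ {ι : Type} (t : Finset ι)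
    (b : ι → Sp n) (x : Sp n) (ρ : ℝ), 0 < ρ → (∀ i ∈ t, ‖b i - x‖ ≤ K * ρ) →
    (∀ i ∈ t, ∀ j ∈ t, i ≠ j → ρ ≤ ‖b i - b j‖) → t.card ≤ N := by
  obtain ⟨c, hc, hcf, hcov⟩ := (isCompact_closedBall (0 : Sp n) K).finite_cover_balls
    (e := 1 / 2) (by norm_num)
  lift c to Finset (Sp n) using hcf
  refine ⟨c.card, fun t b x ρ hρ hK hsep => ?_⟩
  have h : ∀ i ∈ t, ∃ y ∈ c, ‖ρ⁻¹ • (b i - x) - y‖ < 1 / 2 := by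
    intro i hi
    have : ρ⁻¹ • (b i - x) ∈ Metric.closedBall (0 : Sp n) K := by
      rw [mem_closedBall_zero_iff, norm_smul, Real.norm_of_nonneg (by positivity),
        inv_mul_le_iff₀ hρ]
      linarith [hK i hi]
    obtain ⟨y, hy, hyb⟩ := mem_iUnion₂.1 (hcov this)
    exact ⟨y, hy, by simpa [dist_eq_norm] using hyb⟩
  choose! g hg hgd using h
  refine Finset.card_le_card_of_injOn g hg fun i hi j hj hij => ?_
  by_contra hne
  have h1 := hsep i hi j hj hne
  have h2 : ‖ρ⁻¹ • (b i - b j)‖ < 1 := by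
    have e : ρ⁻¹ • (b i - b j) = (ρ⁻¹ • (b i - x) - g i) - (ρ⁻¹ • (b j - x) - g j) := by
      rw [hij, smul_sub, smul_sub, smul_sub]; abel
    rw [e]
    linarith [norm_sub_le (ρ⁻¹ • (b i - x) - g i) (ρ⁻¹ • (b j - x) - g j), hgd i hi, hgd j hj]
  rw [norm_smul, Real.norm_of_nonneg (by positivity), inv_mul_lt_iff₀ hρ] at h2
  linarith

/-- A maximal separated family relative to a variable scale. -/
theorem exists_maximal_separated {V : Set (Sp n)} (ϱ : Sp n → ℝ) :
    ∃ B ⊆ V, (∀ b ∈ B, ∀ b' ∈ B, b ≠ b' → max (ϱ b) (ϱ b') ≤ ‖b - b'‖) ∧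
      ∀ p ∈ V, ∃ b ∈ B, p = b ∨ ‖p - b‖ < max (ϱ p) (ϱ b) := by
  obtain ⟨B, hB⟩ := zorn_subset {B : Set (Sp n) | B ⊆ V ∧
    ∀ b ∈ B, ∀ b' ∈ B, b ≠ b' → max (ϱ b) (ϱ b') ≤ ‖b - b'‖} (by
      intro c hc hchain
      refine ⟨⋃₀ c, ⟨sUnion_subset fun t ht => (hc ht).1, ?_⟩, fun t ht => subset_sUnion_of_mem ht⟩
      rintro b ⟨t, ht, hbt⟩ b' ⟨t', ht', hbt'⟩ hne
      rcases hchain.total ht ht' with h | h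
      · exact (hc ht').2 b (h hbt) b' hbt' hne
      · exact (hc ht).2 b hbt b' (h hbt') hne)
  refine ⟨B, hB.prop.1, hB.prop.2, fun p hp => ?_⟩
  by_contra! hcon
  have hins : insert p B ∈ {B : Set (Sp n) | B ⊆ V ∧
      ∀ b ∈ B, ∀ b' ∈ B, b ≠ b' → max (ϱ b) (ϱ b') ≤ ‖b - b'‖} := by
    refine ⟨insert_subset hp hB.prop.1, ?_⟩
    rintro b (rfl | hb) b' (rfl | hb') hne
    · exact absurd rfl hne
    · exact (hcon b' hb').2
    · rw [max_comm, norm_sub_rev]; exact (hcon b hb).2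
    · exact hB.prop.2 b hb b' hb' hne
  have := hB.le_of_ge hins (subset_insert p B)
  exact (hcon p (this (mem_insert p B))).1 rfl

end

section

variable {n m : ℕ}

theorem abs_coeff_le_of_wn_le {p : Poly n} {δ ϑ B : ℝ} (hδ : 0 < δ)
    (h : wn m δ p ≤ B * δ ^ (m + ϑ : ℝ)) {α : Fin n →₀ ℕ} (hα : α.degree = m) :
    |p.coeff α| ≤ B * δ ^ ϑ := by
  have h1 := (abs_coeff_le_wn hδ.le hα.le p).trans h
  rw [hα, Real.rpow_add hδ, Real.rpow_natCast] at h1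
  have h2 : 0 < δ ^ m := by positivity
  refine le_of_mul_le_mul_right ?_ h2
  linarith

theorem coeff_zero_mul (p q : Poly n) : (p * q).coeff 0 = p.coeff 0 * q.coeff 0 := by
  simpa [MvPolynomial.constantCoeff_eq] using map_mul MvPolynomial.constantCoeff p q

/-- A finite cover of a bounded set by balls with slowly varying radii. -/
theorem exists_slow_cover {U : Set (Sp n)} (hU : Bornology.IsBounded U) {ϱ : Sp n → ℝ} {ϱ₀ : ℝ}
    (hϱ₀ : 0 < ϱ₀) (hϱ : ∀ p ∈ U, ϱ₀ ≤ ϱ p)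
    (hL : ∀ p ∈ U, ∀ q ∈ U, ϱ p ≤ ϱ q + ‖p - q‖ / 100) :
    ∃ (k : ℕ) (b : Fin k → Sp n), (∀ i, b i ∈ U) ∧
      (∀ i j, i ≠ j → ϱ (b i) / 20 ≤ ‖b i - b j‖) ∧
      ∀ p ∈ U, ∃ i, ‖p - b i‖ < ϱ (b i) / 10 := by
  obtain ⟨B, hBU, hsep, hcov⟩ := exists_maximal_separated (V := U) fun p => ϱ p / 20
  have hfin : B.Finite := by
    by_contra hinf
    obtain ⟨D, hD⟩ := hU.exists_norm_le
    obtain ⟨N, hN⟩ := exists_card_le_of_separated n (D / (ϱ₀ / 20))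
    obtain ⟨t, htB, htc⟩ := (Set.not_finite.1 hinf).exists_subset_card_eq (N + 1)
    have := hN t id 0 (ϱ₀ / 20) (by positivity) (fun i hi => by
      rw [div_mul_cancel₀ _ (by positivity)]
      simpa using hD i (hBU (htB hi))) (fun i hi j hj hij => by
      have h1 := hsep i (htB hi) j (htB hj) hij
      have h2 := hϱ i (hBU (htB hi))
      refine le_trans ?_ ((le_max_left _ _).trans h1)
      linarith)
    omega
  refine ⟨hfin.toFinset.card, fun i => (hfin.toFinset.equivFin.symm i).1, ?_, ?_, ?_⟩
  · intro i
    exact hBU (hfin.mem_toFinset.1 (hfin.toFinset.equivFin.symm i).2)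
  · intro i j hij
    refine (le_max_left _ _).trans (hsep _ (hfin.mem_toFinset.1 (hfin.toFinset.equivFin.symm i).2) _
      (hfin.mem_toFinset.1 (hfin.toFinset.equivFin.symm j).2) fun h => hij ?_)
    exact hfin.toFinset.equivFin.symm.injective (Subtype.ext h)
  · intro p hp
    obtain ⟨b, hb, h⟩ := hcov p hp
    refine ⟨hfin.toFinset.equivFin ⟨b, hfin.mem_toFinset.2 hb⟩, ?_⟩
    simp only [Equiv.symm_apply_apply]
    have h0 := hϱ b (hBU hb)
    rcases h with rfl | h
    · simp; linarith
    · have h1 := hL p hp b (hBU hb)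
      rcases lt_max_iff.1 h with h | h <;> linarith

theorem exists_patch (n m : ℕ) {ϑ : ℝ} (hϑ : 0 < ϑ) (hϑ1 : ϑ ≤ 1) : ∃ C : ℝ, 1 ≤ C ∧
    ∀ (M ϱ₀ : ℝ) (U E : Set (Sp n)) (f ϱ : Sp n → ℝ) (F : Sp n → Sp n → Poly n) (y : Sp n),
      0 ≤ M → Convex ℝ U → Bornology.IsBounded U → y ∈ U → 0 < ϱ₀ → (∀ p ∈ U, ϱ₀ ≤ ϱ p) →
      (∀ p ∈ U, ∀ q ∈ U, ϱ p ≤ ϱ q + ‖p - q‖ / 100) → (∀ p ∈ U, IsTow m (F p)) →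
      (∀ p ∈ U, HSOn m ϑ M U (F p)) →
      (∀ p ∈ U, ∀ e ∈ E ∩ U, ‖e - p‖ ≤ ϱ p → (F p e).coeff 0 = f e) →
      (∀ p ∈ U, ∀ q ∈ U, ∀ d, ‖p - q‖ ≤ d → ϱ p ≤ d → ϱ q ≤ d →
        wn m d (F p p - F q p) ≤ M * d ^ (m + ϑ : ℝ)) →
      ∃ T : Sp n → Poly n, IsTow m T ∧ HSOn m ϑ (C * M) U T ∧
        (∀ e ∈ E ∩ U, (T e).coeff 0 = f e) ∧ JEq m (T y) (F y y) := by
  obtain ⟨A, hA1, hA⟩ := exists_bump n m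
  obtain ⟨N, hN⟩ := exists_card_le_of_separated n 10
  obtain ⟨C₁, hC₁1, hC₁⟩ := exists_sc_sum_pou n m N A hA1
  set s : ℝ := m + ϑ with hs
  have hs0 : 0 ≤ s := by positivity
  set Q : ℝ := C₁ * (2 * 80 ^ s) with hQ
  have h80 : 1 ≤ (80 : ℝ) ^ s := Real.one_le_rpow (by norm_num) hs0
  have hQ0 : 0 ≤ Q := by positivity
  refine ⟨2 * Q + 41, by linarith, ?_⟩
  intro M ϱ₀ U E f ϱ F y hM hU hUb hy hϱ₀ hϱ hL hF hFH hFf hcons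
  obtain ⟨k, b, hbU, hsep, hcov⟩ := exists_slow_cover hUb hϱ₀ hϱ hL
  have hϱpos : ∀ p ∈ U, 0 < ϱ p := fun p hp => hϱ₀.trans_le (hϱ p hp)
  choose φ hφT hφS hφ1 hφ0 _ using fun i => hA ϑ hϑ hϑ1 (b i) (ϱ (b i) / 10)
    (by have := hϱpos _ (hbU i); positivity)
  have hφ1' : ∀ i, ∀ x, ‖x - b i‖ < ϱ (b i) / 10 → JEq m (φ i x) 1 := fun i x hx =>
    JEq.of_wn (hφ1 i x (by rwa [Metric.mem_ball, dist_eq_norm]) 1)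
  have hφ0' : ∀ i, ∀ x, ϱ (b i) / 5 < ‖x - b i‖ → JEq m (φ i x) 0 := fun i x hx =>
    JEq.of_wn (by
      rw [sub_zero]
      exact hφ0 i x (by rw [Metric.mem_closedBall, dist_eq_norm]; linarith) 1)
  obtain ⟨q, hqU, hqb, hqy⟩ : ∃ q : Fin k → Sp n, (∀ i, q i ∈ U) ∧
      (∀ i, ‖q i - b i‖ ≤ ϱ (b i) / 5) ∧ ∀ i, ‖y - b i‖ ≤ ϱ (b i) / 5 → q i = y := by
    refine ⟨fun i => if ‖y - b i‖ ≤ ϱ (b i) / 5 then y else b i, fun i => ?_, fun i => ?_,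
      fun i hi => by simp [hi]⟩
    · dsimp only; split_ifs
      exacts [hy, hbU i]
    · dsimp only; split_ifs with h
      · exact h
      · have := hϱpos _ (hbU i)
        rw [sub_self, norm_zero]; positivity
  set T : Sp n → Poly n := fun x => ∑ i, pou φ i x * F (q i) x with hTdef
  have hT : IsTow m T := IsTow.sum _ fun i _ => (isTow_pou hφT i).mul (hF _ (hqU i))
  have hone : ∀ x ∈ U, JEq m (∑ i, pou φ i x) 1 := fun x hx => by
    obtain ⟨i, hi⟩ := hcov x hx
    exact sum_pou_jeq (hφ1' i x hi)
  have hdiff : ∀ p : Sp n → Poly n, ∀ x ∈ U,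
      JEq m (T x - p x) (∑ i, pou φ i x * (F (q i) x - p x)) := by
    intro p x hx
    have e : ∑ i, pou φ i x * (F (q i) x - p x) = T x - (∑ i, pou φ i x) * p x := by
      simp only [mul_sub, Finset.sum_sub_distrib, hTdef, Finset.sum_mul]
    rw [e]
    have := (hone x hx).mul (JEq.refl (m := m) (p x))
    rw [one_mul] at this
    exact (JEq.refl _).sub this.symm
  have hloc : ∀ x ∈ U, SC m ϑ (ϱ x / 40) (Q * M * (ϱ x / 40) ^ s)
      (U ∩ Metric.closedBall x (ϱ x / 40)) fun z => T z - F x z := by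
    intro x hx
    have hx0 := hϱpos x hx
    set δ := ϱ x / 40 with hδ
    have hδ0 : 0 < δ := by positivity
    set S : Finset (Fin k) := Finset.univ.filter fun i => ‖b i - x‖ ≤ ϱ (b i) / 5 + δ with hS
    have hSn : ∀ i ∈ S, ‖b i - x‖ ≤ 10 * δ ∧ 38 * δ ≤ ϱ (b i) ∧ ϱ (b i) ≤ 41 * δ := by
      intro i hi
      have h1 := (Finset.mem_filter.1 hi).2
      have h2 := hL _ (hbU i) x hx
      have h3 := hL x hx _ (hbU i)
      rw [norm_sub_rev] at h3
      refine ⟨?_, ?_, ?_⟩ <;> linarith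
    have hcard : S.card ≤ N := hN S b x δ hδ0 (fun i hi => (hSn i hi).1) fun i hi j hj hij => by
      have := hsep i j hij
      linarith [(hSn i hi).2.1]
    refine (hC₁ k ϑ (2 * 80 ^ s * M) δ x (U ∩ Metric.closedBall x δ) φ
      (fun i z => F (q i) z - F x z) S hϑ hϑ1 (by positivity) hδ0
      (hU.inter (convex_closedBall x δ)) ⟨hx, Metric.mem_closedBall_self hδ0.le⟩
      (fun z hz => by simpa [dist_eq_norm] using hz.2) hcard (fun i hi => ?_) (fun i hi z hz => ?_)
      (fun i _ => (hF _ (hqU i)).sub (hF x hx)) (fun i hi => ?_) (fun i hi => ?_)).mono_const hδ0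
      (le_of_eq (by rw [hQ]; ring)) |>.congr fun z hz => hdiff (F x) z hz.1
    · refine ((hφS i).mono_set (subset_univ _)).mono_scale hϑ (by linarith) hδ0 ?_
      linarith [(hSn i hi).2.1]
    · have h1 : ¬ ‖b i - x‖ ≤ ϱ (b i) / 5 + δ := fun h => hi (by simp [hS, h])
      have h2 : ‖z - x‖ ≤ δ := by simpa [dist_eq_norm] using hz.2
      refine hφ0' i z ?_
      have h3 : ‖b i - x‖ ≤ ‖z - b i‖ + ‖z - x‖ := by
        rw [norm_sub_rev z]; exact norm_sub_le_norm_sub_add_norm_sub _ _ _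
      push Not at h1
      linarith
    · refine (((hFH _ (hqU i)).sub (hFH x hx)).mono_set inter_subset_left).mono_const ?_
      have : M * 1 ≤ M * 80 ^ s := by gcongr
      linarith
    · obtain ⟨h1, h2, h3⟩ := hSn i hi
      have h4 := hqb i
      have h5 : ‖x - q i‖ ≤ 80 * δ := by
        have := norm_sub_le_norm_sub_add_norm_sub x (b i) (q i)
        rw [norm_sub_rev x (b i), norm_sub_rev (b i) (q i)] at this
        linarith
      have h6 := hL _ (hqU i) x hx
      rw [norm_sub_rev] at h6
      have h7 := hcons x hx (q i) (hqU i) (80 * δ) h5 (by linarith) (by linarith)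
      rw [wn_sub_comm]
      refine (wn_mono hδ0.le (by linarith) _).trans (h7.trans ?_)
      rw [Real.mul_rpow (by norm_num) hδ0.le]
      have : 0 ≤ M * 80 ^ s * δ ^ s := by positivity
      linarith
  have hnear : ∀ α : Fin n →₀ ℕ, α.degree = m → ∀ x ∈ U, ∀ z ∈ U, ‖x - z‖ ≤ ϱ x / 40 →
      |(T x).coeff α - (T z).coeff α| ≤ (Q * M + M) * ‖x - z‖ ^ ϑ := by
    intro α hα x hx z hz hxz
    have hδ0 : 0 < ϱ x / 40 := by have := hϱpos x hx; positivity
    have h1 := (hloc x hx).hsOn hδ0 α hα x ⟨hx, Metric.mem_closedBall_self hδ0.le⟩ z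
      ⟨hz, by rw [Metric.mem_closedBall, dist_comm, dist_eq_norm]; exact hxz⟩
    have h2 := hFH x hx α hα x hx z hz
    rw [mul_div_cancel_right₀ _ (by positivity)] at h1
    simp only [MvPolynomial.coeff_sub] at h1
    have h3 : (T x).coeff α - (T z).coeff α = ((T x).coeff α - (F x x).coeff α -
      ((T z).coeff α - (F x z).coeff α)) + ((F x x).coeff α - (F x z).coeff α) := by ring
    rw [h3, add_mul]
    exact (abs_add_le _ _).trans (add_le_add h1 h2)
  have hpt : ∀ α : Fin n →₀ ℕ, α.degree = m → ∀ x ∈ U,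
      |(T x).coeff α - (F x x).coeff α| ≤ Q * M * (ϱ x / 40) ^ ϑ := by
    intro α hα x hx
    have hδ0 : 0 < ϱ x / 40 := by have := hϱpos x hx; positivity
    rw [← MvPolynomial.coeff_sub]
    exact abs_coeff_le_of_wn_le hδ0 ((hloc x hx).bd x ⟨hx, Metric.mem_closedBall_self hδ0.le⟩) hα
  refine ⟨T, hT, ?_, ?_, ?_⟩
  · intro α hα x hx z hz
    have hQM : 0 ≤ Q * M := by positivity
    have hw : 0 ≤ ‖x - z‖ ^ ϑ := by positivity
    by_cases h1 : ‖x - z‖ ≤ ϱ x / 40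
    · refine (hnear α hα x hx z hz h1).trans ?_
      gcongr; nlinarith
    by_cases h2 : ‖x - z‖ ≤ ϱ z / 40
    · rw [abs_sub_comm, norm_sub_rev]
      rw [norm_sub_rev] at h2
      refine (hnear α hα z hz x hx h2).trans ?_
      gcongr; nlinarith
    push Not at h1 h2
    have hx0 := hϱpos x hx
    have hz0 := hϱpos z hz
    have e1 : |(T x).coeff α - (F x x).coeff α| ≤ Q * M * ‖x - z‖ ^ ϑ :=
      (hpt α hα x hx).trans (by gcongr)
    have e2 : |(T z).coeff α - (F z z).coeff α| ≤ Q * M * ‖x - z‖ ^ ϑ :=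
      (hpt α hα z hz).trans (by gcongr)
    have e3 := abs_coeff_le_of_wn_le (by linarith) (hcons x hx z hz (40 * ‖x - z‖) (by linarith) (by linarith)
      (by linarith)) hα
    have e4 := hFH z hz α hα x hx z hz
    have h40 : (40 * ‖x - z‖) ^ ϑ ≤ 40 * ‖x - z‖ ^ ϑ := by
      rw [Real.mul_rpow (by norm_num) (norm_nonneg _)]
      gcongr
      calc (40 : ℝ) ^ ϑ ≤ 40 ^ (1 : ℝ) := Real.rpow_le_rpow_of_exponent_le (by norm_num) hϑ1
        _ = 40 := by simp
    have e3' := e3.trans (mul_le_mul_of_nonneg_left h40 hM)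
    rw [MvPolynomial.coeff_sub] at e3'
    rw [abs_le] at *
    constructor <;> nlinarith
  · rintro e ⟨heE, heU⟩
    have h1 : ∀ i, (pou φ i e).coeff 0 * (F (q i) e).coeff 0 = (pou φ i e).coeff 0 * f e := by
      intro i
      by_cases hi : ϱ (b i) / 5 < ‖e - b i‖
      · rw [(pou_jeq_zero (hφ0' i e hi)).coeff_zero]; simp
      · rw [hFf _ (hqU i) e ⟨heE, heU⟩ ?_]
        have h1 := hqb i
        have h2 := hL _ (hbU i) _ (hqU i)
        have h3 := hϱpos _ (hbU i)
        have h4 := norm_sub_le_norm_sub_add_norm_sub e (b i) (q i)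
        rw [norm_sub_rev (b i)] at h2 h4
        linarith
    have h2 := (hone e heU).coeff_zero
    simp only [hTdef, MvPolynomial.coeff_sum, coeff_zero_mul, h1]
    rw [← Finset.sum_mul, ← MvPolynomial.coeff_sum, h2]
    simp
  · have h1 : JEq m (T y) (∑ i, pou φ i y * F y y) := by
      refine JEq.sum _ fun i _ => ?_
      by_cases hi : ϱ (b i) / 5 < ‖y - b i‖
      · have h0 := pou_jeq_zero (ψ := φ) (hφ0' i y hi)
        have e1 := h0.mul (JEq.refl (m := m) (F (q i) y))
        have e2 := h0.mul (JEq.refl (m := m) (F y y))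
        rw [zero_mul] at e1 e2
        exact e1.trans e2.symm
      · rw [hqy i (not_lt.1 hi)]; exact JEq.refl _
    rw [← Finset.sum_mul] at h1
    have := (hone y hy).mul (JEq.refl (m := m) (F y y))
    rw [one_mul] at this
    exact h1.trans this

end

section

variable {n m : ℕ} {ϑ : ℝ}

/-- `T` is a tower with Hölder constant `M` whose values on `S` are given by `f`. -/
structure IsInt (m : ℕ) (ϑ M : ℝ) (S : Set (Sp n)) (f : Sp n → ℝ) (T : Sp n → Poly n) : Prop where
  tow : IsTow m T
  hs : HSOn m ϑ M univ T
  val : ∀ e ∈ S, (T e).coeff 0 = f e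

namespace IsInt
variable {M M' : ℝ} {S S' : Set (Sp n)} {f f' : Sp n → ℝ} {T T' : Sp n → Poly n}

theorem add (h : IsInt m ϑ M S f T) (h' : IsInt m ϑ M' S f' T') :
    IsInt m ϑ (M + M') S (f + f') fun x => T x + T' x :=
  ⟨h.tow.add h'.tow, h.hs.add h'.hs, fun e he => by simp [h.val e he, h'.val e he]⟩

theorem smul (c : ℝ) (h : IsInt m ϑ M S f T) : IsInt m ϑ (|c| * M) S (c • f) fun x => c • T x :=
  ⟨h.tow.smul c, h.hs.smul c, fun e he => by simp [h.val e he]⟩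

theorem sub (h : IsInt m ϑ M S f T) (h' : IsInt m ϑ M' S f' T') :
    IsInt m ϑ (M + M') S (f - f') fun x => T x - T' x :=
  ⟨h.tow.sub h'.tow, h.hs.sub h'.hs, fun e he => by simp [h.val e he, h'.val e he]⟩

theorem mono_const (h : IsInt m ϑ M S f T) (hM : M ≤ M') : IsInt m ϑ M' S f T :=
  ⟨h.tow, h.hs.mono_const hM, h.val⟩

theorem mono_set (h : IsInt m ϑ M S f T) (hS : S' ⊆ S) : IsInt m ϑ M S' f T :=
  ⟨h.tow, h.hs, fun e he => h.val e (hS he)⟩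

theorem convexComb (h : IsInt m ϑ M S f T) (h' : IsInt m ϑ M S f T') {a b : ℝ} (ha : 0 ≤ a)
    (hb : 0 ≤ b) (hab : a + b = 1) : IsInt m ϑ M S f fun x => a • T x + b • T' x := by
  have := (h.smul a).add (h'.smul b)
  have e1 : |a| * M + |b| * M = M := by
    rw [abs_of_nonneg ha, abs_of_nonneg hb, ← add_mul, hab, one_mul]
  have e2 : a • f + b • f = f := by rw [← add_smul, hab, one_smul]
  rwa [e1, e2] at this

end IsInt

/-- Jets at `x` which extend to interpolants of `f` on every subset of `E` with at most `k` points. -/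
def Gam (m : ℕ) (ϑ : ℝ) (k : ℕ) (E : Finset (Sp n)) (f : Sp n → ℝ) (M : ℝ) (x : Sp n) :
    Set (XX n m) :=
  {u | ∀ S ⊆ E, S.card ≤ k → ∃ T, IsInt m ϑ M (S : Set (Sp n)) f T ∧ jet m (m + ϑ) 1 (T x) = u}

/-- The homogeneous version of `Gam`. -/
def sig (m : ℕ) (ϑ : ℝ) (k : ℕ) (E : Finset (Sp n)) (x : Sp n) : Set (XX n m) :=
  Gam m ϑ k E 0 1 x

section Gam
variable {k k' : ℕ} {E : Finset (Sp n)} {f : Sp n → ℝ} {M M' : ℝ} {x y : Sp n} {u u' v : XX n m}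

theorem Gam.mono (h : k ≤ k') (hM : M ≤ M') : Gam m ϑ k' E f M x ⊆ Gam m ϑ k E f M' x := by
  intro u hu S hS hk
  obtain ⟨T, hT, hTu⟩ := hu S hS (hk.trans h)
  exact ⟨T, hT.mono_const hM, hTu⟩

theorem sig_mono (h : k ≤ k') : sig m ϑ k' E x ⊆ sig m ϑ k E x := Gam.mono h le_rfl

theorem Gam.add_smul (hu : u ∈ Gam m ϑ k E f M x) (hv : v ∈ sig m ϑ k E x) (c : ℝ) :
    u + c • v ∈ Gam m ϑ k E f (M + |c|) x := by
  intro S hS hk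
  obtain ⟨T, hT, rfl⟩ := hu S hS hk
  obtain ⟨T', hT', rfl⟩ := hv S hS hk
  have := hT.add (hT'.smul c)
  simp only [mul_one, smul_zero, add_zero] at this
  exact ⟨_, this, by simp⟩

theorem Gam.sub_mem (hM : 0 < M + M') (hu : u ∈ Gam m ϑ k E f M x)
    (hu' : u' ∈ Gam m ϑ k E f M' x) : ∃ v ∈ sig m ϑ k E x, u - u' = (M + M') • v := by
  refine ⟨(M + M')⁻¹ • (u - u'), ?_, by rw [smul_inv_smul₀ hM.ne']⟩
  intro S hS hk
  obtain ⟨T, hT, rfl⟩ := hu S hS hk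
  obtain ⟨T', hT', rfl⟩ := hu' S hS hk
  have := (hT.sub hT').smul (M + M')⁻¹
  rw [abs_of_pos (inv_pos.2 hM), inv_mul_cancel₀ hM.ne', sub_self, smul_zero] at this
  exact ⟨_, this, by simp⟩

theorem sig_cs : CS (sig m ϑ k E x) where
  convex := by
    intro u hu v hv a b ha hb hab S hS hk
    obtain ⟨T, hT, rfl⟩ := hu S hS hk
    obtain ⟨T', hT', rfl⟩ := hv S hS hk
    exact ⟨_, hT.convexComb hT' ha hb hab, by simp⟩
  zero := by
    intro S hS hk
    refine ⟨fun _ => 0, ⟨IsTow.zero, ?_, by simp⟩, by simp⟩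
    intro α _ x _ y _
    simp; positivity
  neg := by
    intro u hu S hS hk
    obtain ⟨T, hT, rfl⟩ := hu S hS hk
    have := hT.smul (-1)
    simp only [abs_neg, abs_one, one_mul, smul_zero] at this
    exact ⟨_, this, by simp⟩

theorem finrank_XX : Module.finrank ℝ (XX n m) = (idx n m).card := by simp

/-- Jets can be transported to other points at the expense of the number of points. -/
theorem Gam.transport (hu : u ∈ Gam m ϑ (((idx n m).card + 1) * k) E f M x) (y : Sp n) :
    ∃ u' ∈ Gam m ϑ k E f M y, ∃ T, IsTow m T ∧ HSOn m ϑ M univ T ∧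
      jet m (m + ϑ) 1 (T x) = u ∧ jet m (m + ϑ) 1 (T y) = u' := by
  classical
  set K : Finset (Sp n) → Set (XX n m) := fun S =>
    {v | ∃ T, IsInt m ϑ M (S : Set (Sp n)) f T ∧ jet m (m + ϑ) 1 (T x) = u ∧
      jet m (m + ϑ) 1 (T y) = v} with hK
  obtain ⟨v, hv⟩ := Convex.helly_theorem' (𝕜 := ℝ) (F := K)
    (s := E.powerset.filter fun S => S.card ≤ k) (by
      rintro S _ v ⟨T, hT, hTu, rfl⟩ v' ⟨T', hT', hTu', rfl⟩ a b ha hb hab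
      refine ⟨_, hT.convexComb hT' ha hb hab, ?_, by simp⟩
      simp only [map_add, map_smul, hTu, hTu']
      rw [← _root_.add_smul, hab, one_smul]) (by
      intro I hI hIc
      rw [finrank_XX] at hIc
      obtain ⟨T, hT, hTu⟩ := hu (I.biUnion id) (by
        intro e he
        obtain ⟨S, hS, heS⟩ := Finset.mem_biUnion.1 he
        exact Finset.mem_powerset.1 (Finset.mem_filter.1 (hI hS)).1 heS) (by
        refine (Finset.card_biUnion_le_card_mul I id k fun S hS =>
          (Finset.mem_filter.1 (hI hS)).2).trans (Nat.mul_le_mul_right _ hIc))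
      refine ⟨jet m (m + ϑ) 1 (T y), mem_iInter₂.2 fun S hS => ⟨T, hT.mono_set ?_, hTu, rfl⟩⟩
      intro e he
      exact Finset.mem_coe.2 (Finset.mem_biUnion.2 ⟨S, hS, he⟩))
  rw [mem_iInter₂] at hv
  refine ⟨v, fun S hS hk => ?_, ?_⟩
  · obtain ⟨T, hT, -, hTv⟩ := hv S (Finset.mem_filter.2 ⟨Finset.mem_powerset.2 hS, hk⟩)
    exact ⟨T, hT, hTv⟩
  · obtain ⟨T, hT, hTu, hTv⟩ := hv ∅ (by simp)
    exact ⟨T, hT.tow, hT.hs, hTu, hTv⟩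

/-- The linear coordinate tower is bounded on a ball at the scale of the ball. -/
theorem sc_coord (hϑ : 0 < ϑ) (hϑ1 : ϑ ≤ 1) {δ : ℝ} (hδ : 0 < δ) (i : Fin n) (x : Sp n) :
    SC m ϑ δ 2 (Metric.closedBall x δ) fun z =>
      δ⁻¹ • (MvPolynomial.X i + MvPolynomial.C (z i - x i) : Poly n) := by
  have hX : wn m δ (MvPolynomial.X i : Poly n) ≤ δ := by
    classical
    unfold wn
    by_cases h : Finsupp.single i 1 ∈ idx n m
    · rw [Finset.sum_eq_single (Finsupp.single i 1)]
      · simp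
      · intro β _ hβ
        rw [MvPolynomial.coeff_X, if_neg hβ.symm]; simp
      · exact fun h' => absurd h h'
    · rw [Finset.sum_eq_zero]
      · exact hδ.le
      · intro β hβ
        rw [MvPolynomial.coeff_X, if_neg (by rintro rfl; exact h hβ)]; simp
  have hcoord : ∀ z w : Sp n, |z i - w i| ≤ ‖z - w‖ := fun z w => by
    simpa using PiLp.norm_apply_le (z - w) i
  refine ⟨fun z hz => ?_, fun z hz w hw => ?_⟩
  · rw [wn_smul, abs_of_pos (inv_pos.2 hδ), inv_mul_le_iff₀ hδ]
    refine (wn_add_le hδ.le _ _).trans ?_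
    rw [wn_C]
    have := hcoord z x
    rw [Metric.mem_closedBall, dist_eq_norm] at hz
    linarith
  · rw [← smul_sub, add_sub_add_left_eq_sub, ← map_sub, wn_smul, wn_C,
      abs_of_pos (inv_pos.2 hδ), sub_sub_sub_cancel_right]
    rw [Metric.mem_closedBall, dist_eq_norm] at hz hw
    have h1 : ‖z - w‖ / δ ≤ 2 := by
      rw [div_le_iff₀ hδ]
      have := norm_sub_le_norm_sub_add_norm_sub z x w
      rw [norm_sub_rev x w] at this
      linarith
    have h0 : 0 ≤ ‖z - w‖ / δ := by positivity
    calc δ⁻¹ * |z i - w i| ≤ ‖z - w‖ / δ := by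
          rw [inv_mul_le_iff₀ hδ, mul_div_cancel₀ _ hδ.ne']; exact hcoord z w
      _ ≤ 2 * (‖z - w‖ / δ) ^ ϑ := by
          rcases le_total (‖z - w‖ / δ) 1 with h | h
          · have := Real.rpow_le_rpow_of_exponent_ge' h0 h hϑ.le hϑ1
            rw [Real.rpow_one] at this
            linarith [Real.rpow_nonneg h0 ϑ]
          · have := Real.one_le_rpow h hϑ.le
            linarith

/-- The sets `sig` are stable under multiplication by coordinates, at every scale. -/
theorem exists_sig_zStable (n m : ℕ) (hϑ : 0 < ϑ) (hϑ1 : ϑ ≤ 1) : ∃ Cw : ℝ, 1 ≤ Cw ∧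
    ∀ (k : ℕ) (E : Finset (Sp n)) (x : Sp n) (δ : ℝ), 0 < δ →
      ZStable Cw (Zop n m) (Dg (dg n m) (dil (m + ϑ) δ) '' sig m ϑ k E x) := by
  obtain ⟨A, hA1, hA⟩ := exists_bump n m
  obtain ⟨C₁, hC₁1, hC₁⟩ := exists_sc_of_growth n m
  obtain ⟨C₂, hC₂1, hC₂⟩ := exists_wn_le_jet n m
  set s : ℝ := m + ϑ with hs
  have hs0 : 0 ≤ s := by positivity
  have h2s : 1 ≤ (2 : ℝ) ^ s := Real.one_le_rpow (by norm_num) hs0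
  set B : ℝ := 2 * (2 * (C₁ * (C₂ + 1)) * 2) * A with hB
  have hB1 : 1 ≤ B := by
    rw [hB]
    have : 1 ≤ C₁ * (C₂ + 1) := by nlinarith
    nlinarith
  refine ⟨B * 2 ^ s, by nlinarith, fun k E x δ hδ => ?_⟩
  rintro _ ⟨u, hu, rfl⟩ hun i
  have hCw : B * 2 ^ s ≠ 0 := by positivity
  refine ⟨(B * 2 ^ s)⁻¹ • Zop n m i (Dg (dg n m) (dil s δ) u), ?_, by rw [smul_inv_smul₀ hCw]⟩
  have hu0 : ∀ v : XX n m, Dg (dg n m) (dil s δ) (Dg (dg n m) (dil s δ⁻¹) v) = v := by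
    intro v
    rw [Dg_Dg, dil_mul hδ.le (inv_nonneg.2 hδ.le), mul_inv_cancel₀ hδ.ne', dil_one, Dg_one]
  refine ⟨Dg (dg n m) (dil s δ⁻¹) ((B * 2 ^ s)⁻¹ • Zop n m i (Dg (dg n m) (dil s δ) u)), ?_, hu0 _⟩
  intro S hS hk
  obtain ⟨T, hT, rfl⟩ := hu S hS hk
  obtain ⟨θ, hθT, hθS, hθ1, hθ0, -⟩ := hA ϑ hϑ hϑ1 x (δ / 2) (by positivity)
  rw [← jet_eq_dil] at hun ⊢
  have hδ2 : 0 < δ / 2 := by positivity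
  have hδs : 0 < δ ^ s := by positivity
  have hwn : wn m δ (T x) ≤ C₂ * δ ^ s := by
    refine (hC₂ s δ (T x) hδ).trans ?_
    have : δ ^ s * ‖jet m s δ (T x)‖ ≤ δ ^ s * 1 := by gcongr
    nlinarith
  have e1 := (hC₁ ϑ 1 δ (C₂ * δ ^ s) (Metric.closedBall x δ) T x hϑ hϑ1 zero_le_one hδ
    (convex_closedBall x δ) hT.tow (hT.hs.mono_set (subset_univ _))
    (Metric.mem_closedBall_self hδ.le) (fun z hz => by simpa [dist_eq_norm] using hz) hwn)
  have e2 := (e1.mul hδ (by positivity) zero_le_two (sc_coord hϑ hϑ1 hδ i x)).mono_scale hϑ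
    (by positivity) hδ2 (by linarith)
  have e3 := (e2.cutoff hδ2 (by positivity) (by linarith) hθS (fun z hz =>
    hθ0 z (by rwa [mul_div_cancel₀ _ (two_ne_zero)]) _)).hsOn hδ2
  have hconst : 2 * (2 * (C₁ * (C₂ * δ ^ s + 1 * δ ^ s)) * 2) * A / (δ / 2) ^ s = B * 2 ^ s := by
    rw [Real.div_rpow hδ.le zero_le_two, hB]
    field_simp
    try ring
  rw [← hs, hconst] at e3
  have hI : IsInt m ϑ (B * 2 ^ s) (S : Set (Sp n)) 0 fun z =>
      T z * (δ⁻¹ • (MvPolynomial.X i + MvPolynomial.C (z i - x i) : Poly n)) * θ z :=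
    ⟨(hT.tow.mul ((IsTow.X i x).smul _)).mul hθT, e3, fun e he => by
      rw [coeff_zero_mul, coeff_zero_mul, hT.val e he]; simp⟩
  have hI' := hI.smul (B * 2 ^ s)⁻¹
  rw [abs_of_pos (by positivity), inv_mul_cancel₀ hCw, smul_zero] at hI'
  refine ⟨_, hI', ?_⟩
  have hj : JEq m (T x * (δ⁻¹ • (MvPolynomial.X i + MvPolynomial.C (x i - x i) : Poly n)) * θ x)
      (δ⁻¹ • (MvPolynomial.X i * T x)) := by
    have h1 : JEq m (θ x) 1 := JEq.of_wn (hθ1 x (Metric.mem_ball_self hδ2) 1)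
    have := (JEq.refl (m := m)
      (T x * (δ⁻¹ • (MvPolynomial.X i + MvPolynomial.C (x i - x i) : Poly n)))).mul h1
    have e : T x * (δ⁻¹ • (MvPolynomial.X i + MvPolynomial.C (x i - x i) : Poly n)) * 1 =
        δ⁻¹ • (MvPolynomial.X i * T x) := by
      simp [mul_comm]
    rwa [e] at this
  have hj' := (jet_eq_jet_iff (s := s)).2 hj
  have hz : Zop n m i (jet m s δ (T x)) = jet m s δ (δ⁻¹ • (MvPolynomial.X i * T x)) := by
    rw [map_smul, jet_X_mul hδ, inv_smul_smul₀ hδ.ne']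
  rw [hz, jet_eq_dil s δ, ← hj', ← map_smul, Dg_Dg,
    dil_mul (inv_nonneg.2 hδ.le) hδ.le, inv_mul_cancel₀ hδ.ne', dil_one, Dg_one]
  exact map_smul _ _ _

end Gam

end

section

section Linear
variable {ι : Type*} [Fintype ι]

theorem exists_smul_of_strong {A : EuclideanSpace ℝ ι →L[ℝ] EuclideanSpace ℝ ι} {R : ℝ}
    {Ω : Set (EuclideanSpace ℝ ι)} (hΩ : CS Ω)
    (h : ∀ x, ‖x‖ ≤ 1 → ∃ u ∈ Ω, A x = R • u) {x : EuclideanSpace ℝ ι} {F : ℝ} (hF : ‖x‖ ≤ F) :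
    ∃ u ∈ Ω, A x = (F * R) • u := by
  rcases eq_or_lt_of_le ((norm_nonneg x).trans hF) with h0 | h0
  · have : x = 0 := norm_le_zero_iff.1 (h0 ▸ hF)
    exact ⟨0, hΩ.zero, by simp [this]⟩
  · obtain ⟨u, hu, hAu⟩ := h (F⁻¹ • x) (by
      rw [norm_smul, norm_inv, Real.norm_eq_abs, abs_of_pos h0]
      exact (inv_mul_le_one₀ h0).2 hF)
    refine ⟨u, hu, ?_⟩
    rw [mul_smul, ← hAu, map_smul, smul_inv_smul₀ h0.ne']

/-- A vector orthogonal to `W` which is a multiple of an element of `Ω` up to a bounded error is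
bounded. -/
theorem Strong.norm_le_of_decomp {R B F : ℝ} {Ω : Set (EuclideanSpace ℝ ι)} (hΩ : CS Ω)
    {W : Submodule ℝ (EuclideanSpace ℝ ι)} (h : Strong R Ω W) (hR : 1 ≤ R)
    (hb : ∀ u ∈ Ω, W.starProjection u = 0 → ‖u‖ ≤ R) (hB : 0 ≤ B) {b v : EuclideanSpace ℝ ι}
    (hbΩ : b ∈ Ω) (hv : ‖v‖ ≤ F) (hP : W.starProjection (B • b + v) = 0) :
    ‖B • b + v‖ ≤ (B + F * R) * R + F * R + F := by
  obtain ⟨A, h1, h2, h3, h4⟩ := h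
  have hF : 0 ≤ F := (norm_nonneg v).trans hv
  have hAv : ‖A v‖ ≤ F * R := by
    refine (A.le_opNorm v).trans ?_
    rw [mul_comm]
    gcongr
  obtain ⟨w, hw, hAw⟩ := exists_smul_of_strong hΩ h4 hv
  have hAb : A (B • b) = - A v := by
    have : A (B • b + v) = 0 := by rw [← h2, hP, map_zero]
    rw [map_add] at this
    exact eq_neg_of_add_eq_zero_left this
  have hb' : ‖B • b + A v‖ ≤ (B + F * R) * R := by
    rcases eq_or_lt_of_le (show 0 ≤ B + F * R by positivity) with h0 | h0
    · have hB0 : B = 0 := by nlinarith [mul_nonneg hF (zero_le_one.trans hR)]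
      have hF0 : F * R = 0 := by linarith
      rw [hAw, hB0, hF0]; simp
    · have hmem : (B + F * R)⁻¹ • (B • b + A v) ∈ Ω := by
        have := hΩ.convex hbΩ hw (a := B / (B + F * R)) (b := F * R / (B + F * R))
          (by positivity) (by positivity) (by field_simp)
        convert this using 1
        rw [hAw, smul_add, smul_smul, smul_smul]
        congr 2 <;> rw [div_eq_inv_mul]
      have := hb _ hmem (by
        have : A v = - A (B • b) := by rw [hAb, neg_neg]
        rw [map_smul, map_add, this, map_neg, h1, add_neg_cancel, smul_zero])
      rw [norm_smul, norm_inv, Real.norm_eq_abs, abs_of_pos h0, inv_mul_le_iff₀ h0] at this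
      exact this
  calc ‖B • b + v‖ = ‖(B • b + A v) - A v + v‖ := by congr 1; abel
    _ ≤ ‖B • b + A v‖ + ‖A v‖ + ‖v‖ := (norm_add_le _ _).trans (by gcongr; exact norm_sub_le _ _)
    _ ≤ _ := by gcongr

end Linear

variable {n m : ℕ} {ϑ : ℝ}

/-- The set `sig` in the coordinates adapted to the scale `δ`. -/
abbrev dsig (m : ℕ) (ϑ : ℝ) (k : ℕ) (E : Finset (Sp n)) (x : Sp n) (δ : ℝ) : Set (XX n m) :=
  Dg (dg n m) (dil (m + ϑ) δ) '' sig m ϑ k E x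

theorem dsig_cs (k : ℕ) (E : Finset (Sp n)) (x : Sp n) (δ : ℝ) : CS (dsig m ϑ k E x δ) :=
  sig_cs.image (Dg (dg n m) (dil (m + ϑ) δ) : XX n m →ₗ[ℝ] XX n m)

theorem dsig_mono {k k' : ℕ} (h : k ≤ k') (E : Finset (Sp n)) (x : Sp n) (δ : ℝ) :
    dsig m ϑ k' E x δ ⊆ dsig m ϑ k E x δ := image_mono (sig_mono h)

/-- A tower vanishing to order `m` at a point is small nearby. -/
theorem exists_growth_zero (n m : ℕ) (hϑ : 0 < ϑ) (hϑ1 : ϑ ≤ 1) : ∃ C : ℝ, 1 ≤ C ∧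
    ∀ (M δ : ℝ) (U : Set (Sp n)) (T : Sp n → Poly n) (x y : Sp n), 0 ≤ M → 0 < δ → Convex ℝ U →
      IsTow m T → HSOn m ϑ M U T → x ∈ U → y ∈ U → JEq m (T x) 0 → ‖y - x‖ ≤ δ →
      wn m δ (T y) ≤ C * M * δ ^ (m + ϑ : ℝ) := by
  obtain ⟨C, hC1, hC⟩ := exists_growth n m
  refine ⟨C, hC1, fun M δ U T x y hM hδ hU hT hH hx hy h0 hxy => ?_⟩
  have hw : wn m δ (T x) = 0 := by rw [h0.wn_eq, wn_zero]
  have h1 := hC ϑ M δ 0 U T x y hϑ hϑ1 hM hδ hU hT hH hx hy hxy hw.le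
  have h2 := wn_le_add_sub hδ.le (m := m) (T y) (T x)
  have h3 : (‖y - x‖ / δ) ^ ϑ ≤ 1 :=
    Real.rpow_le_one (by positivity) ((div_le_one hδ).2 hxy) hϑ.le
  have h4 : 0 ≤ C * M * δ ^ (m + ϑ : ℝ) := by positivity
  calc wn m δ (T y) ≤ C * M * δ ^ (m + ϑ : ℝ) * (‖y - x‖ / δ) ^ ϑ := by
        rw [hw] at h2; linarith
    _ ≤ _ := mul_le_of_le_one_right h4 h3

/-- Weak approximability persists at nearby points. -/
theorem exists_weak_transport (n m : ℕ) (hϑ : 0 < ϑ) (hϑ1 : ϑ ≤ 1) {ε : ℝ} (hε : 0 < ε)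
    (hε1 : ε ≤ 1) : ∃ c : ℝ, 0 < c ∧ c ≤ 1 ∧ ∀ (k : ℕ) (E : Finset (Sp n)) (x y : Sp n) (δ : ℝ)
      (W : Submodule ℝ (XX n m)), 0 < δ → ‖y - x‖ ≤ c * δ →
      Weak ε (dsig m ϑ (((idx n m).card + 1) * k) E x δ) W →
      Weak (2 * ε) (dsig m ϑ k E y δ) W := by
  obtain ⟨C, hC1, hC⟩ := exists_growth n m
  obtain ⟨C₁, hC₁1, hC₁⟩ := exists_norm_jet_le n m
  obtain ⟨C₂, hC₂1, hC₂⟩ := exists_wn_le_jet n m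
  set K : ℝ := C₁ * (C * (C₂ * 2 + 1)) with hK
  have hK1 : 0 < K := by positivity
  have hεK : 0 < ε / K := by positivity
  set c : ℝ := min 1 ((ε / K) ^ ϑ⁻¹) with hc
  have hc0 : 0 < c := lt_min one_pos (Real.rpow_pos_of_pos hεK _)
  refine ⟨c, hc0, min_le_left _ _, fun k E x y δ W hδ hxy hW w hw hw1 => ?_⟩
  obtain ⟨_, ⟨u, hu, rfl⟩, hq⟩ := hW w hw hw1
  obtain ⟨u', hu', T, hT, hH, rfl, rfl⟩ := Gam.transport hu y
  rw [← jet_eq_dil] at hq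
  refine ⟨_, ⟨_, hu', rfl⟩, ?_⟩
  rw [← jet_eq_dil]
  set s : ℝ := m + ϑ with hs
  have hδs : 0 < δ ^ s := by positivity
  have hn : ‖jet m s δ (T x)‖ ≤ 2 := by
    have := norm_add_le w (jet m s δ (T x) - w)
    rw [add_sub_cancel] at this
    linarith
  have hwn : wn m δ (T x) ≤ C₂ * 2 * δ ^ s := by
    refine (hC₂ s δ (T x) hδ).trans ?_
    have : δ ^ s * ‖jet m s δ (T x)‖ ≤ δ ^ s * 2 := by gcongr
    nlinarith
  have hc1 : c * δ ≤ δ := mul_le_of_le_one_left hδ.le (min_le_left _ _)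
  have h1 := hC ϑ 1 δ _ univ T x y hϑ hϑ1 zero_le_one hδ convex_univ hT hH trivial trivial
    (hxy.trans hc1) hwn
  have h2 : (‖y - x‖ / δ) ^ ϑ ≤ ε / K := by
    have : ‖y - x‖ / δ ≤ (ε / K) ^ ϑ⁻¹ :=
      ((div_le_iff₀ hδ).2 hxy).trans (min_le_right _ _)
    refine (Real.rpow_le_rpow (by positivity) this hϑ.le).trans (le_of_eq ?_)
    rw [← Real.rpow_mul hεK.le, inv_mul_cancel₀ hϑ.ne', Real.rpow_one]
  have h3 : ‖jet m s δ (T y) - jet m s δ (T x)‖ ≤ ε := by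
    rw [← map_sub]
    refine (hC₁ s δ _ hδ).trans ?_
    calc C₁ * (wn m δ (T y - T x) / δ ^ s)
        ≤ C₁ * (C * (C₂ * 2 * δ ^ s + 1 * δ ^ s) * (ε / K) / δ ^ s) := by
          gcongr
          exact h1.trans (by gcongr)
      _ = ε := by rw [hK]; field_simp
  calc ‖jet m s δ (T y) - w‖ = ‖(jet m s δ (T y) - jet m s δ (T x)) + (jet m s δ (T x) - w)‖ := by
        congr 1; abel
    _ ≤ ε + ε := (norm_add_le _ _).trans (add_le_add h3 hq)
    _ = 2 * ε := by ring

end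

section

variable {n m : ℕ} {ϑ : ℝ}

theorem Good.mem_orthogonal_Dg {W : Submodule ℝ (XX n m)} (hW : Good (dg n m) (Zop n m) W)
    (c : ℕ → ℝ) {u : XX n m} (hu : u ∈ Wᗮ) : Dg (dg n m) c u ∈ Wᗮ := by
  rw [← Submodule.starProjection_apply_eq_zero_iff] at hu ⊢
  rw [hW.starProjection_Dg, hu, map_zero]

/-- Polynomial towers adapted to `W` with jets in `Gam`, close to a given polynomial tower. -/
theorem exists_adapted_jet (n m : ℕ) (hϑ : 0 < ϑ) (hϑ1 : ϑ ≤ 1) {R : ℝ} (hR : 0 < R) :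
    ∃ C : ℝ, 1 ≤ C ∧ ∀ (k : ℕ) (E : Finset (Sp n)) (f : Sp n → ℝ) (M δ : ℝ)
      (W : Submodule ℝ (XX n m)) (y p : Sp n) (H : Sp n → Poly n), 0 < M → 0 < δ →
      Good (dg n m) (Zop n m) W → Strong R (dsig m ϑ k E p δ) W → ‖p - y‖ ≤ δ → IsPT m H →
      jet m (m + ϑ) 1 (H y) ∈ Gam m ϑ (((idx n m).card + 1) * k) E f M y →
      ∃ G, IsPT m G ∧ jet m (m + ϑ) 1 (G p) ∈ Gam m ϑ k E f (C * M) p ∧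
        (∀ q, jet m (m + ϑ) 1 (G q - H q) ∈ Wᗮ) ∧
        wn m δ (G p - H p) ≤ C * M * δ ^ (m + ϑ : ℝ) ∧ (p = y → G = H) := by
  obtain ⟨C₀, hC₀1, hC₀⟩ := exists_growth_zero n m hϑ hϑ1
  obtain ⟨C₁, hC₁1, hC₁⟩ := exists_norm_jet_le n m
  obtain ⟨C₂, hC₂1, hC₂⟩ := exists_wn_le_jet n m
  have hCC : 1 ≤ C₁ * C₀ := one_le_mul_of_one_le_of_one_le hC₁1 hC₀1
  refine ⟨C₂ * (1 + C₁ * C₀ * (1 + R)), by nlinarith [mul_pos (zero_lt_one.trans_le hCC) hR],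
    fun k E f M δ W y p H hM hδ hW hS hpy hH hHu => ?_⟩
  set s : ℝ := m + ϑ with hs
  have hCM : M ≤ C₂ * (1 + C₁ * C₀ * (1 + R)) * M := by
    have : 1 ≤ C₂ * (1 + C₁ * C₀ * (1 + R)) := by
      nlinarith [mul_pos (zero_lt_one.trans_le hCC) hR]
    nlinarith
  by_cases hp : p = y
  · subst hp
    exact ⟨H, hH, Gam.mono (Nat.le_mul_of_pos_left _ (Nat.succ_pos _)) hCM hHu,
      fun q => by simp, by simp only [sub_self, wn_zero]; positivity, fun _ => rfl⟩
  obtain ⟨u', hu', T, hT, hTH, hTy, rfl⟩ := Gam.transport hHu p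
  have hw : wn m δ (T p - H p) ≤ C₀ * M * δ ^ s := by
    refine hC₀ M δ univ (fun x => T x - H x) y p hM.le hδ convex_univ (hT.sub hH.1) (by
      simpa using hTH.sub (hH.hsOn ϑ univ)) trivial trivial ?_ hpy
    rw [← sub_self (H y)]
    exact JEq.sub (jet_eq_jet_iff.1 hTy) (JEq.refl _)
  have hδs : 0 < δ ^ s := by positivity
  set v := jet m s δ (T p - H p) with hv
  have hvn : ‖v‖ ≤ C₁ * C₀ * M := by
    refine (hC₁ s δ _ hδ).trans ?_
    rw [mul_assoc C₁]
    gcongr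
    rwa [div_le_iff₀ hδs]
  obtain ⟨A, hA1, hA2, hA3, hA4⟩ := hS
  obtain ⟨_, ⟨w, hwΩ, rfl⟩, hAw⟩ := exists_smul_of_strong (dsig_cs _ _ _ _) hA4 hvn
  obtain ⟨P, hP⟩ := jet_surjective s (jet m s 1 (T p) + (-(C₁ * C₀ * M * R)) • w)
  obtain ⟨G, hG, hGp⟩ := exists_isPT m p P
  have hGP : jet m s 1 (G p) = jet m s 1 (T p) + (-(C₁ * C₀ * M * R)) • w := by
    rw [← hP]
    exact jet_eq_jet_iff.2 (JEq.of_wn (hGp 1))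
  have hGd : jet m s δ (G p - H p) = v - A v := by
    rw [hAw, hv, map_sub, map_sub, jet_eq_dil s δ (G p), hGP, map_add, ← jet_eq_dil, map_smul,
      neg_smul]
    abel
  have horth : jet m s δ (G p - H p) ∈ Wᗮ := by
    rw [← Submodule.starProjection_apply_eq_zero_iff, hGd, map_sub, hA1, sub_self]
  have horth1 : jet m s 1 (G p - H p) ∈ Wᗮ := by
    have := hW.mem_orthogonal_Dg (dil s δ⁻¹) horth
    rwa [jet_eq_dil, Dg_Dg, dil_mul (inv_nonneg.2 hδ.le) hδ.le, inv_mul_cancel₀ hδ.ne', dil_one,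
      Dg_one] at this
  refine ⟨G, hG, ?_, hW.mem_orthogonal_of_isPT (hG.sub hH) horth1, ?_, fun h => absurd h hp⟩
  · rw [hGP]
    refine Gam.mono le_rfl ?_ (Gam.add_smul hu' hwΩ _)
    rw [abs_neg, abs_of_nonneg (by positivity)]
    have h1 : M + C₁ * C₀ * M * R ≤ (1 + C₁ * C₀ * (1 + R)) * M := by
      nlinarith [mul_pos (zero_lt_one.trans_le hCC) hM]
    have h2 : 0 ≤ (1 + C₁ * C₀ * (1 + R)) * M := by positivity
    nlinarith
  · refine (hC₂ s δ _ hδ).trans ?_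
    have hAv : ‖A v‖ ≤ R * (C₁ * C₀ * M) := (A.le_opNorm v).trans (by gcongr)
    have : ‖jet m s δ (G p - H p)‖ ≤ (1 + C₁ * C₀ * (1 + R)) * M := by
      rw [hGd]
      refine (norm_sub_le _ _).trans ((add_le_add hvn hAv).trans ?_)
      nlinarith
    calc C₂ * (δ ^ s * ‖jet m s δ (G p - H p)‖)
        ≤ C₂ * (δ ^ s * ((1 + C₁ * C₀ * (1 + R)) * M)) := by gcongr
      _ = _ := by ring

/-- Adapted polynomial towers at nearby points are consistent at unstopped scales. -/
theorem exists_adapted_consistent (n m : ℕ) (hϑ : 0 < ϑ) (hϑ1 : ϑ ≤ 1) {R B ε : ℝ} (hR : 0 < R)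
    (hB : 1 ≤ B) (hε : 0 < ε) : ∃ C : ℝ, 1 ≤ C ∧ ∀ (k : ℕ) (E : Finset (Sp n)) (f : Sp n → ℝ)
      (M δ d : ℝ) (W : Submodule ℝ (XX n m)) (p q : Sp n) (F G H : Sp n → Poly n), 0 < M → 0 < δ →
      0 < d → Good (dg n m) (Zop n m) W → Strong R (dsig m ϑ k E p δ) W →
      (∀ δ', d < δ' → δ' ≤ δ → ∀ W', Good (dg n m) (Zop n m) W' →
        mu m (dg n m) W < mu m (dg n m) W' → ¬ Weak ε (dsig m ϑ k E p δ') W') →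
      IsPT m F → IsPT m G → IsPT m H →
      jet m (m + ϑ) 1 (F p) ∈ Gam m ϑ (((idx n m).card + 1) * k) E f (B * M) p →
      jet m (m + ϑ) 1 (G q) ∈ Gam m ϑ (((idx n m).card + 1) * k) E f (B * M) q →
      (∀ z, jet m (m + ϑ) 1 (F z - H z) ∈ Wᗮ) → (∀ z, jet m (m + ϑ) 1 (G z - H z) ∈ Wᗮ) →
      wn m δ (F p - H p) ≤ B * M * δ ^ (m + ϑ : ℝ) →
      wn m δ (G q - H q) ≤ B * M * δ ^ (m + ϑ : ℝ) →
      ‖p - q‖ ≤ d → ‖p - q‖ ≤ δ → wn m d (F p - G p) ≤ C * M * d ^ (m + ϑ : ℝ) := by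
  obtain ⟨Cg, hCg1, hCg⟩ := exists_growth n m
  obtain ⟨C₀, hC₀1, hC₀⟩ := exists_growth_zero n m hϑ hϑ1
  obtain ⟨C₁, hC₁1, hC₁⟩ := exists_norm_jet_le n m
  obtain ⟨C₂, hC₂1, hC₂⟩ := exists_wn_le_jet n m
  obtain ⟨Cw, hCw1, hCw⟩ := exists_sig_zStable n m hϑ hϑ1
  obtain ⟨Q, hQ1, ρ, hρ0, hρ1, hdich⟩ := exists_dichotomy (s := m + ϑ) (dg_le (n := n) (m := m))
    (by linarith) Dg_Zop hε (zero_lt_one.trans_le hCw1) hR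
  set s : ℝ := m + ϑ with hs
  have hs0 : 0 ≤ s := by positivity
  set t : ℝ := 2 / ρ with ht
  have ht1 : 1 ≤ t := by rw [ht, le_div_iff₀ hρ0]; linarith
  have hts : 1 ≤ t ^ s := Real.one_le_rpow ht1 hs0
  set Cn : ℝ := C₁ * (C₀ * B) with hCn
  have hCn0 : 0 ≤ Cn := by positivity
  set Ca : ℝ := (B + (Cg * B + B)) * t ^ s with hCa
  have hCa0 : 0 ≤ Ca := by positivity
  set Cb : ℝ := C₂ * (t ^ s * ((2 * B + Cn * Q) * Q + Cn * Q + Cn)) with hCb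
  have hCb0 : 0 ≤ Cb := by positivity
  refine ⟨1 + Ca + Cb, by linarith, ?_⟩
  intro k E f M δ d W p q F G H hM hδ hd hW hS h_unstopped hF hG hH hFp hGq hFH hGH hwF hwG hpq hpqδ
  have hds : 0 < d ^ s := by positivity
  have hδs : 0 < δ ^ s := by positivity
  have hBM : 0 < B * M := by positivity
  rcases le_or_gt δ (t * d) with hle | hlt
  · -- the scale is comparable to `δ`
    have h1 : wn m δ (G p - H p) ≤ (Cg * B + B) * M * δ ^ s := by
      have := hCg ϑ 0 δ _ univ (fun z => G z - H z) q p hϑ hϑ1 le_rfl hδ convex_univ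
        (hG.sub hH).1 ((hG.sub hH).hsOn ϑ univ) trivial trivial hpqδ hwG
      have h3 : (‖p - q‖ / δ) ^ ϑ ≤ 1 :=
        Real.rpow_le_one (by positivity) ((div_le_one hδ).2 hpqδ) hϑ.le
      have h4 := wn_le_add_sub hδ.le (m := m) (G p - H p) (G q - H q)
      have h5 : Cg * (B * M * δ ^ s + 0 * δ ^ s) * (‖p - q‖ / δ) ^ ϑ ≤ Cg * (B * M * δ ^ s) := by
        rw [zero_mul, add_zero]
        exact mul_le_of_le_one_right (by positivity) h3
      nlinarith
    have h2 : wn m δ (F p - G p) ≤ (B + (Cg * B + B)) * M * δ ^ s := by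
      have := wn_sub_le hδ.le (m := m) (F p - H p) (G p - H p)
      rw [sub_sub_sub_cancel_right] at this
      linarith
    have h3 : wn m d (F p - G p) ≤ Ca * M * d ^ s := by
      rcases le_total d δ with hdδ | hdδ
      · refine (wn_mono hd.le hdδ _).trans (h2.trans ?_)
        have : δ ^ s ≤ t ^ s * d ^ s := by
          rw [← Real.mul_rpow (by positivity) hd.le]
          exact Real.rpow_le_rpow hδ.le hle hs0
        calc (B + (Cg * B + B)) * M * δ ^ s ≤ (B + (Cg * B + B)) * M * (t ^ s * d ^ s) := by gcongr
          _ = _ := by rw [hCa]; ring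
      · have h4 := wn_scale_le (m := m) (c := d / δ) hδ.le ((one_le_div hδ).2 hdδ) (F p - G p)
        rw [div_mul_cancel₀ _ hδ.ne'] at h4
        have h5 : (d / δ) ^ m * δ ^ s ≤ d ^ s := by
          have : (d / δ) ^ m ≤ (d / δ) ^ s := by
            rw [← Real.rpow_natCast]
            exact Real.rpow_le_rpow_of_exponent_le ((one_le_div hδ).2 hdδ) (by linarith)
          calc (d / δ) ^ m * δ ^ s ≤ (d / δ) ^ s * δ ^ s := by gcongr
            _ = d ^ s := by
              rw [← Real.mul_rpow (by positivity) hδ.le, div_mul_cancel₀ _ hδ.ne']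
        calc wn m d (F p - G p) ≤ (d / δ) ^ m * ((B + (Cg * B + B)) * M * δ ^ s) :=
              h4.trans (by gcongr)
          _ = (B + (Cg * B + B)) * M * ((d / δ) ^ m * δ ^ s) := by ring
          _ ≤ (B + (Cg * B + B)) * M * (t ^ s * d ^ s) := by
              exact mul_le_mul_of_nonneg_left
                (h5.trans (le_mul_of_one_le_left hds.le hts)) (by positivity)
          _ = _ := by rw [hCa]; ring
    refine h3.trans ?_
    gcongr
    linarith
  · set τ : ℝ := t * d with hτ
    have hτ0 : 0 < τ := by positivity
    have hdτ : d ≤ τ := le_mul_of_one_le_left hd.le ht1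
    have hτs : τ ^ s = t ^ s * d ^ s := Real.mul_rpow (by positivity) hd.le
    have hτδ : τ / δ * δ = τ := div_mul_cancel₀ _ hδ.ne'
    obtain ⟨hst, hbd⟩ := hdich (dsig m ϑ k E p δ) W (τ / δ) (dsig_cs _ _ _ _) (by
        intro ρ' hρ' _
        rw [image_dil_dil _ hρ'.le hδ.le]
        exact hCw k E p _ (by positivity)) hW hS (by positivity) ((div_le_one hδ).2 hlt.le) (by
        intro ρ' hρ' hρ'1 W' hW' hmu
        have hρ'0 : 0 < ρ' := lt_of_lt_of_le (by positivity) hρ'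
        rw [image_dil_dil _ hρ'0.le hδ.le]
        refine h_unstopped _ ?_ (mul_le_of_le_one_left hδ.le hρ'1) W' hW' hmu
        have : ρ * (τ / δ) * δ ≤ ρ' * δ := by gcongr
        have e : ρ * (τ / δ) * δ = 2 * d := by
          rw [hτ, ht]; field_simp
        linarith)
    rw [image_dil_dil _ (by positivity) hδ.le, hτδ] at hst hbd
    obtain ⟨u', hu', T, hT, hTH, hTq, rfl⟩ := Gam.transport hGq p
    obtain ⟨b, hb, hbe⟩ := Gam.sub_mem (by linarith)
      (Gam.mono (Nat.le_mul_of_pos_left k (Nat.succ_pos _)) le_rfl hFp) hu'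
    have hw : wn m τ (T p - G p) ≤ C₀ * (B * M) * τ ^ s := by
      refine hC₀ (B * M) τ univ (fun x => T x - G x) q p hBM.le hτ0 convex_univ (hT.sub hG.1) (by
        simpa using hTH.sub (hG.hsOn ϑ univ)) trivial trivial ?_ (hpq.trans hdτ)
      rw [← sub_self (G q)]
      exact JEq.sub (jet_eq_jet_iff.1 hTq) (JEq.refl _)
    have hv : ‖jet m s τ (T p - G p)‖ ≤ Cn * M := by
      refine (hC₁ s τ _ hτ0).trans ?_
      have : wn m τ (T p - G p) / τ ^ s ≤ C₀ * (B * M) := by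
        rwa [div_le_iff₀ (by positivity)]
      calc C₁ * (wn m τ (T p - G p) / τ ^ s) ≤ C₁ * (C₀ * (B * M)) := by gcongr
        _ = Cn * M := by rw [hCn]; ring
    have hdec : (2 * B * M) • Dg (dg n m) (dil s τ) b + jet m s τ (T p - G p) =
        jet m s τ (F p - G p) := by
      have : (2 * B * M) • b = jet m s 1 (F p) - jet m s 1 (T p) := by
        rw [hbe]; congr 1; ring
      rw [← map_smul, this, map_sub, ← jet_eq_dil, ← jet_eq_dil, ← map_sub, ← map_add]
      congr 1; abel
    have hP : W.starProjection (jet m s τ (F p - G p)) = 0 := by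
      rw [Submodule.starProjection_apply_eq_zero_iff, jet_eq_dil]
      refine hW.mem_orthogonal_Dg _ ?_
      have := Submodule.sub_mem _ (hFH p) (hGH p)
      rwa [← map_sub, sub_sub_sub_cancel_right] at this
    have hmain := hst.norm_le_of_decomp (dsig_cs _ _ _ _) hQ1 hbd (B := 2 * B * M) (by positivity)
      ⟨b, hb, rfl⟩ hv (by rw [hdec]; exact hP)
    rw [hdec] at hmain
    have h3 : wn m d (F p - G p) ≤ Cb * M * d ^ s := by
      refine (wn_mono hd.le hdτ _).trans ((hC₂ s τ _ hτ0).trans ?_)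
      calc C₂ * (τ ^ s * ‖jet m s τ (F p - G p)‖)
          ≤ C₂ * (τ ^ s * ((2 * B * M + Cn * M * Q) * Q + Cn * M * Q + Cn * M)) := by gcongr
        _ = _ := by rw [hCb, hτs]; ring
    refine h3.trans ?_
    gcongr
    linarith

end

section

variable {n m : ℕ} {ϑ : ℝ}

/-- The slowly varying radius associated with a family of stopped scales. -/
theorem exists_stopping_radius (P : Sp n → ℝ → Prop) {η δ l : ℝ} (hη : 0 < η) (hηδ : η ≤ δ)
    (hl : 0 ≤ l) (hP : ∀ z t, P z t → t ≤ δ) : ∃ r : Sp n → ℝ, (∀ y, η ≤ r y) ∧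
      (∀ y z, r y ≤ r z + l * ‖y - z‖) ∧ (∀ y t, P y t → t ≤ r y) ∧
      ∀ y, r y < 2 * η ∨ ∃ z t, P z t ∧ r y / 2 < t - l * ‖y - z‖ := by
  let Q : Sp n → Set ℝ := fun y => insert η {a | ∃ z t, P z t ∧ a = t - l * ‖y - z‖}
  have hbdd : ∀ y, BddAbove (Q y) := by
    intro y
    refine ⟨δ, ?_⟩
    rintro a (rfl | ⟨z, t, hzt, rfl⟩)
    · exact hηδ
    · have := mul_nonneg hl (norm_nonneg (y - z))
      linarith [hP z t hzt]
  have hne : ∀ y, (Q y).Nonempty := fun y => ⟨η, Or.inl rfl⟩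
  have hηr : ∀ y, η ≤ sSup (Q y) := fun y => le_csSup (hbdd y) (Or.inl rfl)
  refine ⟨fun y => sSup (Q y), hηr, fun y z => ?_, fun y t hyt => ?_, fun y => ?_⟩
  · refine csSup_le (hne y) ?_
    rintro a (rfl | ⟨w, t, hwt, rfl⟩)
    · have := mul_nonneg hl (norm_nonneg (y - z))
      linarith [hηr z]
    · have h1 : t - l * ‖z - w‖ ≤ sSup (Q z) := le_csSup (hbdd z) (Or.inr ⟨w, t, hwt, rfl⟩)
      have h2 := norm_sub_le_norm_sub_add_norm_sub z y w
      rw [norm_sub_rev z y] at h2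
      have := mul_le_mul_of_nonneg_left h2 hl
      linarith
  · exact le_csSup (hbdd y) (Or.inr ⟨y, t, hyt, by simp⟩)
  · have hpos := hη.trans_le (hηr y)
    obtain ⟨a, ha, hlt⟩ := exists_lt_of_lt_csSup (hne y) (half_lt_self hpos)
    rcases ha with rfl | ⟨z, t, hzt, rfl⟩
    · left; linarith
    · exact Or.inr ⟨z, t, hzt, hlt⟩

theorem exists_separation (E : Finset (Sp n)) : ∃ η : ℝ, 0 < η ∧
    ∀ x ∈ E, ∀ y ∈ E, ‖x - y‖ ≤ 2 * η → x = y := by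
  by_cases h : (E : Set (Sp n)).Nontrivial
  · have h0 := E.infsep_pos_iff_nontrivial.2 h
    refine ⟨(E : Set (Sp n)).infsep / 3, by positivity, fun x hx y hy hxy => ?_⟩
    by_contra hne
    have := Set.infsep_le_dist_of_mem (Finset.mem_coe.2 hx) (Finset.mem_coe.2 hy) hne
    rw [dist_eq_norm] at this
    linarith
  · rw [Set.not_nontrivial_iff] at h
    exact ⟨1, one_pos, fun x hx y hy _ => h hx hy⟩

/-- The tolerance for weak approximability. -/
def tol (n m : ℕ) : ℝ := (4 * ((idx n m).card + 1))⁻¹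

theorem tol_pos (n m : ℕ) : 0 < tol n m := by unfold tol; positivity

theorem tol_le_one (n m : ℕ) : tol n m ≤ 1 := by
  unfold tol
  refine inv_le_one_of_one_le₀ ?_
  have : (0 : ℝ) ≤ (idx n m).card := Nat.cast_nonneg _
  linarith

/-- Local interpolation with prescribed jets, near points at which the jets are controlled by a
subspace with a large invariant `mu`. -/
def LocalExtension (n m : ℕ) (ϑ : ℝ) (N : ℕ) : Prop :=
  ∃ (k : ℕ) (C c : ℝ), 1 ≤ k ∧ 1 ≤ C ∧ 0 < c ∧ c ≤ 1 ∧
    ∀ (E : Finset (Sp n)) (f : Sp n → ℝ) (M δ : ℝ) (x : Sp n) (W : Submodule ℝ (XX n m)),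
      0 < M → 0 < δ → Good (dg n m) (Zop n m) W → N ≤ mu m (dg n m) W →
      Weak (tol n m) (dsig m ϑ k E x δ) W → ∀ y ∈ Metric.closedBall x (c * δ),
      ∀ u ∈ Gam m ϑ k E f M y, ∃ T, IsInt m ϑ (C * M) (↑E ∩ Metric.closedBall x (c * δ)) f T ∧
        jet m (m + ϑ) 1 (T y) = u

/-- Gluing a tower defined near `x` to a polynomial tower with the same jet at `y`. -/
theorem exists_glue (n m : ℕ) (hϑ : 0 < ϑ) (hϑ1 : ϑ ≤ 1) : ∃ C : ℝ, 1 ≤ C ∧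
    ∀ (M r : ℝ) (x y : Sp n) (T G : Sp n → Poly n), 0 ≤ M → 0 < r → IsTow m T →
      HSOn m ϑ M (Metric.closedBall x (2 * r)) T → IsPT m G → y ∈ Metric.closedBall x (2 * r) →
      JEq m (T y) (G y) → ∃ S, IsTow m S ∧ HSOn m ϑ (C * M) univ S ∧
        ∀ z ∈ Metric.ball x r, JEq m (S z) (T z) := by
  obtain ⟨A, hA1, hA⟩ := exists_bump n m
  obtain ⟨C, hC1, hC⟩ := exists_sc_of_growth n m
  set s : ℝ := m + ϑ with hs
  have hs0 : 0 ≤ s := by positivity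
  have h4s : 1 ≤ (4 : ℝ) ^ s := Real.one_le_rpow (by norm_num) hs0
  refine ⟨2 * C * A * 4 ^ s, ?_, fun M r x y T G hM hr hT hTH hG hy hTG => ?_⟩
  · have : 1 ≤ C * A * 4 ^ s :=
      one_le_mul_of_one_le_of_one_le (one_le_mul_of_one_le_of_one_le hC1 hA1) h4s
    nlinarith
  obtain ⟨θ, hθT, hθS, hθ1, hθ0, -⟩ := hA ϑ hϑ hϑ1 x r hr
  have hd : ∀ z ∈ Metric.closedBall x (2 * r), ‖z - y‖ ≤ 4 * r := by
    intro z hz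
    rw [Metric.mem_closedBall] at hz hy
    rw [← dist_eq_norm]
    linarith [dist_triangle_right z y x]
  have e1 := hC ϑ M (4 * r) 0 (Metric.closedBall x (2 * r)) (fun z => T z - G z) y hϑ hϑ1 hM
    (by positivity) (convex_closedBall _ _) (hT.sub hG.1)
    (by simpa using hTH.sub (hG.hsOn ϑ _)) hy hd (by
      have : JEq m (T y - G y) 0 := by
        rw [← sub_self (G y)]; exact hTG.sub (JEq.refl _)
      rw [this.wn_eq, wn_zero])
  have e2 := ((e1.mono_scale hϑ (by positivity) hr (by linarith)).cutoff hr (by positivity)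
    (by linarith) hθS (fun z hz => hθ0 z hz _)).hsOn hr
  have hconst : 2 * (C * (0 + M * (4 * r) ^ s)) * A / r ^ s = 2 * C * A * 4 ^ s * M := by
    rw [Real.mul_rpow (by norm_num) hr.le]
    have : r ^ s ≠ 0 := by positivity
    field_simp
    try ring
  rw [← hs, hconst] at e2
  refine ⟨fun z => G z + (T z - G z) * θ z, hG.1.add ((hT.sub hG.1).mul hθT),
    by simpa using (hG.hsOn ϑ univ).add e2, fun z hz => ?_⟩
  have := (JEq.refl (G z)).add ((JEq.refl (T z - G z)).mul
    (JEq.of_wn (hθ1 z hz 1) : JEq m (θ z) 1))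
  rwa [mul_one, add_sub_cancel] at this

end

section

variable {n m : ℕ} {ϑ : ℝ}

set_option maxHeartbeats 1600000 in
theorem LocalExtension.of_succ (hϑ : 0 < ϑ) (hϑ1 : ϑ ≤ 1) {N : ℕ}
    (h : LocalExtension n m ϑ (N + 1)) : LocalExtension n m ϑ N := by
  obtain ⟨k, C, c, hk1, hC1, hc0, hc1, hext⟩ := h
  obtain ⟨c₀, hc₀0, hc₀1, hweak⟩ := exists_weak_transport n m hϑ hϑ1 (tol_pos n m) (tol_le_one n m)
  set D : ℕ := (idx n m).card with hD
  set R : ℝ := 4 * (D + 1) with hR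
  have hR0 : 0 < R := by positivity
  obtain ⟨B, hB1, hadapt⟩ := exists_adapted_jet n m hϑ hϑ1 hR0
  obtain ⟨Cc, hCc1, hcons⟩ := exists_adapted_consistent n m hϑ hϑ1 hR0 hB1 (tol_pos n m)
  obtain ⟨C₀, hC₀1, hgrow⟩ := exists_growth_zero n m hϑ hϑ1
  obtain ⟨Cp, hCp1, hpatch⟩ := exists_patch n m hϑ hϑ1
  obtain ⟨Cg, hCg1, hglue⟩ := exists_glue n m hϑ hϑ1
  set s : ℝ := m + ϑ with hs
  have hs0 : 0 ≤ s := by positivity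
  set κ : ℝ := c / 200 with hκ
  have hκ0 : 0 < κ := by positivity
  set Q : ℝ := C * B + (Cc * κ⁻¹ ^ s + C₀ * (C * B)) with hQ
  have hQ0 : 0 ≤ Q := by positivity
  have hCB : 1 ≤ C * B := one_le_mul_of_one_le_of_one_le hC1 hB1
  set c' : ℝ := c₀ * c / 8 with hc'
  have hc'0 : 0 < c' := by positivity
  have hc'c₀ : 8 * c' ≤ c₀ := by rw [hc']; nlinarith
  have hc'c : c' ≤ c := by rw [hc']; nlinarith
  refine ⟨(D + 1) * ((D + 1) * k), C + Cg * (Cp * Q), c', ?_, ?_, hc'0, by linarith, ?_⟩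
  · exact Nat.mul_pos (Nat.succ_pos _) (Nat.mul_pos (Nat.succ_pos _) hk1)
  · have : 0 ≤ Cg * (Cp * Q) := by positivity
    linarith
  intro E f M δ x W hM hδ hW hN hwk y hy u hu
  have hkk : k ≤ (D + 1) * ((D + 1) * k) :=
    (Nat.le_mul_of_pos_left k (Nat.succ_pos D)).trans (Nat.le_mul_of_pos_left _ (Nat.succ_pos D))
  have hcδ : c' * δ ≤ c * δ := by gcongr
  rcases Nat.lt_or_ge N (mu m (dg n m) W) with hlt | hge
  · obtain ⟨T, hT, hTu⟩ := hext E f M δ x W hM hδ hW hlt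
      (hwk.mono le_rfl (dsig_mono hkk _ _ _)) y (Metric.closedBall_subset_closedBall hcδ hy) u
      (Gam.mono hkk le_rfl hu)
    refine ⟨T, (hT.mono_set ?_).mono_const ?_, hTu⟩
    · exact inter_subset_inter_right _ (Metric.closedBall_subset_closedBall hcδ)
    · have : 0 ≤ Cg * (Cp * Q) * M := by positivity
      nlinarith
  have hNW : mu m (dg n m) W = N := le_antisymm hge hN
  set r₀ : ℝ := 2 * (c' * δ) with hr₀
  have hr₀0 : 0 < r₀ := by positivity
  set U := Metric.closedBall x (2 * r₀) with hU
  have hUx : ∀ p ∈ U, ‖p - x‖ ≤ 4 * c' * δ := by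
    intro p hp
    rw [hU, Metric.mem_closedBall, dist_eq_norm] at hp
    linarith
  have hUU : ∀ p ∈ U, ∀ q ∈ U, ‖p - q‖ ≤ δ := by
    intro p hp q hq
    have h1 := norm_sub_le_norm_sub_add_norm_sub p x q
    rw [norm_sub_rev x q] at h1
    have h2 : 8 * c' * δ ≤ 1 * δ := by gcongr; linarith
    linarith [hUx p hp, hUx q hq]
  have hyr : y ∈ Metric.ball x r₀ := by
    rw [Metric.mem_closedBall] at hy
    rw [Metric.mem_ball]
    have : 0 < c' * δ := by positivity
    linarith
  have hyU : y ∈ U := Metric.closedBall_subset_closedBall (by linarith)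
    (Metric.ball_subset_closedBall hyr)
  have hstrong : ∀ p ∈ U, Strong R (dsig m ϑ ((D + 1) * k) E p δ) W := by
    intro p hp
    have h1 := hweak ((D + 1) * k) E x p δ W hδ ((hUx p hp).trans (by gcongr; linarith)) hwk
    have h2 := h1.strong (dsig_cs _ _ _ _) (by have := tol_pos n m; positivity) (by
      rw [Fintype.card_coe, tol]
      have : ((idx n m).card : ℝ) + 1 ≠ 0 := by positivity
      refine le_of_eq ?_
      field_simp
      norm_num)
    rwa [Fintype.card_coe] at h2
  obtain ⟨P, hP⟩ := jet_surjective s u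
  obtain ⟨H, hH, hHP⟩ := exists_isPT m y P
  have hHu : jet m s 1 (H y) = u := by
    rw [← hP]; exact jet_eq_jet_iff.2 (JEq.of_wn (hHP 1))
  rw [← hHu] at hu
  choose! G hGPT hGmem hGorth hGwn hGy using fun p (hp : p ∈ U) =>
    hadapt ((D + 1) * k) E f M δ W y p H hM hδ hW (hstrong p hp) (hUU p hp y hyU) hH hu
  -- stopped scales
  obtain ⟨η₀, hη₀, hsep⟩ := exists_separation E
  set η : ℝ := min η₀ δ with hη
  have hη0 : 0 < η := lt_min hη₀ hδ
  obtain ⟨r, hrη, hrlip, hr_top, hralt⟩ := exists_stopping_radius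
    (fun z t => 0 < t ∧ t ≤ δ ∧ ∃ W', Good (dg n m) (Zop n m) W' ∧
      mu m (dg n m) W < mu m (dg n m) W' ∧ Weak (tol n m) (dsig m ϑ k E z t) W')
    (l := 2 / c) hη0 (min_le_right _ _) (by positivity) (fun z t ht => ht.2.1)
  have hr0 : ∀ p, 0 < r p := fun p => hη0.trans_le (hrη p)
  have hGk : ∀ p ∈ U, jet m s 1 (G p p) ∈ Gam m ϑ k E f (B * M) p := fun p hp =>
    Gam.mono (Nat.le_mul_of_pos_left k (Nat.succ_pos D)) le_rfl (hGmem p hp)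
  -- local interpolants
  have hlocal : ∀ p ∈ U, ∃ F, IsTow m F ∧ HSOn m ϑ (C * B * M) univ F ∧ JEq m (F p) (G p p) ∧
      ∀ e ∈ E, ‖e - p‖ ≤ κ * r p → (F e).coeff 0 = f e := by
    intro p hp
    rcases hralt p with hlt | ⟨z, t, ⟨ht0, htδ, W', hW', hmu, hwk'⟩, hzt⟩
    · classical
      obtain ⟨F, hF, hFp⟩ := hGk p hp (E.filter fun e => ‖e - p‖ ≤ κ * r p)
        (Finset.filter_subset _ _) (by
          refine le_trans (Finset.card_le_one.2 fun a ha b hb => ?_) hk1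
          rw [Finset.mem_filter] at ha hb
          refine hsep a ha.1 b hb.1 ?_
          have h1 := norm_sub_le_norm_sub_add_norm_sub a p b
          rw [norm_sub_rev p b] at h1
          have h2 : κ * r p ≤ η₀ := by
            have : η ≤ η₀ := min_le_left _ _
            have hκ1 : κ ≤ 1 / 2 := by rw [hκ]; linarith
            nlinarith [hr0 p]
          linarith [ha.2, hb.2])
      refine ⟨F, hF.tow, hF.hs.mono_const ?_, jet_eq_jet_iff.1 hFp, fun e he hep =>
        hF.val e (by simp [he, hep])⟩
      have : 0 < B * M := by positivity
      nlinarith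
    · have hrt : r p < 2 * t := by
        have : 0 ≤ 2 / c * ‖p - z‖ := by positivity
        linarith
      have hpz : ‖p - z‖ < c / 2 * t := by
        have h1 : 2 / c * ‖p - z‖ < t := by linarith [hr0 p]
        have h2 : c / 2 * (2 / c * ‖p - z‖) < c / 2 * t := by gcongr
        have h3 : c / 2 * (2 / c * ‖p - z‖) = ‖p - z‖ := by field_simp
        linarith
      have hct : 0 < c * t := by positivity
      obtain ⟨F, hF, hFp⟩ := hext E f (B * M) t z W' (by positivity) ht0 hW' (by omega) hwk' p
        (by rw [Metric.mem_closedBall, dist_eq_norm]; linarith) _ (hGk p hp)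
      refine ⟨F, hF.tow, by rw [mul_assoc]; exact hF.hs, jet_eq_jet_iff.1 hFp, fun e he hep =>
        hF.val e ⟨he, ?_⟩⟩
      rw [Metric.mem_closedBall, dist_eq_norm]
      have h1 := norm_sub_le_norm_sub_add_norm_sub e p z
      have h2 : κ * r p ≤ c / 100 * t := by
        have : κ * r p ≤ κ * (2 * t) := by gcongr
        rw [hκ] at this ⊢
        linarith
      linarith
  choose! F hFT hFH hFG hFf using hlocal
  have hCBM : 0 ≤ C * B * M := by positivity
  obtain ⟨T, hT, hTH, hTf, hTy⟩ := hpatch (Q * M) (κ * η) U E f (fun p => κ * r p) F y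
    (by positivity) (convex_closedBall _ _) Metric.isBounded_closedBall hyU (by positivity)
    (fun p _ => by have := hrη p; gcongr) (by
      intro p _ q _
      have := mul_le_mul_of_nonneg_left (hrlip p q) hκ0.le
      have e : κ * (r q + 2 / c * ‖p - q‖) = κ * r q + ‖p - q‖ / 100 := by
        rw [hκ]; field_simp; ring
      linarith) hFT (fun p hp => (hFH p hp).mono_const (by
        rw [hQ]
        gcongr
        exact le_add_of_nonneg_right (by positivity)) |>.mono_set (subset_univ _))
    (fun p hp e he hep => hFf p hp e he.1 hep) (by
      intro p hp q hq d hpq hpd hqd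
      have hd0 : 0 < d := lt_of_lt_of_le (mul_pos hκ0 (hr0 p)) hpd
      have hdκ : d ≤ d / κ := by
        rw [le_div_iff₀ hκ0]
        have : κ ≤ 1 := by rw [hκ]; linarith
        nlinarith
      have hrpd : r p ≤ d / κ := by rw [le_div_iff₀ hκ0, mul_comm]; exact hpd
      have h1 := hcons k E f M δ (d / κ) W p q (G p) (G q) H hM hδ (by positivity) hW
        ((hstrong p hp).mono_set (dsig_mono (Nat.le_mul_of_pos_left k (Nat.succ_pos D)) _ _ _))
        (by
          intro δ' hδ' hδ'δ W' hW' hmu hwk'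
          have := hr_top p δ' ⟨by linarith [hr0 p], hδ'δ, W', hW', hmu, hwk'⟩
          linarith)
        (hGPT p hp) (hGPT q hq) hH (hGmem p hp) (hGmem q hq) (hGorth p hp) (hGorth q hq)
        (hGwn p hp) (by
          exact hGwn q hq) (hpq.trans hdκ) (hUU p hp q hq)
      have h2 : wn m d (F q p - G q p) ≤ C₀ * (C * B * M) * d ^ s := by
        refine hgrow (C * B * M) d univ (fun z => F q z - G q z) q p hCBM hd0 convex_univ
          ((hFT q hq).sub (hGPT q hq).1) (by
            simpa using (hFH q hq).sub ((hGPT q hq).hsOn ϑ univ)) trivial trivial ?_ hpq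
        rw [← sub_self (G q q)]
        exact (hFG q hq).sub (JEq.refl _)
      have h3 : wn m d (F p p - F q p) ≤ wn m d (G p p - G q p) + wn m d (F q p - G q p) := by
        rw [((hFG p hp).sub (JEq.refl (F q p))).wn_eq]
        have := wn_sub_le hd0.le (m := m) (G p p - G q p) (F q p - G q p)
        rwa [sub_sub_sub_cancel_right] at this
      have h4 : (d / κ) ^ s = κ⁻¹ ^ s * d ^ s := by
        rw [div_eq_inv_mul, Real.mul_rpow (by positivity) hd0.le]
      rw [h4] at h1
      have h5 := wn_mono hd0.le hdκ (m := m) (G p p - G q p)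
      have h6 : 0 ≤ C * B * M * d ^ s := by positivity
      calc wn m d (F p p - F q p) ≤ Cc * M * (κ⁻¹ ^ s * d ^ s) + C₀ * (C * B * M) * d ^ s := by
            linarith
        _ ≤ C * B * M * d ^ s + (Cc * M * (κ⁻¹ ^ s * d ^ s) + C₀ * (C * B * M) * d ^ s) := by
            linarith
        _ = Q * M * d ^ s := by rw [hQ]; ring)
  have hTH' : JEq m (T y) (H y) := by
    refine hTy.trans ((hFG y hyU).trans ?_)
    rw [hGy y hyU rfl]
    exact JEq.refl _
  obtain ⟨S, hS, hSH, hST⟩ := hglue (Cp * (Q * M)) r₀ x y T H (by positivity) hr₀0 hT hTH hH hyU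
    hTH'
  refine ⟨S, ⟨hS, hSH.mono_const ?_, ?_⟩, ?_⟩
  · have : 0 ≤ C * M := by positivity
    nlinarith
  · rintro e ⟨he, hex⟩
    have her : e ∈ Metric.ball x r₀ := by
      rw [Metric.mem_closedBall] at hex
      rw [Metric.mem_ball]
      have : 0 < c' * δ := by positivity
      linarith
    rw [(hST e her).coeff_zero]
    exact hTf e ⟨he, Metric.closedBall_subset_closedBall (by linarith)
      (Metric.ball_subset_closedBall her)⟩
  · rw [← hHu]
    exact jet_eq_jet_iff.2 ((hST y hyr).trans hTH')

theorem localExtension_zero (n m : ℕ) (hϑ : 0 < ϑ) (hϑ1 : ϑ ≤ 1) : LocalExtension n m ϑ 0 := by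
  have hbig : LocalExtension n m ϑ ((m + 1) * (idx n m).card + 1) := by
    refine ⟨1, 1, 1, le_rfl, le_rfl, one_pos, le_rfl, fun E f M δ x W _ _ _ hN => ?_⟩
    have := mu_le m (dg n m) W
    rw [Fintype.card_coe] at this
    omega
  generalize (m + 1) * (idx n m).card + 1 = N at hbig
  induction N with
  | zero => exact hbig
  | succ N ih => exact ih (hbig.of_succ hϑ hϑ1)

/-- The finiteness principle with prescribed jets. -/
theorem exists_extension (n m : ℕ) (hϑ : 0 < ϑ) (hϑ1 : ϑ ≤ 1) : ∃ (k : ℕ) (C : ℝ), 1 ≤ C ∧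
    ∀ (E : Finset (Sp n)) (f : Sp n → ℝ) (M : ℝ) (y : Sp n), 0 < M →
      ∀ u ∈ Gam m ϑ k E f M y, ∃ T, IsInt m ϑ (C * M) ↑E f T ∧ jet m (m + ϑ) 1 (T y) = u := by
  obtain ⟨k, C, c, -, hC1, hc0, -, h⟩ := localExtension_zero n m hϑ hϑ1
  refine ⟨k, C, hC1, fun E f M y hM u hu => ?_⟩
  obtain ⟨ρ, hρ⟩ := (E.finite_toSet.isBounded).subset_closedBall y
  obtain ⟨T, hT, hTu⟩ := h E f M ((|ρ| + 1) / c) y ⊥ hM (by positivity) (Good.bot _ _) (Nat.zero_le _)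
    (by
      intro w hw _
      rw [Submodule.mem_bot] at hw
      exact ⟨0, (dsig_cs _ _ _ _).zero, by simp [hw, (tol_pos n m).le]⟩) y
    (Metric.mem_closedBall_self (by positivity)) u hu
  refine ⟨T, hT.mono_set fun e he => ⟨he, Metric.closedBall_subset_closedBall ?_ (hρ he)⟩, hTu⟩
  rw [mul_div_cancel₀ _ hc0.ne']
  linarith [le_abs_self ρ]

end

section

variable {n m : ℕ} {ϑ : ℝ}

/-- A nonnegative tower satisfying the flatness bounds. -/
structure IsFlat (m : ℕ) (ϑ M C : ℝ) (T : Sp n → Poly n) : Prop where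
  tow : IsTow m T
  hs : HSOn m ϑ (C * M) univ T
  nonneg : ∀ x, 0 ≤ (T x).coeff 0
  bd : ∀ x, wn m 1 (T x) ≤ C * M
  flat : ∀ x δ, 0 < δ → (T x).coeff 0 ≤ M * δ ^ (m + ϑ) → wn m δ (T x) ≤ C * M * δ ^ (m + ϑ)

theorem lowFloor_lt {s : ℝ} (hs : 0 < s) : (lowFloor s : ℝ) < s := by
  have h := Nat.ceil_lt_add_one hs.le
  have h1 : 1 ≤ ⌈s⌉₊ := Nat.one_le_iff_ne_zero.2 (Nat.ceil_pos.2 hs).ne'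
  rw [lowFloor, Nat.cast_sub h1]
  push_cast
  linarith

theorem le_lowFloor_add_one (s : ℝ) : s ≤ lowFloor s + 1 := by
  have h := Nat.le_ceil s
  have h1 : ⌈s⌉₊ ≤ lowFloor s + 1 := by rw [lowFloor]; omega
  exact h.trans (by exact_mod_cast h1)

theorem wn_le_of_coeff_le {δ B : ℝ} {p : Poly n}
    (h : ∀ α : Fin n →₀ ℕ, α.degree ≤ m → |p.coeff α| * δ ^ α.degree ≤ B) :
    wn m δ p ≤ (idx n m).card * B := by
  rw [wn]
  refine (Finset.sum_le_card_nsmul _ _ B fun α hα => h α (mem_idx.1 hα)).trans ?_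
  rw [nsmul_eq_mul]

theorem enorm_div_rpow_le {s a b M : ℝ} {j : ℕ} (hj : 1 ≤ j) (hs : 0 < s) (hjs : (j : ℝ) < s)
    (hM : 0 ≤ M) (ha : 0 ≤ a) (hb : 0 ≤ b)
    (h : (ENNReal.ofReal a ^ s / ENNReal.ofReal b ^ (s - (j : ℝ))) ^ (1 / (j : ℝ)) ≤
      ENNReal.ofReal M) :
    a ^ s ≤ M ^ (j : ℝ) * b ^ (s - j) := by
  have hj0 : (0 : ℝ) < j := by exact_mod_cast hj
  have h1 := ENNReal.rpow_le_rpow h hj0.le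
  rw [← ENNReal.rpow_mul, one_div_mul_cancel hj0.ne', ENNReal.rpow_one] at h1
  rw [ENNReal.ofReal_rpow_of_nonneg ha hs.le, ENNReal.ofReal_rpow_of_nonneg hb (by linarith),
    ENNReal.ofReal_rpow_of_nonneg hM hj0.le] at h1
  have h2 : ENNReal.ofReal (a ^ s) ≤ ENNReal.ofReal (M ^ (j : ℝ)) * ENNReal.ofReal (b ^ (s - j)) :=
    (ENNReal.div_le_iff_le_mul (Or.inr ENNReal.ofReal_ne_top) (Or.inl ENNReal.ofReal_ne_top)).1 h1
  rw [← ENNReal.ofReal_mul (by positivity)] at h2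
  exact (ENNReal.ofReal_le_ofReal_iff (by positivity)).1 h2

theorem nnnorm_eq_ofReal {X : Type*} [NormedAddCommGroup X] (x : X) :
    (‖x‖₊ : ℝ≥0∞) = ENNReal.ofReal ‖x‖ := by
  rw [← enorm_eq_nnnorm, ofReal_norm]

theorem exists_isFlat_tay (n : ℕ) {s : ℝ} (hs : 0 < s) : ∃ C : ℝ, 1 ≤ C ∧ ∀ M, 0 < M →
    ∀ F : Sp n → ℝ, MemFs s univ F → fsNorm s univ F ≤ ENNReal.ofReal M →
      IsFlat (lowFloor s) (s - lowFloor s) M C (tay (lowFloor s) F) := by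
  set m := lowFloor s with hm
  have hms : (m : ℝ) < s := lowFloor_lt hs
  set C : ℝ := ((idx n m).card : ℝ) with hC
  have hC1 : 1 ≤ C := by
    have : 1 ≤ (idx n m).card := Finset.card_pos.2 ⟨0, zero_mem_idx⟩
    rw [hC]; exact_mod_cast this
  refine ⟨C, hC1, fun M hM F hF hFM => ?_⟩
  have hcd : ContDiff ℝ m F := by
    have := hF.1.1
    rw [contDiffOn_univ] at this
    exact this
  have hcs : csNorm s univ F ≤ ENNReal.ofReal M := le_self_add.trans hFM
  have hfl : flatSemi s univ F ≤ ENNReal.ofReal M := le_add_self.trans hFM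
  have hds : derivSup s univ F ≤ ENNReal.ofReal M := le_self_add.trans hcs
  have hho : holderSemi s univ F ≤ ENNReal.ofReal M := le_add_self.trans hcs
  have hn0 : ∀ x, 0 ≤ F x := fun x => hF.2.1 x (mem_univ x)
  have hD : ∀ j ≤ m, ∀ x, ‖iteratedFDeriv ℝ j F x‖ ≤ M := by
    intro j hj x
    simp only [derivSup, iSup_le_iff, iteratedFDerivWithin_univ] at hds
    have := hds j hj x (mem_univ x)
    rw [nnnorm_eq_ofReal] at this
    exact (ENNReal.ofReal_le_ofReal_iff hM.le).1 this
  have hH : ∀ x y, ‖iteratedFDeriv ℝ m F x - iteratedFDeriv ℝ m F y‖ ≤ M * ‖x - y‖ ^ (s - m) := by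
    intro x y
    rcases eq_or_ne x y with rfl | hxy
    · simp; positivity
    simp only [holderSemi, iSup_le_iff, iteratedFDerivWithin_univ] at hho
    have := hho x (mem_univ x) y (mem_univ y) hxy
    rw [nnnorm_eq_ofReal] at this
    have h2 := (ENNReal.div_le_iff_le_mul (Or.inr ENNReal.ofReal_ne_top)
      (Or.inl ENNReal.ofReal_ne_top)).1 this
    rw [← ENNReal.ofReal_mul hM.le] at h2
    exact (ENNReal.ofReal_le_ofReal_iff (by positivity)).1 h2
  have hFlat : ∀ j ≤ m, ∀ x δ, 0 < δ → F x ≤ M * δ ^ s →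
      ‖iteratedFDeriv ℝ j F x‖ * δ ^ j ≤ M * δ ^ s := by
    intro j hj x δ hδ hx
    rcases Nat.eq_zero_or_pos j with rfl | hj1
    · simpa [abs_of_nonneg (hn0 x)] using hx
    have hjs : (j : ℝ) < s := lt_of_le_of_lt (by exact_mod_cast hj) hms
    simp only [flatSemi, iSup_le_iff, iteratedFDerivWithin_univ] at hfl
    have := hfl j hj1 hj x (mem_univ x)
    rw [nnnorm_eq_ofReal] at this
    have h1 := enorm_div_rpow_le hj1 hs hjs hM.le (norm_nonneg _) (hn0 x) this
    have h2 : F x ^ (s - j) ≤ (M * δ ^ s) ^ (s - j) :=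
      Real.rpow_le_rpow (hn0 x) hx (by linarith)
    have h3 : M ^ (j : ℝ) * (M * δ ^ s) ^ (s - j) = (M * δ ^ (s - j)) ^ s := by
      rw [Real.mul_rpow hM.le (by positivity), Real.mul_rpow hM.le (by positivity), ← mul_assoc,
        ← Real.rpow_add hM, ← Real.rpow_mul hδ.le, ← Real.rpow_mul hδ.le]
      congr 2 <;> ring
    have h4 : ‖iteratedFDeriv ℝ j F x‖ ≤ M * δ ^ (s - j) := by
      refine (Real.rpow_le_rpow_iff (norm_nonneg _) (by positivity) hs).1 ?_
      rw [← h3]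
      exact h1.trans (mul_le_mul_of_nonneg_left h2 (by positivity))
    calc ‖iteratedFDeriv ℝ j F x‖ * δ ^ j ≤ M * δ ^ (s - j) * δ ^ j := by gcongr
      _ = M * δ ^ s := by
        rw [mul_assoc, ← Real.rpow_natCast, ← Real.rpow_add hδ, sub_add_cancel]
  refine ⟨isTow_tay hcd, ?_, ?_, ?_, ?_⟩
  · intro α hα x _ y _
    refine (abs_coeff_tay_sub_le hcd hα.le x y).trans ?_
    rw [hα]
    refine (hH x y).trans ?_
    have : M ≤ C * M := by nlinarith
    gcongr
  · intro x; rw [coeff_zero_tay]; exact hn0 x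
  · intro x
    refine wn_le_of_coeff_le fun α hα => ?_
    rw [one_pow, mul_one]
    exact (abs_coeff_tay_le hcd hα x).trans (hD _ hα x)
  · intro x δ hδ hx
    rw [coeff_zero_tay] at hx
    rw [add_sub_cancel] at hx ⊢
    rw [mul_assoc]
    refine wn_le_of_coeff_le fun α hα => ?_
    refine le_trans ?_ (hFlat _ hα x δ hδ hx)
    exact mul_le_mul_of_nonneg_right (abs_coeff_tay_le hcd hα x) (by positivity)

theorem IsTow.comp_add {T : Sp n → Poly n} (hT : IsTow m T) (h : Sp n) :
    IsTow m fun x => T (x + h) := by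
  intro α hα x
  have := (hT α hα (x + h)).comp x ((hasFDerivAt_id x).add_const h)
  simpa [Function.comp_def] using this

theorem le_of_forall_rpow {a B r : ℝ} (hr : 0 < r) (h : ∀ δ : ℝ, 0 < δ → a ≤ B * δ ^ r) : a ≤ 0 := by
  have h1 : Filter.Tendsto (fun δ : ℝ => B * δ ^ r) (nhdsWithin 0 (Ioi 0)) (nhds (B * 0 ^ r)) :=
    ((continuous_const.mul (Real.continuous_rpow_const hr.le)).tendsto 0).mono_left
      nhdsWithin_le_nhds
  rw [Real.zero_rpow hr.ne', mul_zero] at h1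
  refine ge_of_tendsto h1 ?_
  filter_upwards [self_mem_nhdsWithin] with δ hδ using h δ hδ

theorem exists_fsNorm_le (n : ℕ) {s C : ℝ} (hs : 0 < s) (hC : 1 ≤ C) : ∃ K : ℝ, 0 < K ∧
    ∀ M, 0 < M → ∀ T : Sp n → Poly n, IsFlat (lowFloor s) (s - lowFloor s) M C T →
      MemFs s univ (fun x => (T x).coeff 0) ∧
        fsNorm s univ (fun x => (T x).coeff 0) ≤ ENNReal.ofReal (K * M) := by
  set m := lowFloor s with hm
  have hms : (m : ℝ) < s := lowFloor_lt hs
  obtain ⟨C₁, hC₁1, hC₁⟩ := exists_iteratedFDeriv_le n m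
  set A : ℝ := C₁ * C with hA
  have hA1 : 1 ≤ A := one_le_mul_of_one_le_of_one_le hC₁1 hC
  refine ⟨A + A + A ^ s, by positivity, fun M hM T hT => ?_⟩
  set F : Sp n → ℝ := fun x => (T x).coeff 0 with hF
  have hϑ : 0 < s - m := by linarith
  have hct := fun α hα => hT.hs.continuous_top hϑ α hα
  obtain ⟨hcd, hder⟩ := hC₁ T hT.tow hct
  have hds : derivSup s univ F ≤ ENNReal.ofReal (A * M) := by
    simp only [derivSup, iSup_le_iff, iteratedFDerivWithin_univ]
    intro j hj x _
    rw [nnnorm_eq_ofReal]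
    refine ENNReal.ofReal_le_ofReal ?_
    rw [hA, mul_assoc]
    refine hder j hj x _ (by positivity) fun α hα => ?_
    have := abs_coeff_le_wn (m := m) zero_le_one (hα.trans_le hj) (T x)
    rw [one_pow, mul_one] at this
    exact this.trans (hT.bd x)
  have hho : holderSemi s univ F ≤ ENNReal.ofReal (A * M) := by
    simp only [holderSemi, iSup_le_iff, iteratedFDerivWithin_univ]
    intro x _ y _ hxy
    have hp : 0 < ‖x - y‖ := norm_pos_iff.2 (sub_ne_zero.2 hxy)
    rw [nnnorm_eq_ofReal, ENNReal.div_le_iff_le_mul (Or.inr ENNReal.ofReal_ne_top)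
      (Or.inl ENNReal.ofReal_ne_top), ← ENNReal.ofReal_mul (by positivity)]
    refine ENNReal.ofReal_le_ofReal ?_
    have hT' : IsTow m fun z => T z - T (z + (y - x)) := hT.tow.sub (hT.tow.comp_add _)
    have h1 := (hC₁ _ hT' (fun α hα => by
      simp only [MvPolynomial.coeff_sub]
      exact (hct α hα).sub ((hct α hα).comp (continuous_id.add continuous_const)))).2 m le_rfl x
      (C * M * ‖x - y‖ ^ (s - m)) (by positivity) (fun α hα => by
        have := hT.hs α hα x (mem_univ _) (x + (y - x)) (mem_univ _)
        simpa using this)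
    have h2 : (fun z => (T z - T (z + (y - x))).coeff 0) = F - fun z => F (z + (y - x)) := by
      funext z; simp [hF]
    have hcdF : ContDiff ℝ m F := hcd
    have hcdG : ContDiff ℝ m fun z => F (z + (y - x)) :=
      hcdF.comp (contDiff_id.add contDiff_const)
    rw [h2, iteratedFDeriv_sub_apply hcdF.contDiffAt hcdG.contDiffAt,
      iteratedFDeriv_comp_add_right] at h1
    simp only [add_sub_cancel] at h1
    rw [hA]
    calc _ ≤ _ := h1
      _ = _ := by ring
  have hfl : flatSemi s univ F ≤ ENNReal.ofReal (A ^ s * M) := by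
    simp only [flatSemi, iSup_le_iff, iteratedFDerivWithin_univ]
    intro j hj1 hj x _
    have hj0 : (0 : ℝ) < j := by exact_mod_cast hj1
    have hjs : (j : ℝ) < s := lt_of_le_of_lt (by exact_mod_cast hj) hms
    have key : ∀ δ : ℝ, 0 < δ → F x ≤ M * δ ^ s →
        ‖iteratedFDeriv ℝ j F x‖ ≤ A * M * δ ^ (s - j) := by
      intro δ hδ hx
      have h1 := hT.flat x δ hδ (by rwa [add_sub_cancel])
      rw [add_sub_cancel] at h1
      have h2 := hder j hj x (C * M * δ ^ (s - j)) (by positivity) fun α hα => by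
        have h3 := (abs_coeff_le_wn (m := m) hδ.le (hα.trans_le hj) (T x)).trans h1
        rw [hα] at h3
        rw [Real.rpow_sub hδ, Real.rpow_natCast, ← mul_div_assoc, le_div_iff₀ (by positivity)]
        exact h3
      rw [hA]
      calc _ ≤ _ := h2
        _ = _ := by ring
    rw [nnnorm_eq_ofReal]
    rcases (hT.nonneg x).eq_or_lt with h0 | h0
    · have h1 : ‖iteratedFDeriv ℝ j F x‖ ≤ 0 := le_of_forall_rpow (sub_pos.2 hjs) fun δ hδ =>
        key δ hδ (by rw [hF]; dsimp only; rw [← h0]; positivity)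
      rw [le_antisymm h1 (norm_nonneg _), ENNReal.ofReal_zero, ENNReal.zero_rpow_of_pos hs,
        ENNReal.zero_div, ENNReal.zero_rpow_of_pos (by positivity)]
      exact bot_le
    · have hF0 : 0 < F x := h0
      set δ : ℝ := (F x / M) ^ (1 / s) with hδ
      have hδ0 : 0 < δ := by positivity
      have hFδ : F x = M * δ ^ s := by
        rw [hδ, ← Real.rpow_mul (by positivity), one_div_mul_cancel hs.ne', Real.rpow_one]
        field_simp
      have h1 := key δ hδ0 hFδ.le
      have h2 : ‖iteratedFDeriv ℝ j F x‖ ^ s ≤ A ^ s * (M ^ (j : ℝ) * F x ^ (s - j)) := by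
        refine (Real.rpow_le_rpow (norm_nonneg _) h1 hs.le).trans (le_of_eq ?_)
        rw [hFδ, Real.mul_rpow (x := M) hM.le (by positivity), Real.mul_rpow (by positivity)
          (by positivity), Real.mul_rpow (by positivity) hM.le, ← mul_assoc (M ^ _),
          ← Real.rpow_add hM, ← Real.rpow_mul hδ0.le, ← Real.rpow_mul hδ0.le, mul_assoc]
        congr 3 <;> ring
      rw [ENNReal.ofReal_rpow_of_nonneg (norm_nonneg _) hs.le,
        ENNReal.ofReal_rpow_of_nonneg hF0.le (by linarith),
        ← ENNReal.ofReal_div_of_pos (by positivity),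
        ENNReal.ofReal_rpow_of_nonneg (by positivity) (by positivity)]
      refine ENNReal.ofReal_le_ofReal ?_
      have h3 : ‖iteratedFDeriv ℝ j F x‖ ^ s / F x ^ (s - (j : ℝ)) ≤ (A ^ s * M) ^ (j : ℝ) := by
        rw [div_le_iff₀ (by positivity), Real.mul_rpow (by positivity) hM.le, mul_assoc]
        refine h2.trans (mul_le_mul_of_nonneg_right ?_ (by positivity))
        have : 1 ≤ A ^ s := Real.one_le_rpow hA1 hs.le
        exact Real.self_le_rpow_of_one_le this (by exact_mod_cast hj1)
      calc _ ≤ ((A ^ s * M) ^ (j : ℝ)) ^ (1 / (j : ℝ)) :=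
            Real.rpow_le_rpow (by positivity) h3 (by positivity)
        _ = _ := by rw [← Real.rpow_mul (by positivity), mul_one_div_cancel hj0.ne', Real.rpow_one]
  have hcs : csNorm s univ F ≤ ENNReal.ofReal (A * M + A * M) := by
    rw [csNorm, ENNReal.ofReal_add (by positivity) (by positivity)]
    exact add_le_add hds hho
  refine ⟨⟨⟨?_, ne_top_of_le_ne_top ENNReal.ofReal_ne_top hcs⟩, fun x _ => hT.nonneg x,
    ne_top_of_le_ne_top ENNReal.ofReal_ne_top hfl⟩, ?_⟩
  · rw [contDiffOn_univ]; exact hcd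
  · have : (A + A + A ^ s) * M = (A * M + A * M) + A ^ s * M := by ring
    rw [this, fsNorm, ENNReal.ofReal_add (by positivity) (by positivity)]
    exact add_le_add hcs hfl

end

section

variable {n m : ℕ} {ϑ : ℝ}

/-- The size of a flat function varies slowly. -/
theorem exists_isFlat_compare (n m : ℕ) {C : ℝ} (hϑ : 0 < ϑ) (hϑ1 : ϑ ≤ 1) (hC : 1 ≤ C) :
    ∃ Q : ℝ, 1 ≤ Q ∧ ∀ (M δ : ℝ) (T : Sp n → Poly n) (x y : Sp n), 0 < M → 0 < δ →
      IsFlat m ϑ M C T → (T x).coeff 0 ≤ M * δ ^ (m + ϑ) → ‖y - x‖ ≤ δ →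
        (T y).coeff 0 ≤ Q * M * δ ^ (m + ϑ) := by
  obtain ⟨C₁, hC₁1, hC₁⟩ := exists_growth n m
  refine ⟨C + C₁ * (C + C), by nlinarith, fun M δ T x y hM hδ hT hx hxy => ?_⟩
  have h1 := hT.flat x δ hδ hx
  have h2 := hC₁ ϑ (C * M) δ _ univ T x y hϑ hϑ1 (by positivity) hδ convex_univ hT.tow hT.hs
    (mem_univ _) (mem_univ _) hxy h1
  have h3 : (‖y - x‖ / δ) ^ ϑ ≤ 1 :=
    Real.rpow_le_one (by positivity) ((div_le_one hδ).2 hxy) hϑ.le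
  have h4 := h2.trans (mul_le_of_le_one_right (by positivity) h3)
  have h5 := (le_abs_self _).trans (abs_coeff_zero_le_wn (m := m) hδ.le (T y))
  have h6 := wn_le_add_sub (m := m) hδ.le (T y) (T x)
  calc _ ≤ _ := h5.trans h6
    _ ≤ _ := add_le_add h1 h4
    _ = _ := by ring

theorem exists_near_bound (n m : ℕ) {C : ℝ} (hϑ : 0 < ϑ) (hϑ1 : ϑ ≤ 1) (hC : 1 ≤ C) :
    ∃ c : ℝ, 0 < c ∧ c ≤ 1 / 100 ∧ ∀ (M δ : ℝ) (T : Sp n → Poly n) (x y : Sp n), 0 < M → 0 < δ →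
      IsTow m T → HSOn m ϑ (C * M) univ T → wn m δ (T x) ≤ C * M * δ ^ (m + ϑ) → ‖y - x‖ ≤ c * δ →
        wn m δ (T y - T x) ≤ M * δ ^ (m + ϑ) / 2 := by
  obtain ⟨C₁, hC₁1, hC₁⟩ := exists_growth n m
  refine ⟨min (1 / 100) ((1 / (4 * C₁ * C)) ^ (1 / ϑ)), by positivity, min_le_left _ _,
    fun M δ T x y hM hδ hT hTs hx hxy => ?_⟩
  set c := min (1 / 100) ((1 / (4 * C₁ * C)) ^ (1 / ϑ)) with hc
  have hc1 : c ≤ 1 / 100 := min_le_left _ _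
  have h2 := hC₁ ϑ (C * M) δ _ univ T x y hϑ hϑ1 (by positivity) hδ convex_univ hT hTs
    (mem_univ _) (mem_univ _) (hxy.trans (by nlinarith)) hx
  have h3 : (‖y - x‖ / δ) ^ ϑ ≤ 1 / (4 * C₁ * C) := by
    have : ‖y - x‖ / δ ≤ (1 / (4 * C₁ * C)) ^ (1 / ϑ) :=
      ((div_le_iff₀ hδ).2 hxy).trans (min_le_right _ _)
    refine (Real.rpow_le_rpow (by positivity) this hϑ.le).trans (le_of_eq ?_)
    rw [← Real.rpow_mul (by positivity), one_div_mul_cancel hϑ.ne', Real.rpow_one]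
  refine h2.trans ((mul_le_mul_of_nonneg_left h3 (by positivity)).trans (le_of_eq ?_))
  field_simp
  ring

theorem exists_flat_extension (n m : ℕ) {C : ℝ} (hϑ : 0 < ϑ) (hϑ1 : ϑ ≤ 1) (hC : 1 ≤ C) :
    ∃ (k : ℕ) (C' : ℝ), C ≤ C' ∧ ∀ (E : Finset (Sp n)) (f : Sp n → ℝ) (M δ : ℝ) (y : Sp n),
      0 < M → 0 < δ → y ∈ E → f y ≤ M * δ ^ (m + ϑ) →
      (∀ S ⊆ E, S.card ≤ k → ∃ T, IsFlat m ϑ M C T ∧ ∀ e ∈ S, (T e).coeff 0 = f e) →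
      ∃ T, IsInt m ϑ (C' * M) ↑E f T ∧ wn m δ (T y) ≤ C' * M * δ ^ (m + ϑ) := by
  classical
  obtain ⟨k, C₁, hC₁1, hC₁⟩ := exists_extension n m hϑ hϑ1
  refine ⟨((idx n m).card + 1) * k + 1, C₁ * C, by nlinarith, fun E f M δ y hM hδ hy hfy H => ?_⟩
  set B := C * M * δ ^ (m + ϑ) with hB
  have hB0 : 0 ≤ B := by positivity
  set K : Finset (Sp n) → Set (XX n m) := fun S =>
    {v | ∃ T, IsInt m ϑ (C * M) (S : Set (Sp n)) f T ∧ jet m (m + ϑ) 1 (T y) = v ∧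
      wn m δ (T y) ≤ B} with hK
  obtain ⟨u, hu⟩ := Convex.helly_theorem' (𝕜 := ℝ) (F := K)
    (s := E.powerset.filter fun S => S.card ≤ k) (by
      rintro S _ v ⟨T, hT, rfl, hTu⟩ v' ⟨T', hT', rfl, hTu'⟩ a b ha hb hab
      refine ⟨_, hT.convexComb hT' ha hb hab, by simp, ?_⟩
      refine (wn_add_le hδ.le _ _).trans ?_
      rw [wn_smul, wn_smul, abs_of_nonneg ha, abs_of_nonneg hb]
      calc _ ≤ a * B + b * B := by gcongr
        _ = B := by rw [← add_mul, hab, one_mul]) (by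
      intro I hI hIc
      rw [finrank_XX] at hIc
      have hsub : I.biUnion id ⊆ E := by
        intro e he
        obtain ⟨S, hS, heS⟩ := Finset.mem_biUnion.1 he
        exact Finset.mem_powerset.1 (Finset.mem_filter.1 (hI hS)).1 heS
      have hcard : (I.biUnion id).card ≤ ((idx n m).card + 1) * k :=
        (Finset.card_biUnion_le_card_mul I id k fun S hS =>
          (Finset.mem_filter.1 (hI hS)).2).trans (Nat.mul_le_mul_right _ hIc)
      obtain ⟨T, hT, hTf⟩ := H (insert y (I.biUnion id)) (Finset.insert_subset hy hsub)
        ((Finset.card_insert_le _ _).trans (by omega))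
      have hTy := hT.flat y δ hδ (by rwa [hTf y (Finset.mem_insert_self _ _)])
      refine ⟨jet m (m + ϑ) 1 (T y), mem_iInter₂.2 fun S hS => ⟨T, ⟨hT.tow, hT.hs, ?_⟩, rfl, hTy⟩⟩
      intro e he
      exact hTf e (Finset.mem_insert_of_mem (Finset.mem_biUnion.2 ⟨S, hS, he⟩)))
  rw [mem_iInter₂] at hu
  obtain ⟨T, hT, hTu⟩ := hC₁ E f (C * M) y (by positivity) u fun S hS hk => by
    obtain ⟨T, hT, hTu, -⟩ := hu S (Finset.mem_filter.2 ⟨Finset.mem_powerset.2 hS, hk⟩)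
    exact ⟨T, hT, hTu⟩
  obtain ⟨T', -, hTu', hw⟩ := hu ∅ (by simp)
  refine ⟨T, by rwa [mul_assoc], ?_⟩
  have hj : JEq m (T y) (T' y) := jet_eq_jet_iff.1 (hTu.trans hTu'.symm)
  rw [hj.wn_eq]
  refine hw.trans ?_
  rw [hB, mul_assoc, mul_assoc, mul_assoc C₁]
  exact le_mul_of_one_le_left (by positivity) hC₁1

end

section

variable {n m : ℕ} {ϑ : ℝ}

theorem wn_shrink_le {τ δ : ℝ} (hτ : 0 ≤ τ) (hτ1 : τ ≤ 1) (hδ : 0 ≤ δ) (p : Poly n) :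
    wn m (τ * δ) p ≤ |p.coeff 0| + τ * wn m δ p := by
  classical
  have h0 : |p.coeff 0| = ∑ α ∈ idx n m, if α = 0 then |p.coeff 0| else 0 := by
    rw [Finset.sum_ite_eq' (idx n m) 0]; simp [zero_mem_idx]
  rw [h0, wn, wn, Finset.mul_sum, ← Finset.sum_add_distrib]
  refine Finset.sum_le_sum fun α _ => ?_
  split_ifs with h
  · subst h
    have : 0 ≤ τ * |p.coeff 0| := by positivity
    simpa using this
  · have hd : α.degree ≠ 0 := by rwa [Ne, Finsupp.degree_eq_zero_iff]
    have : τ ^ α.degree ≤ τ := pow_le_of_le_one hτ hτ1 hd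
    rw [mul_pow, zero_add]
    calc |p.coeff α| * (τ ^ α.degree * δ ^ α.degree) = τ ^ α.degree * (|p.coeff α| * δ ^ α.degree) := by
          ring
      _ ≤ _ := mul_le_mul_of_nonneg_right this (by positivity)

theorem wn_prod_le {ι : Type*} {δ B : ℝ} (hδ : 0 ≤ δ) (hB : 0 ≤ B) (t : Finset ι)
    {f : ι → Poly n} (h : ∀ i ∈ t, wn m δ (f i) ≤ B) : wn m δ (∏ i ∈ t, f i) ≤ B ^ t.card := by
  classical
  induction t using Finset.induction_on with
  | empty => simp [wn_one]
  | insert a t ha ih =>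
    rw [Finset.prod_insert ha, Finset.card_insert_of_notMem ha, pow_succ']
    refine (wn_mul_le hδ _ _).trans ?_
    exact mul_le_mul (h a (Finset.mem_insert_self _ _))
      (ih fun i hi => h i (Finset.mem_insert_of_mem hi)) (wn_nonneg hδ _) hB

theorem coeff_zero_prod {ι : Type*} (t : Finset ι) (f : ι → Poly n) :
    (∏ i ∈ t, f i).coeff 0 = ∏ i ∈ t, (f i).coeff 0 := by
  exact map_prod MvPolynomial.constantCoeff f t

theorem coeff_zero_pow (p : Poly n) (N : ℕ) : (p ^ N).coeff 0 = p.coeff 0 ^ N := by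
  simpa [MvPolynomial.constantCoeff_eq] using map_pow MvPolynomial.constantCoeff p N

theorem coeff_zero_one : (1 : Poly n).coeff 0 = 1 := by
  simp

theorem coeff_zero_pou_nonneg {k : ℕ} {ψ : Fin k → Sp n → Poly n} {x : Sp n}
    (h0 : ∀ i, 0 ≤ (ψ i x).coeff 0) (h1 : ∀ i, (ψ i x).coeff 0 ≤ 1) (i : Fin k) :
    0 ≤ (pou ψ i x).coeff 0 := by
  rw [pou, coeff_zero_mul, coeff_zero_prod]
  refine mul_nonneg (h0 i) (Finset.prod_nonneg fun j _ => ?_)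
  rw [MvPolynomial.coeff_sub, coeff_zero_one]
  linarith [h1 j]

theorem le_coeff_zero_sum_pou {k : ℕ} {ψ : Fin k → Sp n → Poly n} {x : Sp n}
    (h0 : ∀ i, 0 ≤ (ψ i x).coeff 0) (h1 : ∀ i, (ψ i x).coeff 0 ≤ 1) (i : Fin k) :
    (ψ i x).coeff 0 ≤ ∑ j, (pou ψ j x).coeff 0 := by
  rw [← MvPolynomial.coeff_sum, sum_pou, MvPolynomial.coeff_sub, coeff_zero_prod, coeff_zero_one]
  have : ∏ j, (1 - ψ j x).coeff 0 ≤ 1 - (ψ i x).coeff 0 := by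
    rw [← Finset.mul_prod_erase _ _ (Finset.mem_univ i), MvPolynomial.coeff_sub, coeff_zero_one]
    refine mul_le_of_le_one_right (by linarith [h1 i]) (Finset.prod_le_one ?_ ?_)
    · intro j _
      rw [MvPolynomial.coeff_sub, coeff_zero_one]; linarith [h1 j]
    · intro j _
      rw [MvPolynomial.coeff_sub, coeff_zero_one]; linarith [h0 j]
  linarith

set_option maxHeartbeats 1600000 in
theorem exists_flat_at (n m N : ℕ) {A C : ℝ} (hA : 1 ≤ A) (hC : 1 ≤ C) : ∃ K : ℝ, 1 ≤ K ∧
    ∀ (k : ℕ) (ϑ M δ : ℝ) (x : Sp n) (φ : Fin k → Sp n → Poly n) (H : Fin k → Poly n)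
      (S : Finset (Fin k)), 0 < ϑ → ϑ ≤ 1 → 0 < M → 0 < δ → S.card ≤ N →
      (∀ i ∉ S, JEq m (φ i x) 0) → (∀ i ∈ S, wn m δ (φ i x) ≤ A) →
      (∀ i, 0 ≤ (φ i x).coeff 0) → (∀ i, (φ i x).coeff 0 ≤ 1) →
      (∀ i ∈ S, wn m δ (H i) ≤ C * M * δ ^ (m + ϑ)) →
      (∀ i ∈ S, M * δ ^ (m + ϑ) ≤ 2 * (H i).coeff 0) →
      0 ≤ (∑ i, pou (fun j z => φ j z ^ (m + 1)) i x * H i).coeff 0 ∧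
      (∀ δ', δ ≤ δ' → wn m δ' (∑ i, pou (fun j z => φ j z ^ (m + 1)) i x * H i) ≤
        K * M * δ' ^ (m + ϑ)) ∧
      ∀ δ', 0 < δ' → (∑ i, pou (fun j z => φ j z ^ (m + 1)) i x * H i).coeff 0 ≤
        M * δ' ^ (m + ϑ) → wn m δ' (∑ i, pou (fun j z => φ j z ^ (m + 1)) i x * H i) ≤
          K * M * δ' ^ (m + ϑ) := by
  set B : ℝ := (1 + A) ^ (m + 1) with hB
  have hB1 : 1 ≤ B := one_le_pow₀ (by linarith)
  set K₀ : ℝ := N * (B * (1 + B) ^ N * C) with hK₀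
  have hK₀0 : 0 ≤ K₀ := by positivity
  refine ⟨2 * K₀ + 1, by linarith, ?_⟩
  intro k ϑ M δ x φ H S hϑ hϑ1 hM hδ hSN hout hφ hφ0 hφ1 hH hHl
  set ψ : Fin k → Sp n → Poly n := fun j z => φ j z ^ (m + 1) with hψ
  set P := ∑ i, pou ψ i x * H i with hP
  set s : ℝ := m + ϑ with hs
  have hψz : ∀ i ∉ S, JEq m (ψ i x) 0 := fun i hi => by
    have := (hout i hi).pow (m + 1)
    rwa [zero_pow (Nat.succ_ne_zero m)] at this
  have hψe : ∀ i, (ψ i x).coeff 0 = (φ i x).coeff 0 ^ (m + 1) := fun i => coeff_zero_pow _ _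
  have hψ0 : ∀ i, 0 ≤ (ψ i x).coeff 0 := fun i => by rw [hψe]; exact pow_nonneg (hφ0 i) _
  have hψ1 : ∀ i, (ψ i x).coeff 0 ≤ 1 := fun i => by
    rw [hψe]; exact pow_le_one₀ (hφ0 i) (hφ1 i)
  have hp0 : ∀ i, 0 ≤ (pou ψ i x).coeff 0 := coeff_zero_pou_nonneg hψ0 hψ1
  -- lower bound
  have hlow : ∀ i, (φ i x).coeff 0 ^ (m + 1) * (M * δ ^ s) ≤ 2 * P.coeff 0 := by
    intro i
    rw [← hψe]
    refine (mul_le_mul_of_nonneg_right (le_coeff_zero_sum_pou hψ0 hψ1 i) (by positivity)).trans ?_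
    rw [hP, MvPolynomial.coeff_sum, Finset.sum_mul, Finset.mul_sum]
    refine Finset.sum_le_sum fun j _ => ?_
    rw [coeff_zero_mul]
    by_cases hj : j ∈ S
    · have := mul_le_mul_of_nonneg_left (hHl j hj) (hp0 j)
      linarith
    · have := (pou_jeq_zero (hψz j hj)).coeff_zero
      rw [this]; simp
  -- upper bound
  have hup : ∀ τ : ℝ, 0 ≤ τ → τ ≤ 1 → (∀ i, (φ i x).coeff 0 ≤ τ) →
      wn m (τ * δ) P ≤ K₀ * M * (τ ^ (m + 1) * δ ^ s) := by
    intro τ hτ hτ1 hle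
    have hτδ : 0 ≤ τ * δ := by positivity
    have h1 : ∀ i ∈ S, wn m (τ * δ) (ψ i x) ≤ B * τ ^ (m + 1) := by
      intro i hi
      refine (wn_pow_le hτδ _ _).trans ?_
      rw [hB, ← mul_pow]
      refine pow_le_pow_left₀ (wn_nonneg hτδ _) ((wn_shrink_le hτ hτ1 hδ.le _).trans ?_) _
      rw [abs_of_nonneg (hφ0 i)]
      have := mul_le_mul_of_nonneg_left (hφ i hi) hτ
      linarith [hle i]
    have h2 : ∀ i ∈ S, wn m (τ * δ) (1 - ψ i x) ≤ 1 + B := by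
      intro i hi
      refine (wn_sub_le hτδ _ _).trans ?_
      rw [wn_one]
      have := mul_le_of_le_one_right (zero_le_one.trans hB1) (pow_le_one₀ hτ hτ1 (n := m + 1))
      linarith [h1 i hi]
    rw [hP, (sum_pou_mul_jeq S hψz H).wn_eq]
    refine (wn_sum_le hτδ _ _).trans ?_
    have h3 : ∀ i ∈ S, wn m (τ * δ) ((ψ i x * ∏ j ∈ S.filter (· < i), (1 - ψ j x)) * H i) ≤
        B * τ ^ (m + 1) * (1 + B) ^ N * (C * M * δ ^ s) := by
      intro i hi
      refine (wn_mul_le hτδ _ _).trans ?_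
      have h4 : wn m (τ * δ) (∏ j ∈ S.filter (· < i), (1 - ψ j x)) ≤ (1 + B) ^ N := by
        refine (wn_prod_le hτδ (by linarith) _ fun j hj => h2 j (Finset.mem_filter.1 hj).1).trans ?_
        exact pow_le_pow_right₀ (by linarith) ((Finset.card_filter_le _ _).trans hSN)
      have h5 : wn m (τ * δ) (H i) ≤ C * M * δ ^ s :=
        (wn_mono hτδ (mul_le_of_le_one_left hδ.le hτ1) _).trans (hH i hi)
      refine mul_le_mul ((wn_mul_le hτδ _ _).trans ?_) h5 (wn_nonneg hτδ _) (by positivity)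
      exact mul_le_mul (h1 i hi) h4 (wn_nonneg hτδ _) (by positivity)
    refine (Finset.sum_le_card_nsmul _ _ _ h3).trans ?_
    rw [nsmul_eq_mul]
    have h6 : (S.card : ℝ) ≤ N := by exact_mod_cast hSN
    refine (mul_le_mul_of_nonneg_right h6 (by positivity)).trans (le_of_eq ?_)
    rw [hK₀]; ring
  have hbig : ∀ δ', δ ≤ δ' → wn m δ' P ≤ K₀ * M * δ' ^ s := by
    intro δ' hδ'
    have h0 : 0 < δ' := hδ.trans_le hδ'
    have h1 := wn_scale_le (m := m) hδ.le ((one_le_div hδ).2 hδ') P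
    rw [div_mul_cancel₀ _ hδ.ne'] at h1
    have h2 := hup 1 zero_le_one le_rfl hφ1
    rw [one_mul, one_pow, one_mul] at h2
    refine h1.trans ((mul_le_mul_of_nonneg_left h2 (by positivity)).trans ?_)
    rw [hs, Real.rpow_add hδ, Real.rpow_add h0, Real.rpow_natCast, Real.rpow_natCast]
    have h3 : δ ^ ϑ ≤ δ' ^ ϑ := Real.rpow_le_rpow hδ.le hδ' hϑ.le
    calc (δ' / δ) ^ m * (K₀ * M * (δ ^ m * δ ^ ϑ)) = K₀ * M * (δ' ^ m * δ ^ ϑ) := by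
          rw [div_pow]; field_simp
      _ ≤ _ := mul_le_mul_of_nonneg_left (mul_le_mul_of_nonneg_left h3 (by positivity)) (by positivity)
  have hKmono : ∀ r : ℝ, 0 ≤ r → K₀ * M * r ≤ (2 * K₀ + 1) * M * r := fun r hr => by
    have : 0 ≤ M * r := by positivity
    nlinarith
  refine ⟨?_, fun δ' hδ' => (hbig δ' hδ').trans (hKmono _ (by
    have := hδ.trans_le hδ'
    positivity)), fun δ' h0 hF => ?_⟩
  · rw [hP, MvPolynomial.coeff_sum]
    refine Finset.sum_nonneg fun j _ => ?_
    rw [coeff_zero_mul]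
    by_cases hj : j ∈ S
    · have : 0 ≤ M * δ ^ s := by positivity
      exact mul_nonneg (hp0 j) (by linarith [hHl j hj])
    · have := (pou_jeq_zero (hψz j hj)).coeff_zero
      rw [this]; simp
  · rcases le_total δ δ' with hδ' | hδ'
    · exact (hbig δ' hδ').trans (hKmono _ (by positivity))
    set τ := δ' / δ with hτ
    have hτ0 : 0 < τ := by positivity
    have hτ1 : τ ≤ 1 := (div_le_one hδ).2 hδ'
    have hτδ : τ * δ = δ' := div_mul_cancel₀ _ hδ.ne'
    by_cases hall : ∀ i, (φ i x).coeff 0 ≤ τ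
    · have h1 := hup τ hτ0.le hτ1 hall
      rw [hτδ] at h1
      refine h1.trans (le_trans ?_ (hKmono _ (by positivity)))
      refine mul_le_mul_of_nonneg_left ?_ (by positivity)
      rw [← hτδ, Real.mul_rpow hτ0.le hδ.le]
      refine mul_le_mul_of_nonneg_right ?_ (by positivity)
      rw [← Real.rpow_natCast]
      refine Real.rpow_le_rpow_of_exponent_ge hτ0 hτ1 ?_
      push_cast; linarith
    · push Not at hall
      obtain ⟨i₁, hi₁⟩ := hall
      obtain ⟨i, -, hi⟩ := Finset.exists_max_image Finset.univ (fun i => (φ i x).coeff 0)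
        ⟨i₁, Finset.mem_univ _⟩
      have h1 := hup _ (hφ0 i) (hφ1 i) fun j => hi j (Finset.mem_univ j)
      have h2 : δ' ≤ (φ i x).coeff 0 * δ := by
        rw [← hτδ]
        exact mul_le_mul_of_nonneg_right (hi₁.le.trans (hi i₁ (Finset.mem_univ _))) hδ.le
      have h3 := hlow i
      refine (wn_mono h0.le h2 P).trans (h1.trans ?_)
      have h4 : 0 ≤ M * δ' ^ s := by positivity
      calc _ = K₀ * ((φ i x).coeff 0 ^ (m + 1) * (M * δ ^ s)) := by ring
        _ ≤ K₀ * (2 * (M * δ' ^ s)) := mul_le_mul_of_nonneg_left (by linarith) hK₀0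
        _ ≤ _ := by nlinarith

end

section

variable {n m : ℕ} {ϑ : ℝ}

set_option maxHeartbeats 1600000 in
/-- Gluing of local interpolants into a flat nonnegative one. -/
theorem exists_flat_glue (n m : ℕ) {C : ℝ} (hϑ : 0 < ϑ) (hϑ1 : ϑ ≤ 1) (hC : 1 ≤ C) :
    ∃ K : ℝ, 1 ≤ K ∧ ∀ (M ϱ₀ : ℝ) (U E : Set (Sp n)) (f ϱ : Sp n → ℝ) (F : Sp n → Sp n → Poly n),
      0 < M → Bornology.IsBounded U → 0 < ϱ₀ → (∀ p ∈ U, ϱ₀ ≤ ϱ p) → (∀ p ∈ U, ϱ p ≤ 1) →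
      (∀ p ∈ U, ∀ q ∈ U, ϱ p ≤ ϱ q + ‖p - q‖ / 100) → (∀ p ∈ U, IsTow m (F p)) →
      (∀ p ∈ U, HSOn m ϑ (C * M) univ (F p)) →
      (∀ p ∈ U, ∀ x, ‖x - p‖ ≤ ϱ p → M * ϱ p ^ (m + ϑ) ≤ 2 * (F p x).coeff 0) →
      (∀ p ∈ U, ∀ x, ‖x - p‖ ≤ ϱ p → wn m (ϱ p) (F p x) ≤ C * M * ϱ p ^ (m + ϑ)) →
      (∀ p ∈ U, ∀ e ∈ E, (F p e).coeff 0 = f e) → (∀ e ∈ E, e ∉ U → f e = 0) →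
      ∃ T : Sp n → Poly n, IsFlat m ϑ M K T ∧ ∀ e ∈ E, (T e).coeff 0 = f e := by
  obtain ⟨A, hA1, hA⟩ := exists_bump n m
  obtain ⟨N, hN⟩ := exists_card_le_of_separated n 10
  have hA2 : 1 ≤ (2 * A) ^ (m + 1) := one_le_pow₀ (by linarith)
  obtain ⟨C₁, hC₁1, hC₁⟩ := exists_sc_sum_pou n m N _ hA2
  set s : ℝ := m + ϑ with hs
  have hs0 : 0 ≤ s := by positivity
  set Q : ℝ := C * 41 ^ s with hQ
  have h41 : 1 ≤ (41 : ℝ) ^ s := Real.one_le_rpow (by norm_num) hs0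
  have hQC : C ≤ Q := le_mul_of_one_le_right (by linarith) h41
  have hQ1 : 1 ≤ Q := hC.trans hQC
  obtain ⟨C₂, hC₂1, hC₂⟩ := exists_flat_at n m N hA1 hQ1
  have hK : 0 ≤ C₁ * Q := by positivity
  refine ⟨2 * (C₁ * Q) + C₂, by linarith, ?_⟩
  intro M ϱ₀ U E f ϱ F hM hUb hϱ₀ hϱ hϱ1 hL hF hFH hlow hup hval hzero
  obtain ⟨k, b, hbU, hsep, hcov⟩ := exists_slow_cover hUb hϱ₀ hϱ hL
  have hϱpos : ∀ p ∈ U, 0 < ϱ p := fun p hp => hϱ₀.trans_le (hϱ p hp)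
  choose φ hφT hφS hφ1 hφ0 hφ01 using fun i => hA ϑ hϑ hϑ1 (b i) (ϱ (b i) / 10)
    (by have := hϱpos _ (hbU i); positivity)
  have hφ1' : ∀ i, ∀ x, ‖x - b i‖ < ϱ (b i) / 10 → JEq m (φ i x) 1 := fun i x hx =>
    JEq.of_wn (hφ1 i x (by rwa [Metric.mem_ball, dist_eq_norm]) 1)
  have hφ0' : ∀ i, ∀ x, ϱ (b i) / 5 < ‖x - b i‖ → JEq m (φ i x) 0 := fun i x hx =>
    JEq.of_wn (by
      rw [sub_zero]
      exact hφ0 i x (by rw [Metric.mem_closedBall, dist_eq_norm]; linarith) 1)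
  set ψ : Fin k → Sp n → Poly n := fun j z => φ j z ^ (m + 1) with hψ
  have hψ0' : ∀ i, ∀ x, ϱ (b i) / 5 < ‖x - b i‖ → JEq m (ψ i x) 0 := fun i x hx => by
    have := (hφ0' i x hx).pow (m + 1)
    rwa [zero_pow (Nat.succ_ne_zero m)] at this
  set T : Sp n → Poly n := fun x => ∑ i, pou ψ i x * F (b i) x with hTdef
  have hT : IsTow m T := IsTow.sum _ fun i _ =>
    (isTow_pou (fun j => (hφT j).pow _) i).mul (hF _ (hbU i))
  have hinact : ∀ x, (∀ i, ϱ (b i) / 5 < ‖x - b i‖) → JEq m (T x) 0 := by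
    intro x hx
    have := JEq.sum Finset.univ (f := fun i => pou ψ i x * F (b i) x) (g := fun _ => 0) fun i _ => by
      simpa using (pou_jeq_zero (hψ0' i x (hx i))).mul (JEq.refl (m := m) (F (b i) x))
    simpa [hTdef] using this
  have hact : ∀ x i₀, ‖x - b i₀‖ ≤ ϱ (b i₀) / 5 → ∃ δ, 0 < δ ∧ δ ≤ 1 ∧
      SC m ϑ δ (C₁ * (Q * M * δ ^ s)) (Metric.closedBall x δ) T ∧ 0 ≤ (T x).coeff 0 ∧
      (∀ δ', δ ≤ δ' → wn m δ' (T x) ≤ C₂ * M * δ' ^ s) ∧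
      ∀ δ', 0 < δ' → (T x).coeff 0 ≤ M * δ' ^ s → wn m δ' (T x) ≤ C₂ * M * δ' ^ s := by
    intro x i₀ hi₀
    have hr0 := hϱpos _ (hbU i₀)
    set δ := ϱ (b i₀) / 40 with hδ
    have hδ0 : 0 < δ := by positivity
    set S : Finset (Fin k) := Finset.univ.filter fun i => ‖b i - x‖ ≤ ϱ (b i) / 5 + δ with hS
    have hSn : ∀ i ∈ S, ‖b i - x‖ ≤ 10 * δ ∧ 38 * δ ≤ ϱ (b i) ∧ ϱ (b i) ≤ 41 * δ := by
      intro i hi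
      have h1 := (Finset.mem_filter.1 hi).2
      have h2 := hL _ (hbU i) _ (hbU i₀)
      have h3 := hL _ (hbU i₀) _ (hbU i)
      have h4 := norm_sub_le_norm_sub_add_norm_sub (b i) x (b i₀)
      rw [norm_sub_rev (b i₀) (b i)] at h3
      refine ⟨?_, ?_, ?_⟩ <;> linarith
    have hcard : S.card ≤ N := hN S b x δ hδ0 (fun i hi => (hSn i hi).1) fun i hi j hj hij => by
      have := hsep i j hij
      linarith [(hSn i hi).2.1]
    have hout : ∀ i ∉ S, ∀ z ∈ Metric.closedBall x δ, ϱ (b i) / 5 < ‖z - b i‖ := by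
      intro i hi z hz
      have h1 : ¬ ‖b i - x‖ ≤ ϱ (b i) / 5 + δ := fun h => hi (by simp [hS, h])
      have h2 : ‖z - x‖ ≤ δ := by simpa [dist_eq_norm] using hz
      have h3 : ‖b i - x‖ ≤ ‖z - b i‖ + ‖z - x‖ := by
        rw [norm_sub_rev z]; exact norm_sub_le_norm_sub_add_norm_sub _ _ _
      push Not at h1
      linarith
    have hxδ : x ∈ Metric.closedBall x δ := Metric.mem_closedBall_self hδ0.le
    have hSCφ : ∀ i ∈ S, SC m ϑ δ A univ (φ i) := fun i hi =>
      (hφS i).mono_scale hϑ (by linarith) hδ0 (by linarith [(hSn i hi).2.1])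
    have hnear : ∀ i ∈ S, ‖x - b i‖ ≤ ϱ (b i) := fun i hi => by
      rw [norm_sub_rev]
      linarith [(hSn i hi).1, (hSn i hi).2.1]
    have hwn : ∀ i ∈ S, wn m δ (F (b i) x) ≤ Q * M * δ ^ s := by
      intro i hi
      obtain ⟨-, h2, h3⟩ := hSn i hi
      refine (wn_mono hδ0.le (by linarith) _).trans ((hup _ (hbU i) x (hnear i hi)).trans ?_)
      have h4 : ϱ (b i) ^ s ≤ 41 ^ s * δ ^ s := by
        rw [← Real.mul_rpow (by norm_num) hδ0.le]
        exact Real.rpow_le_rpow (by linarith) h3 hs0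
      calc _ ≤ C * M * (41 ^ s * δ ^ s) := mul_le_mul_of_nonneg_left h4 (by positivity)
        _ = _ := by rw [hQ]; ring
    refine ⟨δ, hδ0, by linarith [hϱ1 _ (hbU i₀)], ?_, ?_⟩
    · refine hC₁ k ϑ (Q * M) δ x (Metric.closedBall x δ) ψ (fun i => F (b i)) S hϑ hϑ1
        (by positivity) hδ0 (convex_closedBall x δ) hxδ
        (fun z hz => by simpa [dist_eq_norm] using hz) hcard (fun i hi => ?_) (fun i hi z hz => ?_)
        (fun i _ => hF _ (hbU i)) (fun i _ => ?_) hwn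
      · exact ((hSCφ i hi).pow hδ0 hA1 (m + 1)).mono_set (subset_univ _)
      · exact hψ0' i z (hout i hi z hz)
      · exact ((hFH _ (hbU i)).mono_set (subset_univ _)).mono_const (by gcongr)
    · refine hC₂ k ϑ M δ x φ (fun i => F (b i) x) S hϑ hϑ1 hM hδ0 hcard
        (fun i hi => hφ0' i x (hout i hi x hxδ)) (fun i hi => (hSCφ i hi).bd x (mem_univ _))
        (fun i => (hφ01 i x).1) (fun i => (hφ01 i x).2) hwn (fun i hi => ?_)
      refine le_trans ?_ (hlow _ (hbU i) x (hnear i hi))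
      refine mul_le_mul_of_nonneg_left (Real.rpow_le_rpow hδ0.le ?_ hs0) hM.le
      linarith [(hSn i hi).2.1]
  have hcases : ∀ x, JEq m (T x) 0 ∨ ∃ δ, 0 < δ ∧ δ ≤ 1 ∧
      SC m ϑ δ (C₁ * (Q * M * δ ^ s)) (Metric.closedBall x δ) T ∧ 0 ≤ (T x).coeff 0 ∧
      (∀ δ', δ ≤ δ' → wn m δ' (T x) ≤ C₂ * M * δ' ^ s) ∧
      ∀ δ', 0 < δ' → (T x).coeff 0 ≤ M * δ' ^ s → wn m δ' (T x) ≤ C₂ * M * δ' ^ s := by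
    intro x
    by_cases h : ∀ i, ϱ (b i) / 5 < ‖x - b i‖
    · exact Or.inl (hinact x h)
    · push Not at h
      obtain ⟨i, hi⟩ := h
      exact Or.inr (hact x i hi)
  have hC₂K : ∀ r : ℝ, 0 ≤ r → C₂ * M * r ≤ (2 * (C₁ * Q) + C₂) * M * r := fun r hr => by
    have : 0 ≤ C₁ * Q * (M * r) := by positivity
    nlinarith
  have hhold : ∀ α : Fin n →₀ ℕ, α.degree = m → ∀ x y,
      |(T x).coeff α| ≤ C₁ * Q * M * ‖x - y‖ ^ ϑ ∨
        |(T x).coeff α - (T y).coeff α| ≤ C₁ * Q * M * ‖x - y‖ ^ ϑ := by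
    intro α hα x y
    rcases hcases x with h | ⟨δ, hδ, -, hsc, -⟩
    · left
      rw [h α hα.le]; simp; positivity
    have hxδ : x ∈ Metric.closedBall x δ := Metric.mem_closedBall_self hδ.le
    rcases le_total ‖x - y‖ δ with hxy | hxy
    · right
      have h1 := hsc.hsOn hδ α hα x hxδ y
        (by rwa [Metric.mem_closedBall, dist_eq_norm, norm_sub_rev])
      refine h1.trans (le_of_eq ?_)
      have : δ ^ s ≠ 0 := (Real.rpow_pos_of_pos hδ s).ne'
      change C₁ * (Q * M * δ ^ s) / δ ^ s * _ = _
      rw [← mul_assoc C₁, mul_div_cancel_right₀ _ this, ← mul_assoc C₁]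
    · left
      have h1 := abs_coeff_le_of_wn_le (B := C₁ * Q * M) (ϑ := ϑ) hδ
        ((hsc.bd x hxδ).trans (le_of_eq (by ring))) hα
      refine h1.trans (mul_le_mul_of_nonneg_left ?_ (by positivity))
      exact Real.rpow_le_rpow hδ.le hxy hϑ.le
  refine ⟨T, ⟨hT, ?_, ?_, ?_, ?_⟩, ?_⟩
  · intro α hα x _ y _
    have hr : 0 ≤ ‖x - y‖ ^ ϑ := by positivity
    have hb : 0 ≤ C₁ * Q * M * ‖x - y‖ ^ ϑ := by positivity
    have hb2 : 0 ≤ C₂ * M * ‖x - y‖ ^ ϑ := by positivity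
    have e : (2 * (C₁ * Q) + C₂) * M * ‖x - y‖ ^ ϑ =
      2 * (C₁ * Q * M * ‖x - y‖ ^ ϑ) + C₂ * M * ‖x - y‖ ^ ϑ := by ring
    rw [e]
    have h1 := hhold α hα x y
    have h2 := hhold α hα y x
    rw [norm_sub_rev y x, abs_sub_comm ((T y).coeff α)] at h2
    have h3 := abs_sub ((T x).coeff α) ((T y).coeff α)
    rcases h1 with h1 | h1
    · rcases h2 with h2 | h2 <;> linarith
    · linarith
  · intro x
    rcases hcases x with h | ⟨δ, -, -, -, h, -⟩
    · rw [h.coeff_zero]; simp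
    · exact h
  · intro x
    rcases hcases x with h | ⟨δ, -, hδ1, -, -, h, -⟩
    · rw [h.wn_eq, wn_zero]; positivity
    · have h1 := h 1 hδ1
      have h2 := hC₂K (1 ^ s) (by positivity)
      rw [Real.one_rpow, mul_one] at h1 h2
      rw [mul_one] at h2
      exact h1.trans h2
  · intro x δ' hδ' hx
    rcases hcases x with h | ⟨δ, -, -, -, -, -, h⟩
    · rw [h.wn_eq, wn_zero]; positivity
    · exact (h δ' hδ' hx).trans (hC₂K _ (by positivity))
  · intro e he
    have h1 : (T e).coeff 0 = (∑ i, pou ψ i e).coeff 0 * f e := by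
      rw [hTdef, MvPolynomial.coeff_sum, MvPolynomial.coeff_sum, Finset.sum_mul]
      refine Finset.sum_congr rfl fun i _ => ?_
      rw [coeff_zero_mul, hval _ (hbU i) e he]
    by_cases heU : e ∈ U
    · obtain ⟨i, hi⟩ := hcov e heU
      have h2 : JEq m (ψ i e) 1 := by simpa using (hφ1' i e hi).pow (m + 1)
      rw [h1, (sum_pou_jeq h2).coeff_zero, coeff_zero_one, one_mul]
    · rw [h1, hzero e he heU, mul_zero]

end

section

variable {n m : ℕ} {ϑ : ℝ}

/-- A slowly varying lower envelope of a positive function on a finite set. -/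
theorem exists_slow_radius {U : Finset (Sp n)} (hU : U.Nonempty) {g : Sp n → ℝ} {c Q : ℝ}
    (hc : 0 < c) (hc1 : c ≤ 1 / 100) (hQ : 1 ≤ Q)
    (hgQ : ∀ x ∈ U, ∀ y ∈ U, g y ≤ Q * (g x + ‖y - x‖)) :
    ∃ ϱ : Sp n → ℝ, (∀ p q, ϱ p ≤ ϱ q + ‖p - q‖ / 100) ∧ (∀ p ∈ U, ϱ p ≤ c * g p) ∧
      ∀ p ∈ U, c * g p ≤ Q * ϱ p := by
  refine ⟨fun p => U.inf' hU fun e => c * g e + ‖p - e‖ / 100, fun p q => ?_, fun p hp => ?_,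
    fun p hp => ?_⟩
  · obtain ⟨e, he, h⟩ := Finset.exists_mem_eq_inf' hU fun e => c * g e + ‖q - e‖ / 100
    have h1 := Finset.inf'_le (fun e => c * g e + ‖p - e‖ / 100) he
    have h2 := norm_sub_le_norm_sub_add_norm_sub p q e
    simp only at h h1 ⊢
    rw [h]
    linarith
  · have h1 := Finset.inf'_le (fun e => c * g e + ‖p - e‖ / 100) hp
    exact h1.trans_eq (by simp)
  · obtain ⟨e, he, h⟩ := Finset.exists_mem_eq_inf' hU fun e => c * g e + ‖p - e‖ / 100
    simp only at h ⊢
    rw [h]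
    have h1 := mul_le_mul_of_nonneg_left (hgQ e he p hp) hc.le
    have h2 := mul_le_mul_of_nonneg_right hc1 (norm_nonneg (p - e))
    have h3 : Q * (c * ‖p - e‖) ≤ Q * (1 / 100 * ‖p - e‖) :=
      mul_le_mul_of_nonneg_left h2 (by linarith)
    linarith

set_option maxHeartbeats 800000 in
/-- Finiteness principle for flat nonnegative towers. -/
theorem exists_flat_interpolant (n m : ℕ) {C : ℝ} (hϑ : 0 < ϑ) (hϑ1 : ϑ ≤ 1) (hC : 1 ≤ C) :
    ∃ (k : ℕ) (K : ℝ), 1 ≤ K ∧ ∀ (E : Finset (Sp n)) (f : Sp n → ℝ) (M : ℝ), 0 < M →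
      (∀ e ∈ E, 0 ≤ f e) →
      (∀ S ⊆ E, S.card ≤ k → ∃ T, IsFlat m ϑ M C T ∧ ∀ e ∈ S, (T e).coeff 0 = f e) →
      ∃ T, IsFlat m ϑ M K T ∧ ∀ e ∈ E, (T e).coeff 0 = f e := by
  classical
  obtain ⟨k, C', hCC', hext⟩ := exists_flat_extension n m hϑ hϑ1 hC
  have hC' : 1 ≤ C' := hC.trans hCC'
  obtain ⟨c₀, hc₀, hc₀1, hnear⟩ := exists_near_bound n m hϑ hϑ1 hC'
  obtain ⟨Q₀, hQ₀, hcmp⟩ := exists_isFlat_compare n m hϑ hϑ1 hC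
  set s : ℝ := m + ϑ with hs
  have hs0 : 0 < s := by positivity
  set B : ℝ := C ^ (1 / s) with hB
  have hB1 : 1 ≤ B := Real.one_le_rpow hC (by positivity)
  set Q : ℝ := Q₀ ^ (1 / s) with hQdef
  have hQ : 1 ≤ Q := Real.one_le_rpow hQ₀ (by positivity)
  set c : ℝ := c₀ / B with hcdef
  have hc : 0 < c := by positivity
  have hcc₀ : c ≤ c₀ := div_le_self hc₀.le hB1
  have hQc : 1 ≤ Q / c := by rw [le_div_iff₀ hc]; linarith
  set K₀ : ℝ := (C' + 1) * (Q / c) ^ s with hK₀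
  have hQcs : 1 ≤ (Q / c) ^ s := Real.one_le_rpow hQc hs0.le
  have hK₀C' : C' ≤ K₀ := by rw [hK₀]; nlinarith
  obtain ⟨K, hK, hglue⟩ := exists_flat_glue n m hϑ hϑ1 (hC'.trans hK₀C')
  refine ⟨max k 2, K, hK, fun E f M hM hf H => ?_⟩
  have hroot : ∀ {a : ℝ}, 0 ≤ a → (a ^ (1 / s)) ^ s = a := fun ha => by
    rw [← Real.rpow_mul ha, one_div_mul_cancel hs0.ne', Real.rpow_one]
  set g : Sp n → ℝ := fun e => (f e / M) ^ (1 / s) with hg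
  have hfg : ∀ e ∈ E, f e = M * g e ^ s := fun e he => by
    rw [hg]; simp only
    rw [hroot (div_nonneg (hf e he) hM.le)]
    field_simp
  set U : Finset (Sp n) := E.filter fun e => 0 < f e with hU
  have hUE : ∀ {p}, p ∈ U → p ∈ E := fun hp => (Finset.mem_filter.1 hp).1
  have hgpos : ∀ p ∈ U, 0 < g p := fun p hp =>
    Real.rpow_pos_of_pos (div_pos (Finset.mem_filter.1 hp).2 hM) _
  have hgB : ∀ p ∈ U, g p ≤ B := fun p hp => by
    obtain ⟨T, hT, hTf⟩ := H {p} (by simpa using hUE hp) (by simp)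
    have h1 := (le_abs_self _).trans ((abs_coeff_zero_le_wn (m := m) zero_le_one (T p)).trans
      (hT.bd p))
    rw [hTf p (by simp)] at h1
    exact Real.rpow_le_rpow (div_nonneg (hf p (hUE hp)) hM.le) ((div_le_iff₀ hM).2 h1)
      (by positivity)
  have hgQ : ∀ x ∈ U, ∀ y ∈ U, g y ≤ Q * (g x + ‖y - x‖) := fun x hx y hy => by
    obtain ⟨T, hT, hTf⟩ := H {x, y} (by
      intro z hz
      rcases Finset.mem_insert.1 hz with rfl | hz
      · exact hUE hx
      · rw [Finset.mem_singleton.1 hz]; exact hUE hy) (Finset.card_le_two.trans (le_max_right _ _))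
    have hgx := hgpos x hx
    have hgy := hgpos y hy
    have hδ : 0 < g x + ‖y - x‖ := by positivity
    have h1 := hcmp M (g x + ‖y - x‖) T x y hM hδ hT (by
      rw [hTf x (by simp), hfg x (hUE hx)]
      gcongr
      linarith [norm_nonneg (y - x)]) (by linarith)
    rw [hTf y (by simp), hfg y (hUE hy)] at h1
    have h2 : g y ^ s ≤ (Q * (g x + ‖y - x‖)) ^ s := by
      rw [Real.mul_rpow (by positivity) hδ.le, hQdef, hroot (a := Q₀) (by positivity)]
      refine le_of_mul_le_mul_left (h1.trans_eq ?_) hM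
      ring
    exact (Real.rpow_le_rpow_iff hgy.le (by positivity) hs0).1 h2
  rcases U.eq_empty_or_nonempty with hUe | hUne
  · obtain ⟨T, hT, hTf⟩ := hglue M 1 ∅ ↑E f (fun _ => 1) (fun _ _ => 0) hM
      Bornology.isBounded_empty one_pos (by simp) (by simp) (by simp) (by simp) (by simp)
      (by simp) (by simp) (by simp) (fun e he _ => by
        have h1 : e ∉ U := by simp [hUe]
        have h2 : ¬ 0 < f e := fun h => h1 (Finset.mem_filter.2 ⟨he, h⟩)
        exact le_antisymm (not_lt.1 h2) (hf e he))
    exact ⟨T, hT, hTf⟩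
  obtain ⟨ϱ, hϱL, hϱc, hϱQ⟩ := exists_slow_radius hUne hc (hcc₀.trans hc₀1) hQ hgQ
  have hϱpos : ∀ p ∈ U, 0 < ϱ p := fun p hp => by
    have h1 := (mul_pos hc (hgpos p hp)).trans_le (hϱQ p hp)
    exact pos_of_mul_pos_right h1 (by linarith)
  have hϱg : ∀ p ∈ U, ϱ p ≤ g p := fun p hp =>
    (hϱc p hp).trans (mul_le_of_le_one_left (hgpos p hp).le (by linarith))
  choose! F hF hFg using fun b (hb : b ∈ U) => hext E f M (g b) b hM (hgpos b hb) (hUE hb)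
    (hfg b (hUE hb)).le fun S hS hSk => H S hS (hSk.trans (le_max_left _ _))
  have hball : ∀ p ∈ U, ∀ x, ‖x - p‖ ≤ ϱ p →
      wn m (g p) (F p x - F p p) ≤ M * g p ^ s / 2 := fun p hp x hx => by
    refine hnear M (g p) (F p) p x hM (hgpos p hp) (hF p hp).tow (hF p hp).hs (hFg p hp) ?_
    exact hx.trans ((hϱc p hp).trans (mul_le_mul_of_nonneg_right hcc₀ (hgpos p hp).le))
  obtain ⟨p₀, hp₀, hmin⟩ := U.exists_min_image ϱ hUne
  refine hglue M (ϱ p₀) ↑U ↑E f ϱ F hM U.finite_toSet.isBounded (hϱpos p₀ hp₀)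
    (fun p hp => hmin p hp) (fun p hp => ?_) (fun p _ q _ => hϱL p q)
    (fun p hp => (hF p hp).tow) (fun p hp α hα x hx y hy => ((hF p hp).hs α hα x hx y hy).trans ?_)
    (fun p hp x hx => ?_) (fun p hp x hx => ?_) (fun p hp e he => (hF p hp).val e he) (fun e he heU => ?_)
  · have h1 := mul_le_mul_of_nonneg_left (hgB p hp) hc.le
    have h2 : c * B = c₀ := by rw [hcdef]; field_simp
    linarith [hϱc p hp]
  · gcongr
  · have h1 := (abs_coeff_zero_le_wn (m := m) (hgpos p hp).le _).trans (hball p hp x hx)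
    rw [MvPolynomial.coeff_sub, (hF p hp).val p (hUE hp), hfg p (hUE hp)] at h1
    have h2 := (abs_le.1 h1).1
    have h3 : M * ϱ p ^ s ≤ M * g p ^ s := mul_le_mul_of_nonneg_left
      (Real.rpow_le_rpow (hϱpos p hp).le (hϱg p hp) hs0.le) hM.le
    linarith
  · have hgp := hgpos p hp
    have h1 := wn_mono (m := m) (hϱpos p hp).le (hϱg p hp) (F p x)
    have h2 := wn_le_add_sub (m := m) hgp.le (F p x) (F p p)
    have h3 := hball p hp x hx
    have h4 := hFg p hp
    have h5 : g p ^ s ≤ (Q / c) ^ s * ϱ p ^ s := by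
      rw [← Real.mul_rpow (by positivity) (hϱpos p hp).le]
      refine Real.rpow_le_rpow hgp.le ?_ hs0.le
      rw [div_mul_eq_mul_div, le_div_iff₀ hc, mul_comm]
      exact hϱQ p hp
    have h6 : 0 ≤ M * g p ^ s := by positivity
    calc _ ≤ (C' + 1) * M * g p ^ s := by linarith
      _ ≤ (C' + 1) * M * ((Q / c) ^ s * ϱ p ^ s) := by gcongr
      _ = _ := by rw [hK₀]; ring
  · have h2 : ¬ 0 < f e := fun h => heU (Finset.mem_filter.2 ⟨he, h⟩)
    exact le_antisymm (not_lt.1 h2) (hf e he)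

end

end FlatFP

theorem traceNorm_mono {V : Type*} [NormedAddCommGroup V] [NormedSpace ℝ V] (s : ℝ) {S S' : Set V}
    (h : S ⊆ S') (f : V → ℝ) : traceNorm s S f ≤ traceNorm s S' f :=
  le_iInf₂ fun F hF => iInf₂_le F ⟨hF.1, fun x hx => hF.2 x (h hx)⟩

/-- Theorem `fp-finite`, Finiteness Principle for `F^s`,
finite-set version: there exist `k♯ = k♯(n,s)` and `C♯ = C♯(n,s)` such that
for every finite `E ⊆ ℝⁿ` and `f : E → [0,∞)`,
`max_{S ⊆ E, #S ≤ k♯} ‖f‖_{F^s(S)} ≤ ‖f‖_{F^s(E)} ≤ C♯ max_{S ⊆ E, #S ≤ k♯} ‖f‖_{F^s(S)}`. -/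
theorem statement17 (n : ℕ) (hn : 1 ≤ n) (s : ℝ) (hs : 0 < s) :
    ∃ (k : ℕ) (C : ℝ), 0 < C ∧
      ∀ (Eset : Set (EuclideanSpace ℝ (Fin n))), Eset.Finite →
      ∀ f : EuclideanSpace ℝ (Fin n) → ℝ, (∀ x ∈ Eset, 0 ≤ f x) →
        (⨆ (S : Set (EuclideanSpace ℝ (Fin n)))
            (_ : S ⊆ Eset ∧ S.Finite ∧ S.ncard ≤ k), traceNorm s S f) ≤
          traceNorm s Eset f ∧
        traceNorm s Eset f ≤ ENNReal.ofReal C *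
          ⨆ (S : Set (EuclideanSpace ℝ (Fin n)))
            (_ : S ⊆ Eset ∧ S.Finite ∧ S.ncard ≤ k), traceNorm s S f := by
  have hϑ : 0 < s - lowFloor s := sub_pos.2 (FlatFP.lowFloor_lt hs)
  have hϑ1 : s - lowFloor s ≤ 1 := by linarith [FlatFP.le_lowFloor_add_one s]
  obtain ⟨C₀, hC₀, htay⟩ := FlatFP.exists_isFlat_tay n hs
  obtain ⟨k, K, hK, hcore⟩ := FlatFP.exists_flat_interpolant n (lowFloor s) hϑ hϑ1 hC₀
  obtain ⟨K', hK', hback⟩ := FlatFP.exists_fsNorm_le n hs hK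
  refine ⟨k, K', hK', fun Eset hE f hf =>
    ⟨iSup₂_le fun S hS => traceNorm_mono s hS.1 f, ?_⟩⟩
  have hK'0 : ENNReal.ofReal K' ≠ 0 := by simpa using hK'
  rw [mul_comm, ← ENNReal.div_le_iff hK'0 ofReal_ne_top]
  refine le_of_forall_gt_imp_ge_of_dense fun a ha => ?_
  rcases eq_or_ne a ⊤ with rfl | hatop
  · exact le_top
  have ha0 : 0 < a := bot_le.trans_lt ha
  have hM : 0 < a.toReal := ENNReal.toReal_pos ha0.ne' hatop
  rw [ENNReal.div_le_iff hK'0 ofReal_ne_top]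
  obtain ⟨T, hT, hTf⟩ := hcore hE.toFinset f a.toReal hM (fun e he => hf e (by simpa using he))
    (fun S hS hSk => by
      have h1 := (le_iSup₂_of_le (f := fun (S : Set (EuclideanSpace ℝ (Fin n)))
        (_ : S ⊆ Eset ∧ S.Finite ∧ S.ncard ≤ k) => traceNorm s S f) (↑S) ⟨fun x hx => by
          simpa using hS hx, S.finite_toSet, by rwa [Set.ncard_coe_finset]⟩ le_rfl).trans_lt ha
      simp only [traceNorm, iInf_lt_iff] at h1
      obtain ⟨F, hF, hFa⟩ := h1
      refine ⟨_, htay a.toReal hM F hF.1 ?_, fun e he => ?_⟩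
      · rw [ENNReal.ofReal_toReal hatop]; exact hFa.le
      · rw [FlatFP.coeff_zero_tay]; exact hF.2 e he)
  obtain ⟨h1, h2⟩ := hback _ hM T hT
  refine (iInf₂_le _ ⟨h1, fun x hx => hTf x (by simpa using hx)⟩).trans (h2.trans_eq ?_)
  rw [mul_comm, ENNReal.ofReal_mul hM.le, ENNReal.ofReal_toReal hatop]

end
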